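/- Let S₁ and S₂ be disjoint finite sets of prime numbers. For x > 0 let N(x) denote the set of negative fundamental discriminants Δ with |Δ| < x such that 3 does not divide h(Δ), no prime p ∈ S₁ splits in ℚ(√Δ), and every prime p ∈ S₂ either splits or ramifies in ℚ(√Δ). Then the limit inferior, as x → ∞, of the ratio #N(x) / #{negative fundamental discriminants Δ with |Δ| < x} is at least (1/2) · ∏_{p ∈ S₁ ∪ S₂} n_p, where n_p = (p+2)/(2(p+1)) if p is odd and n_2 = 1/24. -/

import Mathlib

open IntermediateField Filter

/-- A fundamental discriminant: `Δ ≠ 1` and either `Δ ≡ 1 (mod 4)` and `Δ` squarefree,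
or `Δ ≡ 0 (mod 4)`, `Δ/4` squarefree and `Δ/4 ≡ 2, 3 (mod 4)`. -/
def IsFundamentalDiscriminant (Δ : ℤ) : Prop :=
  Δ ≠ 1 ∧ ((Δ % 4 = 1 ∧ Squarefree Δ) ∨
    (Δ % 4 = 0 ∧ Squarefree (Δ / 4) ∧ ((Δ / 4) % 4 = 2 ∨ (Δ / 4) % 4 = 3)))

/-- The quadratic field ℚ(√Δ), realized inside ℂ. -/
noncomputable def quadField (Δ : ℤ) : IntermediateField ℚ ℂ :=
  ℚ⟮(Δ : ℂ) ^ ((1 : ℂ) / 2)⟯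

/-- The class number `h(Δ)` of ℚ(√Δ): the cardinality of the ideal class group of its
ring of integers. -/
noncomputable def classNum (Δ : ℤ) : ℕ :=
  Nat.card (ClassGroup (integralClosure ℤ (quadField Δ)))

/-- The prime `p` splits in ℚ(√Δ): for odd `p` the Legendre symbol `(Δ/p)` is `1`,
and for `p = 2` one has `Δ ≡ 1 (mod 8)`. -/
def SplitsIn (p : ℕ) (Δ : ℤ) : Prop :=
  if p = 2 then Δ % 8 = 1
  else if hp : p.Prime then @legendreSym p ⟨hp⟩ Δ = 1 else False

/-- The prime `p` ramifies in ℚ(√Δ): for odd `p` one has `p ∣ Δ`,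
and for `p = 2` one has `Δ ≡ 0 (mod 4)`. -/
def RamifiesIn (p : ℕ) (Δ : ℤ) : Prop :=
  if p = 2 then Δ % 4 = 0 else (p : ℤ) ∣ Δ

/-- The reduced discriminant of the binary cubic form `a x³ + 3 b x² y + 3 c x y² + d y³`. -/
def cubicDisc {R : Type*} [CommRing R] (a b c d : R) : R :=
  a ^ 2 * d ^ 2 - 3 * b ^ 2 * c ^ 2 + 4 * a * c ^ 3 + 4 * b ^ 3 * d - 6 * a * b * c * d

/-- The discriminant of the Hessian is the reduced discriminant. -/
theorem hessian_disc {R : Type*} [CommRing R] (a b c d : R) :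
    (a * d - b * c) ^ 2 - 4 * (b ^ 2 - a * c) * (c ^ 2 - b * d) = cubicDisc a b c d := by
  unfold cubicDisc; ring

/-- The syzygy between the covariants of a binary cubic form. -/
theorem cubic_syzygy {R : Type*} [CommRing R] (a b c d : R) :
    a ^ 2 * cubicDisc a b c d =
      (a ^ 2 * d - 3 * a * b * c + 2 * b ^ 3) ^ 2 - 4 * (b ^ 2 - a * c) ^ 3 := by
  unfold cubicDisc; ring

/-- The form `a x³ + 3 b x² y + 3 c x y² + d y³` has no nontrivial integral zero. -/
def CubicAnisotropic (a b c d : ℤ) : Prop :=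
  ∀ x y : ℤ, a * x ^ 3 + 3 * b * x ^ 2 * y + 3 * c * x * y ^ 2 + d * y ^ 3 = 0 → x = 0 ∧ y = 0

theorem CubicAnisotropic.left_ne_zero {a b c d : ℤ} (h : CubicAnisotropic a b c d) : a ≠ 0 := by
  intro ha
  have := h 1 0 (by simp [ha])
  simp at this

theorem CubicAnisotropic.translate {a b c d : ℤ} (h : CubicAnisotropic a b c d) (k : ℤ) :
    CubicAnisotropic a (b + k * a) (c + 2 * k * b + k ^ 2 * a)
      (d + 3 * k * c + 3 * k ^ 2 * b + k ^ 3 * a) := by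
  intro x y hxy
  have := h (x + k * y) y (by linear_combination hxy)
  obtain ⟨h1, h2⟩ := this
  subst h2
  simpa using h1

theorem CubicAnisotropic.swap {a b c d : ℤ} (h : CubicAnisotropic a b c d) :
    CubicAnisotropic d c b a := by
  intro x y hxy
  have := h y x (by linear_combination hxy)
  exact this.symm

theorem hessian_pos {a b c d : ℤ} (ha : a ≠ 0) (hD : cubicDisc a b c d < 0) :
    0 < b ^ 2 - a * c := by
  have h := cubic_syzygy a b c d
  have ha2 : 0 < a ^ 2 := by positivity
  have : 0 < (b ^ 2 - a * c) ^ 3 := by nlinarith [sq_nonneg (a ^ 2 * d - 3 * a * b * c + 2 * b ^ 3)]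
  exact (Odd.pow_pos_iff (by decide)).1 this

/-- An anisotropic form of negative reduced discriminant is equivalent to one with positive leading
coefficient and reduced Hessian. -/
theorem exists_reduced_cubic {a b c d : ℤ} (h : CubicAnisotropic a b c d)
    (hD : cubicDisc a b c d < 0) :
    ∃ a' b' c' d' : ℤ, cubicDisc a' b' c' d' = cubicDisc a b c d ∧ 0 < a' ∧
      0 ≤ a' * d' - b' * c' ∧ a' * d' - b' * c' ≤ b' ^ 2 - a' * c' ∧
      b' ^ 2 - a' * c' ≤ c' ^ 2 - b' * d' := by
  induction hn : (b ^ 2 - a * c).toNat using Nat.strong_induction_on generalizing a b c d with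
  | _ n ih =>
    have hA := hessian_pos h.left_ne_zero hD
    set A := b ^ 2 - a * c with hAdef
    set B := a * d - b * c with hBdef
    -- translate so that `|B| ≤ A`
    obtain ⟨k, hk1, hk2⟩ : ∃ k : ℤ, -A ≤ B - 2 * k * A ∧ B - 2 * k * A ≤ A := by
      refine ⟨(B + A) / (2 * A), ?_, ?_⟩
      · have := Int.emod_add_mul_ediv (B + A) (2 * A)
        have := Int.emod_nonneg (B + A) (b := 2 * A) (by omega)
        linarith
      · have := Int.emod_add_mul_ediv (B + A) (2 * A)
        have := Int.emod_lt_of_pos (B + A) (b := 2 * A) (by omega)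
        linarith
    have ht := h.translate k
    set b₁ := b + k * a with hb₁
    set c₁ := c + 2 * k * b + k ^ 2 * a with hc₁
    set d₁ := d + 3 * k * c + 3 * k ^ 2 * b + k ^ 3 * a with hd₁
    have hA₁ : b₁ ^ 2 - a * c₁ = A := by rw [hb₁, hc₁, hAdef]; ring
    have hB₁ : a * d₁ - b₁ * c₁ = B - 2 * k * A := by
      rw [hb₁, hc₁, hd₁, hAdef, hBdef]; ring
    have hD₁ : cubicDisc a b₁ c₁ d₁ = cubicDisc a b c d := by
      rw [hb₁, hc₁, hd₁]; unfold cubicDisc; ring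
    rw [← hB₁] at hk1 hk2
    by_cases hC : A ≤ c₁ ^ 2 - b₁ * d₁
    · rcases le_total 0 (a * d₁ - b₁ * c₁) with hB | hB
      · rcases lt_or_gt_of_ne h.left_ne_zero with ha | ha
        · exact ⟨-a, -b₁, -c₁, -d₁, by rw [← hD₁]; unfold cubicDisc; ring, by omega,
            by linarith, by linarith, by linarith⟩
        · exact ⟨a, b₁, c₁, d₁, hD₁, ha, hB, by linarith, by linarith⟩
      · rcases lt_or_gt_of_ne h.left_ne_zero with ha | ha
        · exact ⟨-a, b₁, -c₁, d₁, by rw [← hD₁]; unfold cubicDisc; ring, by omega,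
            by linarith, by linarith, by linarith⟩
        · exact ⟨a, -b₁, c₁, -d₁, by rw [← hD₁]; unfold cubicDisc; ring, by omega,
            by linarith, by linarith, by linarith⟩
    · have hs := ht.swap
      have hDs : cubicDisc d₁ c₁ b₁ a = cubicDisc a b c d := by
        rw [← hD₁]; unfold cubicDisc; ring
      have hAs := hessian_pos hs.left_ne_zero (hDs ▸ hD)
      have := ih (c₁ ^ 2 - d₁ * b₁).toNat (by
        rw [mul_comm d₁ b₁] at hAs ⊢; omega) hs (hDs ▸ hD) rfl
      rwa [hDs] at this

theorem Nat.exists_eq_cube_of_cube_mul_eq {k n c : ℕ} (hn : n ≠ 0) (hc : c ≠ 0)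
    (h : k ^ 3 = n ^ 3 * c ^ 2) : ∃ m, c = m ^ 3 := by
  have hd : n ∣ k := (Nat.pow_dvd_pow_iff (n := 3) (by norm_num)).1 ⟨_, h⟩
  obtain ⟨l, rfl⟩ := hd
  have h1 : l ^ 3 = c ^ 2 := by
    have : n ^ 3 * l ^ 3 = n ^ 3 * c ^ 2 := by rw [← h]; ring
    exact Nat.eq_of_mul_eq_mul_left (by positivity) this
  have hl : l ≠ 0 := by
    rintro rfl
    simp at h1
    exact hc (by simpa using h1.symm)
  have hd : l ∣ c := (Nat.pow_dvd_pow_iff (n := 2) (by norm_num)).1 ⟨l, by rw [← h1]; ring⟩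
  obtain ⟨m, rfl⟩ := hd
  refine ⟨m, ?_⟩
  have : l ^ 2 * l = l ^ 2 * m ^ 2 := by linear_combination h1
  have := Nat.eq_of_mul_eq_mul_left (by positivity) this
  rw [this]; ring

theorem Ideal.eq_of_pow_eq_pow {O : Type*} [CommRing O] [IsDedekindDomain O] {I J : Ideal O}
    (hI : I ≠ ⊥) (hJ : J ≠ ⊥) {n : ℕ} (hn : n ≠ 0) (h : I ^ n = J ^ n) : I = J := by
  classical
  have h1 := congrArg UniqueFactorizationMonoid.normalizedFactors h
  rw [UniqueFactorizationMonoid.normalizedFactors_pow,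
    UniqueFactorizationMonoid.normalizedFactors_pow] at h1
  have h2 : UniqueFactorizationMonoid.normalizedFactors I =
      UniqueFactorizationMonoid.normalizedFactors J := by
    ext p
    have := congrArg (Multiset.count p) h1
    simp only [Multiset.count_nsmul] at this
    exact Nat.eq_of_mul_eq_mul_left (Nat.pos_of_ne_zero hn) this
  exact associated_iff_eq.1
    ((UniqueFactorizationMonoid.associated_iff_normalizedFactors_eq_normalizedFactors hI hJ).2 h2)

/-- If `I³ = (δ)` and some nonzero `α ∈ I` has `α³ ∈ δℤ`, then `I` is principal. -/
theorem Ideal.isPrincipal_of_cube_eq {O : Type*} [CommRing O] [IsDedekindDomain O]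
    [Module.Free ℤ O] [Module.Finite ℤ O] (hnorm : ∀ m : ℤ, Ideal.absNorm
      (Ideal.span {(m : O)}) = m.natAbs ^ 2) {I : Ideal O} {δ α : O} (hI : I ≠ ⊥)
    (hδ : I ^ 3 = Ideal.span {δ}) (hα : α ≠ 0) {c : ℤ} (h : α ^ 3 = δ * (c : O)) :
    Submodule.IsPrincipal I := by
  have hspan : (Ideal.span {α}) ^ 3 = I ^ 3 * Ideal.span {(c : O)} := by
    rw [hδ, Ideal.span_singleton_pow, Ideal.span_singleton_mul_span_singleton, h]
  have hc : c ≠ 0 := by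
    rintro rfl
    simp at h
    exact hα h
  have hN := congrArg Ideal.absNorm hspan
  rw [map_mul, map_pow, map_pow, hnorm] at hN
  have hI0 : Ideal.absNorm I ≠ 0 := by
    have : Module.IsTorsionFree ℤ O := inferInstance
    exact fun h0 => hI (Ideal.absNorm_eq_zero_iff.1 h0)
  obtain ⟨m, hm⟩ := Nat.exists_eq_cube_of_cube_mul_eq hI0 (Int.natAbs_ne_zero.2 hc) hN
  have hm0 : m ≠ 0 := by
    rintro rfl
    simp at hm
    exact hc hm
  have hcm : Ideal.span {(c : O)} = (Ideal.span {((m : ℤ) : O)}) ^ 3 := by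
    rw [Ideal.span_singleton_pow, Ideal.span_singleton_eq_span_singleton]
    have : Associated c ((m : ℤ) ^ 3) := by
      rw [Int.associated_iff_natAbs, hm, Int.natAbs_pow]; simp
    simpa using this.map (Int.castRingHom O)
  have hm' : Ideal.span {((m : ℤ) : O)} ≠ ⊥ := by
    intro h0
    have h1 := hnorm m
    rw [h0, Ideal.absNorm_bot] at h1
    simp at h1
    exact hm0 (by simpa using h1.symm)
  have heq : Ideal.span {α} = I * Ideal.span {((m : ℤ) : O)} := by
    refine Ideal.eq_of_pow_eq_pow (by simpa using hα) (mul_ne_zero hI hm') (n := 3) (by norm_num) ?_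
    rw [hspan, hcm, mul_pow]
  have hmem0 : (m : O) ≠ 0 := by
    intro h0; apply hm'; simp [h0]
  have hIn : I ∈ nonZeroDivisors (Ideal O) := mem_nonZeroDivisors_of_ne_zero hI
  have hmn : Ideal.span {((m : ℤ) : O)} ∈ nonZeroDivisors (Ideal O) :=
    mem_nonZeroDivisors_of_ne_zero hm'
  have hαn : Ideal.span {α} ∈ nonZeroDivisors (Ideal O) :=
    mem_nonZeroDivisors_of_ne_zero (by simpa using hα)
  rw [← ClassGroup.mk0_eq_one_iff hIn]
  have e1 : ClassGroup.mk0 ⟨Ideal.span {((m : ℤ) : O)}, hmn⟩ = 1 :=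
    (ClassGroup.mk0_eq_one_iff hmn).2 ⟨⟨_, rfl⟩⟩
  have e2 : ClassGroup.mk0 ⟨Ideal.span {α}, hαn⟩ = 1 :=
    (ClassGroup.mk0_eq_one_iff hαn).2 ⟨⟨_, rfl⟩⟩
  have e3 : (⟨Ideal.span {α}, hαn⟩ : nonZeroDivisors (Ideal O)) =
      ⟨I, hIn⟩ * ⟨Ideal.span {((m : ℤ) : O)}, hmn⟩ := Subtype.ext heq
  rw [e3, map_mul, e1, mul_one] at e2
  exact e2

section QuadraticOrder

variable {O : Type*} [CommRing O] (b : Module.Basis (Fin 2) ℤ O) {Δ n : ℤ}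

theorem quadratic_coords (h0 : b 0 = 1) (x : O) :
    x = (b.repr x 0 : O) + (b.repr x 1 : O) * b 1 := by
  conv_lhs => rw [← b.sum_repr x]
  rw [Fin.sum_univ_two, h0]
  simp [zsmul_eq_mul]

theorem quadratic_repr (h0 : b 0 = 1) (u v : ℤ) :
    b.repr ((u : O) + (v : O) * b 1) 0 = u ∧ b.repr ((u : O) + (v : O) * b 1) 1 = v := by
  have : (u : O) + (v : O) * b 1 = u • b 0 + v • b 1 := by
    rw [h0]; simp [zsmul_eq_mul]
  rw [this, map_add, map_smul, map_smul, b.repr_self, b.repr_self]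
  simp

theorem quadratic_norm (h0 : b 0 = 1) (h1 : b 1 * b 1 = (Δ : O) * b 1 - (n : O)) (u v : ℤ) :
    Algebra.norm ℤ ((u : O) + (v : O) * b 1) = u ^ 2 + Δ * u * v + n * v ^ 2 := by
  rw [Algebra.norm_eq_matrix_det b, Matrix.det_fin_two]
  simp only [Algebra.leftMulMatrix_eq_repr_mul]
  have e0 : ((u : O) + (v : O) * b 1) * b 0 = (u : O) + (v : O) * b 1 := by rw [h0, mul_one]
  have e1 : ((u : O) + (v : O) * b 1) * b 1 =
      ((-(n * v) : ℤ) : O) + ((u + Δ * v : ℤ) : O) * b 1 := by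
    push_cast
    linear_combination (v : O) * h1
  rw [e0, e1, (quadratic_repr b h0 _ _).1, (quadratic_repr b h0 _ _).2,
    (quadratic_repr b h0 _ _).1, (quadratic_repr b h0 _ _).2]
  ring

/-- An ideal class of order three in an imaginary quadratic order gives an anisotropic binary cubic
form whose reduced discriminant is that of the order. -/
theorem exists_cubic_of_three_dvd_card [IsDedekindDomain O] (φ : O →+* ℂ)
    (hφ : (starRingEnd ℂ) (φ (b 1)) = Δ - φ (b 1)) (hΔ : Δ < 0) (hn : 4 * n = Δ ^ 2 - Δ)
    (h0 : b 0 = 1) (h1 : b 1 * b 1 = (Δ : O) * b 1 - (n : O)) [Finite (ClassGroup O)]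
    (h3 : 3 ∣ Nat.card (ClassGroup O)) :
    ∃ a₀ a₁ a₂ a₃ : ℤ, CubicAnisotropic a₀ a₁ a₂ a₃ ∧ cubicDisc a₀ a₁ a₂ a₃ = Δ := by
  have : Module.Free ℤ O := Module.Free.of_basis b
  have : Module.Finite ℤ O := Module.Finite.of_basis b
  have : Fact (Nat.Prime 3) := ⟨by norm_num⟩
  obtain ⟨g, hg⟩ := exists_prime_orderOf_dvd_card' 3 h3
  obtain ⟨⟨I, hIn⟩, rfl⟩ := ClassGroup.mk0_surjective g
  have hI : I ≠ ⊥ := mem_nonZeroDivisors_iff_ne_zero.1 hIn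
  have hInp : ¬ Submodule.IsPrincipal I := by
    rw [← ClassGroup.mk0_eq_one_iff hIn]
    intro h
    rw [h] at hg
    simp at hg
  have hI3 : Submodule.IsPrincipal (I ^ 3) := by
    have hI3n : I ^ 3 ∈ nonZeroDivisors (Ideal O) := pow_mem hIn 3
    rw [← ClassGroup.mk0_eq_one_iff hI3n]
    have : (⟨I ^ 3, hI3n⟩ : nonZeroDivisors (Ideal O)) = ⟨I, hIn⟩ ^ 3 := Subtype.ext rfl
    rw [this, map_pow, ← hg, pow_orderOf_eq_one]
  obtain ⟨δ, hδ⟩ := hI3.principal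
  replace hδ : I ^ 3 = Ideal.span {δ} := hδ
  have hnorm : ∀ m : ℤ, Ideal.absNorm (Ideal.span {(m : O)}) = m.natAbs ^ 2 := by
    intro m
    rw [Ideal.absNorm_span_singleton]
    have := quadratic_norm b h0 h1 m 0
    simp only [Int.cast_zero, zero_mul, add_zero, mul_zero] at this
    rw [this]
    simp [Int.natAbs_pow]
  let bI := Ideal.selfBasis b I hI
  set α : O := (bI 0 : O) with hα
  set β : O := (bI 1 : O) with hβ
  have hαI : α ∈ I := (bI 0).2
  have hβI : β ∈ I := (bI 1).2
  have hmem : ∀ x ∈ I, ∀ y ∈ I, ∀ z ∈ I, ∃ c a : ℤ, x * y * z = δ * ((c : O) + (a : O) * b 1) := by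
    intro x hx y hy z hz
    have : x * y * z ∈ Ideal.span {δ} := by
      rw [← hδ, pow_succ, pow_two]
      exact Ideal.mul_mem_mul (Ideal.mul_mem_mul hx hy) hz
    obtain ⟨e, he⟩ := Ideal.mem_span_singleton.1 this
    exact ⟨_, _, by rw [he, ← quadratic_coords b h0 e]⟩
  obtain ⟨c₀, a₀, e₀⟩ := hmem α hαI α hαI α hαI
  obtain ⟨c₁, a₁, e₁⟩ := hmem α hαI α hαI β hβI
  obtain ⟨c₂, a₂, e₂⟩ := hmem α hαI β hβI β hβI
  obtain ⟨c₃, a₃, e₃⟩ := hmem β hβI β hβI β hβI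
  refine ⟨a₀, a₁, a₂, a₃, ?_, ?_⟩
  · intro x y hxy
    by_contra hne
    apply hInp
    have hlin : (x : O) * α + (y : O) * β ≠ 0 := by
      intro hz
      have hz' : x • bI 0 + y • bI 1 = 0 := by
        apply Subtype.ext
        simpa [zsmul_eq_mul] using hz
      have := congrArg bI.repr hz'
      apply hne
      constructor
      · simpa using DFunLike.congr_fun this 0
      · simpa using DFunLike.congr_fun this 1
    refine Ideal.isPrincipal_of_cube_eq hnorm hI hδ hlin
      (c := c₀ * x ^ 3 + 3 * c₁ * x ^ 2 * y + 3 * c₂ * x * y ^ 2 + c₃ * y ^ 3) ?_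
    have hxy' : (a₀ : O) * x ^ 3 + 3 * a₁ * x ^ 2 * y + 3 * a₂ * x * y ^ 2 + a₃ * y ^ 3 = 0 := by
      exact_mod_cast congrArg (Int.cast : ℤ → O) hxy
    push_cast
    linear_combination (x : O) ^ 3 * e₀ + 3 * (x : O) ^ 2 * y * e₁ + 3 * (x : O) * y ^ 2 * e₂ +
      (y : O) ^ 3 * e₃ + δ * b 1 * hxy'
  · have hδN : (Ideal.absNorm I) ^ 3 = (Algebra.norm ℤ δ).natAbs := by
      rw [← map_pow, hδ, Ideal.absNorm_span_singleton]
    have hdet := Ideal.natAbs_det_basis_change b I bI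
    rw [Module.Basis.det_apply, Matrix.det_fin_two] at hdet
    simp only [Module.Basis.toMatrix_apply, Function.comp] at hdet
    change Int.natAbs (b.repr α 0 * b.repr β 1 - b.repr β 0 * b.repr α 1) = _ at hdet
    have hαc := quadratic_coords b h0 α
    have hβc := quadratic_coords b h0 β
    have hδc := quadratic_coords b h0 δ
    set x₁ := b.repr α 0
    set y₁ := b.repr α 1
    set x₂ := b.repr β 0
    set y₂ := b.repr β 1
    set u := b.repr δ 0
    set v := b.repr δ 1
    have hNδ := quadratic_norm b h0 h1 u v
    rw [← hδc] at hNδ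
    set N := Algebra.norm ℤ δ
    set det := x₁ * y₂ - x₂ * y₁ with hdetdef
    have hN2 : N ^ 2 = det ^ 6 := by
      have : (N.natAbs : ℤ) ^ 2 = (det.natAbs : ℤ) ^ 6 := by
        rw [hdet, ← hδN]; push_cast; ring
      rw [← Int.natAbs_sq N, this]
      have := Int.natAbs_sq det
      linear_combination ((det.natAbs : ℤ) ^ 4 + (det.natAbs : ℤ) ^ 2 * det ^ 2 + det ^ 4) * this
    have hN0 : N ≠ 0 := by
      intro hN0
      rw [hN0] at hδN
      have : Ideal.absNorm I = 0 := by simpa using hδN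
      exact hI (Ideal.absNorm_eq_zero_iff.1 this)
    -- the two complex embeddings
    let ψ : O →+* ℂ := (starRingEnd ℂ).comp φ
    set T := φ (b 1) with hT
    have hψT : ψ (b 1) = Δ - T := hφ
    have hTT : T * T = Δ * T - n := by
      have := congrArg φ h1
      simpa using this
    have hnC : (4 * n : ℂ) = Δ ^ 2 - Δ := by exact_mod_cast congrArg (Int.cast : ℤ → ℂ) hn
    have hT2 : (2 * T - Δ) ^ 2 = Δ := by linear_combination 4 * hTT - hnC
    have hΔC : (Δ : ℂ) ≠ 0 := by exact_mod_cast hΔ.ne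
    have zα : φ α = x₁ + y₁ * T := by rw [hαc]; simp [hT]
    have zβ : φ β = x₂ + y₂ * T := by rw [hβc]; simp [hT]
    have zδ : φ δ = u + v * T := by rw [hδc]; simp [hT]
    have wα : ψ α = x₁ + y₁ * (Δ - T) := by rw [hαc]; simp [hψT]
    have wβ : ψ β = x₂ + y₂ * (Δ - T) := by rw [hβc]; simp [hψT]
    have wδ : ψ δ = u + v * (Δ - T) := by rw [hδc]; simp [hψT]
    have hNC : φ δ * ψ δ = N := by
      rw [zδ, wδ, hNδ]; push_cast; linear_combination -(v : ℂ) ^ 2 * hTT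
    have key : ∀ x y z : O, ∀ c a : ℤ, x * y * z = δ * ((c : O) + (a : O) * b 1) →
        ψ δ * (φ x * φ y * φ z) - φ δ * (ψ x * ψ y * ψ z) = N * (2 * T - Δ) * a := by
      intro x y z c a h
      have h₁ := congrArg φ h
      have h₂ := congrArg ψ h
      simp only [map_mul, map_add, map_intCast] at h₁ h₂
      rw [hψT] at h₂
      rw [← hNC, h₁, h₂]; ring
    have k₀ := key _ _ _ _ _ e₀
    have k₁ := key _ _ _ _ _ e₁
    have k₂ := key _ _ _ _ _ e₂
    have k₃ := key _ _ _ _ _ e₃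
    have ident : ∀ p q z z' w w' : ℂ, cubicDisc (p * (z * z * z) - q * (w * w * w))
        (p * (z * z * z') - q * (w * w * w')) (p * (z * z' * z') - q * (w * w' * w'))
        (p * (z' * z' * z') - q * (w' * w' * w')) = (p * q) ^ 2 * (z * w' - z' * w) ^ 6 := by
      intros; unfold cubicDisc; ring
    have hid := ident (ψ δ) (φ δ) (φ α) (φ β) (ψ α) (ψ β)
    rw [k₀, k₁, k₂, k₃, mul_comm (ψ δ), hNC] at hid
    have hdetC : φ α * ψ β - φ β * ψ α = -(det : ℂ) * (2 * T - Δ) := by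
      rw [zα, zβ, wα, wβ, hdetdef]; push_cast; ring
    rw [hdetC] at hid
    have hhom : cubicDisc ((N : ℂ) * (2 * T - Δ) * a₀) (N * (2 * T - Δ) * a₁)
        (N * (2 * T - Δ) * a₂) (N * (2 * T - Δ) * a₃) =
        N ^ 4 * Δ ^ 2 * (cubicDisc a₀ a₁ a₂ a₃ : ℤ) := by
      have : ∀ k : ℂ, cubicDisc ((N : ℂ) * k * a₀) (N * k * a₁) (N * k * a₂) (N * k * a₃) =
          N ^ 4 * (k ^ 2) ^ 2 * (cubicDisc a₀ a₁ a₂ a₃ : ℤ) := by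
        intro k; unfold cubicDisc; push_cast; ring
      rw [this, hT2]
    rw [hhom] at hid
    have hN2C : (N : ℂ) ^ 2 = (det : ℂ) ^ 6 := by exact_mod_cast congrArg (Int.cast : ℤ → ℂ) hN2
    have hfin : (N : ℂ) ^ 4 * Δ ^ 2 * (cubicDisc a₀ a₁ a₂ a₃ : ℤ) = N ^ 4 * Δ ^ 2 * Δ := by
      rw [hid]
      have : (-(det : ℂ) * (2 * T - Δ)) ^ 6 = det ^ 6 * ((2 * T - Δ) ^ 2) ^ 3 := by ring
      rw [this, hT2, ← hN2C]; ring
    have hne : (N : ℂ) ^ 4 * Δ ^ 2 ≠ 0 := by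
      have : (N : ℂ) ≠ 0 := by exact_mod_cast hN0
      positivity
    exact_mod_cast mul_left_cancel₀ hne hfin

end QuadraticOrder

theorem sqrt_sq (Δ : ℤ) : (((Δ : ℂ) ^ ((1 : ℂ) / 2)) ^ 2 : ℂ) = Δ := by
  have := Complex.cpow_nat_inv_pow (Δ : ℂ) (n := 2) (by norm_num)
  rw [Nat.cast_ofNat] at this
  rwa [← one_div] at this

theorem conj_of_sq_neg {Δ : ℤ} (hΔ : Δ < 0) {s : ℂ} (hs : s ^ 2 = Δ) :
    (starRingEnd ℂ) s = -s := by
  have h1 := congrArg Complex.re hs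
  have h2 := congrArg Complex.im hs
  simp [pow_two] at h1 h2
  have hΔ' : (Δ : ℝ) < 0 := by exact_mod_cast hΔ
  have hre : s.re = 0 := by
    by_contra hne
    have : s.im = 0 := by
      have : s.re * s.im = 0 := by linarith
      exact (mul_eq_zero.1 this).resolve_left hne
    rw [this] at h1
    nlinarith [sq_nonneg s.re]
  apply Complex.ext <;> simp [hre]

theorem im_ne_zero_of_sq_neg {Δ : ℤ} (hΔ : Δ < 0) {s : ℂ} (hs : s ^ 2 = Δ) : s.im ≠ 0 := by
  intro h
  have h1 := congrArg Complex.re hs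
  have hΔ' : (Δ : ℝ) < 0 := by exact_mod_cast hΔ
  simp [pow_two, h] at h1
  nlinarith [sq_nonneg s.re]

theorem quadField_repr {Δ : ℤ} (hΔ : Δ < 0) {x : ℂ} (hx : x ∈ quadField Δ) :
    ∃ r q : ℚ, x = r + q * (Δ : ℂ) ^ ((1 : ℂ) / 2) := by
  have hs := sqrt_sq Δ
  have him := im_ne_zero_of_sq_neg hΔ hs
  set s := (Δ : ℂ) ^ ((1 : ℂ) / 2) with hsdef
  have hx' : x ∈ IntermediateField.adjoin ℚ {s} := hx
  induction hx' using IntermediateField.adjoin_induction with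
  | mem y hy => exact ⟨0, 1, by rw [Set.mem_singleton_iff.1 hy]; simp⟩
  | algebraMap x => exact ⟨x, 0, by simp⟩
  | add x y _ _ h1 h2 =>
    obtain ⟨r, q, rfl⟩ := h1 (by assumption)
    obtain ⟨r', q', rfl⟩ := h2 (by assumption)
    exact ⟨r + r', q + q', by push_cast; ring⟩
  | mul x y _ _ h1 h2 =>
    obtain ⟨r, q, rfl⟩ := h1 (by assumption)
    obtain ⟨r', q', rfl⟩ := h2 (by assumption)
    refine ⟨r * r' + q * q' * Δ, r * q' + q * r', ?_⟩
    push_cast; rw [← hs]; ring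
  | inv x _ h =>
    obtain ⟨r, q, rfl⟩ := h (by assumption)
    refine ⟨r / (r ^ 2 - q ^ 2 * Δ), -q / (r ^ 2 - q ^ 2 * Δ), ?_⟩
    by_cases h0 : r = 0 ∧ q = 0
    · simp [h0.1, h0.2]
    have hΔ' : (Δ : ℚ) < 0 := by exact_mod_cast hΔ
    have hne : (r ^ 2 - q ^ 2 * Δ : ℚ) ≠ 0 := by
      intro hz
      apply h0
      have h1 : r ^ 2 ≤ 0 := by nlinarith [sq_nonneg q]
      have h2 : r = 0 := by simpa using le_antisymm h1 (sq_nonneg r)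
      refine ⟨h2, ?_⟩
      rw [h2] at hz
      have : q ^ 2 * Δ = 0 := by linarith
      simpa [hΔ'.ne] using this
    have hneC : ((r : ℂ) ^ 2 - q ^ 2 * Δ) ≠ 0 := by exact_mod_cast hne
    have hmul : ((r : ℂ) + q * s) * (r - q * s) = r ^ 2 - q ^ 2 * Δ := by rw [← hs]; ring
    refine inv_eq_of_mul_eq_one_right ?_
    push_cast
    have : ((r : ℂ) + q * s) * (r / (r ^ 2 - q ^ 2 * Δ) + -q / (r ^ 2 - q ^ 2 * Δ) * s) =
        (r + q * s) * (r - q * s) / (r ^ 2 - q ^ 2 * Δ) := by ring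
    rw [this, hmul, div_self hneC]

theorem Int.exists_of_isIntegral_ratCast {r : ℚ} (h : IsIntegral ℤ (r : ℂ)) : ∃ m : ℤ, r = m := by
  have h' : IsIntegral ℤ r := by
    have h2 : IsIntegral ℤ (algebraMap ℚ ℂ r) := by simpa using h
    exact (isIntegral_algebraMap_iff (algebraMap ℚ ℂ).injective).1 h2
  obtain ⟨m, hm⟩ := IsIntegrallyClosed.isIntegral_iff.1 h'
  exact ⟨m, by simpa using hm.symm⟩

theorem Rat.exists_int_of_squarefree_mul_sq {e : ℤ} (he : Squarefree e) {q : ℚ} {k : ℤ}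
    (h : e * q ^ 2 = k) : ∃ v : ℤ, q = v := by
  have hd : (q.den : ℤ) ^ 2 ∣ e * q.num ^ 2 := by
    refine ⟨k, ?_⟩
    have : (e : ℚ) * q.num ^ 2 = q.den ^ 2 * k := by
      have hq' : q * q.den = q.num := Rat.mul_den_eq_num q
      rw [← h, ← hq']; ring
    exact_mod_cast this
  have hcop : IsCoprime ((q.den : ℤ) ^ 2) (q.num ^ 2) :=
    (Int.isCoprime_iff_gcd_eq_one.2 (by
      simpa [Int.gcd, Nat.coprime_comm] using q.reduced)).pow
  have h1 := hcop.dvd_of_dvd_mul_right hd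
  have h2 : IsUnit (q.den : ℤ) := he _ (by rwa [← pow_two])
  have h3 : q.den = 1 := by
    have := Int.isUnit_iff_natAbs_eq.1 h2
    simpa using this
  exact ⟨q.num, (Rat.den_eq_one_iff q).1 h3 |>.symm⟩

/-- Integrality in an imaginary quadratic field of fundamental discriminant. -/
theorem quadratic_integer_repr {Δ : ℤ} (hf : IsFundamentalDiscriminant Δ) {r q : ℚ} {m N : ℤ}
    (hm : 2 * r = m) (hN : r ^ 2 - Δ * q ^ 2 = N) :
    ∃ u v : ℤ, r = u + v * Δ / 2 ∧ q = v / 2 := by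
  have hV : (Δ : ℚ) * (2 * q) ^ 2 = (m ^ 2 - 4 * N : ℤ) := by
    push_cast; rw [← hm, ← hN]; ring
  obtain ⟨-, ⟨h4, hsq⟩ | ⟨h4, hsq, he⟩⟩ := hf
  · obtain ⟨v, hv⟩ := Rat.exists_int_of_squarefree_mul_sq hsq hV
    rw [hv] at hV
    have hV' : Δ * v ^ 2 = m ^ 2 - 4 * N := by exact_mod_cast hV
    have hpar : (m - v * Δ) % 2 = 0 := by
      have h1 : (v * v) % 2 = v % 2 := by
        rcases Int.emod_two_eq_zero_or_one v with h | h <;> simp [Int.mul_emod, h]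
      have h2 : (m * m) % 2 = m % 2 := by
        rcases Int.emod_two_eq_zero_or_one m with h | h <;> simp [Int.mul_emod, h]
      obtain ⟨t, ht⟩ : ∃ t, Δ = 4 * t + 1 := ⟨Δ / 4, by omega⟩
      have h3 : v * v = m * m - 4 * N - 4 * (t * (v * v)) := by rw [ht] at hV'; linarith
      have h4 : v * Δ = 4 * (t * v) + v := by rw [ht]; ring
      rw [h4]
      omega
    refine ⟨(m - v * Δ) / 2, v, ?_, by linarith⟩
    obtain ⟨w, hw⟩ : ∃ w, m - v * Δ = 2 * w := ⟨(m - v * Δ) / 2, by omega⟩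
    rw [hw, Int.mul_ediv_cancel_left _ two_ne_zero]
    have : (m : ℚ) - v * Δ = 2 * w := by exact_mod_cast hw
    linarith
  · obtain ⟨e, hΔe⟩ : ∃ e, Δ = 4 * e := ⟨Δ / 4, by omega⟩
    have hee : Δ / 4 = e := by omega
    rw [hee] at hsq he
    have hV2 : (e : ℚ) * (2 * (2 * q)) ^ 2 = (m ^ 2 - 4 * N : ℤ) := by
      rw [← hV, hΔe]; push_cast; ring
    obtain ⟨w, hw⟩ := Rat.exists_int_of_squarefree_mul_sq hsq hV2
    rw [hw] at hV2
    have hV' : e * w ^ 2 = m ^ 2 - 4 * N := by exact_mod_cast hV2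
    -- `m² ≡ e w² (mod 4)` with `e ≡ 2, 3 (mod 4)` forces both to be even
    have hpar : m % 2 = 0 ∧ w % 2 = 0 := by
      have h1 : (e * w ^ 2) % 4 = (m ^ 2) % 4 := by rw [hV']; omega
      have hm4 : m % 4 = 0 ∨ m % 4 = 1 ∨ m % 4 = 2 ∨ m % 4 = 3 := by omega
      have hw4 : w % 4 = 0 ∨ w % 4 = 1 ∨ w % 4 = 2 ∨ w % 4 = 3 := by omega
      rcases he with he | he <;> rcases hm4 with h | h | h | h <;>
        rcases hw4 with h' | h' | h' | h' <;>
        simp [Int.mul_emod, pow_two, he, h, h'] at h1 <;> omega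
    obtain ⟨m', hm'⟩ : ∃ m', m = 2 * m' := ⟨m / 2, by omega⟩
    obtain ⟨v, hv⟩ : ∃ v, w = 2 * v := ⟨w / 2, by omega⟩
    refine ⟨m' - 2 * v * e, v, ?_, ?_⟩
    · rw [hΔe]; push_cast
      rw [hm'] at hm; push_cast at hm
      linarith
    · rw [hv] at hw; push_cast at hw
      linarith

theorem exists_cubic_of_three_dvd_classNum {Δ : ℤ} (hf : IsFundamentalDiscriminant Δ) (hΔ : Δ < 0)
    (h3 : 3 ∣ classNum Δ) :
    ∃ a₀ a₁ a₂ a₃ : ℤ, CubicAnisotropic a₀ a₁ a₂ a₃ ∧ cubicDisc a₀ a₁ a₂ a₃ = Δ := by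
  have hs := sqrt_sq Δ
  have him := im_ne_zero_of_sq_neg hΔ hs
  have hconj := conj_of_sq_neg hΔ hs
  have hrepr := fun x (hx : x ∈ quadField Δ) => quadField_repr hΔ hx
  have hsK : (Δ : ℂ) ^ ((1 : ℂ) / 2) ∈ quadField Δ :=
    IntermediateField.mem_adjoin_simple_self ℚ _
  set s := (Δ : ℂ) ^ ((1 : ℂ) / 2) with hsdef
  obtain ⟨n, hn⟩ : ∃ n : ℤ, 4 * n = Δ ^ 2 - Δ := by
    refine ⟨(Δ ^ 2 - Δ) / 4, ?_⟩
    have : Δ % 4 = 0 ∨ Δ % 4 = 1 := by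
      obtain ⟨-, ⟨h4, -⟩ | ⟨h4, -⟩⟩ := hf <;> simp [h4]
    have h4 : (Δ ^ 2 - Δ) % 4 = 0 := by
      rcases this with h | h <;> simp [Int.sub_emod, pow_two, Int.mul_emod, h]
    omega
  have hnC : (4 * n : ℂ) = Δ ^ 2 - Δ := by exact_mod_cast congrArg (Int.cast : ℤ → ℂ) hn
  let K := quadField Δ
  let T : ℂ := (Δ + s) / 2
  have hTK : T ∈ K := by
    refine K.div_mem (K.add_mem ?_ hsK) ?_
    · exact intCast_mem K Δ
    · exact ofNat_mem K 2
  have hTT : T * T = Δ * T - n := by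
    simp only [T]; linear_combination (1 / 4 : ℂ) * hs + (1 / 4 : ℂ) * hnC
  have hTint : IsIntegral ℤ (⟨T, hTK⟩ : K) := by
    refine ⟨Polynomial.X ^ 2 - Polynomial.C Δ * Polynomial.X + Polynomial.C n, by monicity!, ?_⟩
    apply Subtype.ext
    simp only [Polynomial.eval₂_add, Polynomial.eval₂_sub, Polynomial.eval₂_mul,
      Polynomial.eval₂_pow, Polynomial.eval₂_X, Polynomial.eval₂_C]
    simp
    linear_combination hTT
  let O := integralClosure ℤ K
  let τ : O := ⟨⟨T, hTK⟩, hTint⟩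
  let φ : O →+* ℂ := (algebraMap K ℂ).comp (algebraMap O K)
  have hφτ : φ τ = T := rfl
  have hφinj : Function.Injective φ := fun x y h => Subtype.ext (Subtype.ext h)
  have hTim : T.im = s.im / 2 := by simp [T]
  have hφlin : ∀ u v : ℤ, φ (u • (1 : O) + v • τ) = u + v * T := by
    intro u v
    have e1 : φ (u • (1 : O) + v • τ) = u • (1 : ℂ) + v • T := by
      refine (φ.map_add _ _).trans (congrArg₂ (· + ·) ?_ ?_)
      · refine (map_zsmul φ.toAddMonoidHom u (1 : O)).trans ?_
        exact congrArg (u • ·) φ.map_one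
      · exact map_zsmul φ.toAddMonoidHom v τ
    rw [e1]; simp
  have hcoord : ∀ x : O, ∃ u v : ℤ, x = u • (1 : O) + v • τ := by
    intro x
    have hxint : IsIntegral ℤ (φ x) := by
      have : IsIntegral ℤ (x : K) := x.2
      exact this.map (K.val.restrictScalars ℤ)
    obtain ⟨r, q, hrq⟩ := hrepr (φ x) (x : K).2
    have hcint : IsIntegral ℤ ((starRingEnd ℂ) (φ x)) :=
      hxint.map (RingHom.toIntAlgHom (starRingEnd ℂ))
    have hcx : (starRingEnd ℂ) (φ x) = r - q * s := by
      rw [hrq, map_add, map_mul, hconj]; simp; ring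
    obtain ⟨m, hm⟩ : ∃ m : ℤ, 2 * r = m := by
      apply Int.exists_of_isIntegral_ratCast
      have := hxint.add hcint
      rw [hcx, hrq] at this
      rw [add_add_sub_cancel, ← two_mul] at this
      exact_mod_cast this
    obtain ⟨N, hN⟩ : ∃ N : ℤ, r ^ 2 - Δ * q ^ 2 = N := by
      apply Int.exists_of_isIntegral_ratCast
      have := hxint.mul hcint
      rw [hcx, hrq] at this
      have e : ((r : ℂ) + q * s) * (r - q * s) = ((r ^ 2 - Δ * q ^ 2 : ℚ) : ℂ) := by
        push_cast; rw [← hs]; ring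
      rwa [e] at this
    obtain ⟨u, v, hu, hv⟩ := quadratic_integer_repr hf hm hN
    refine ⟨u, v, hφinj ?_⟩
    rw [hφlin, hrq, hu, hv]
    simp only [T]
    push_cast; ring
  have hli : LinearIndependent ℤ ![(1 : O), τ] := by
    rw [LinearIndependent.pair_iff]
    intro u v huv
    have h1 := congrArg φ huv
    rw [hφlin, map_zero] at h1
    have h2 := congrArg Complex.im h1
    simp [hTim, him] at h2
    subst h2
    simpa using h1
  let b : Module.Basis (Fin 2) ℤ O := Module.Basis.mk hli (by
    rintro x -
    obtain ⟨u, v, rfl⟩ := hcoord x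
    refine Submodule.add_mem _ (Submodule.smul_mem _ _ ?_) (Submodule.smul_mem _ _ ?_)
    · exact Submodule.subset_span ⟨0, rfl⟩
    · exact Submodule.subset_span ⟨1, rfl⟩)
  have hb0 : b 0 = 1 := by simp [b]
  have hb1 : b 1 = τ := by simp [b]
  have hfd : FiniteDimensional ℚ K := by
    refine IntermediateField.adjoin.finiteDimensional ?_
    refine ⟨Polynomial.X ^ 2 - Polynomial.C (Δ : ℚ), by monicity!, ?_⟩
    simp only [Polynomial.eval₂_sub, Polynomial.eval₂_pow, Polynomial.eval₂_X, Polynomial.eval₂_C]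
    rw [← hsdef, hs]; simp
  have : NumberField K := { to_charZero := inferInstance, to_finiteDimensional := hfd }
  have hdd : IsDedekindDomain O := integralClosure.isDedekindDomain ℤ ℚ K
  have hfin : Finite (ClassGroup O) := inferInstanceAs (Finite (ClassGroup (NumberField.RingOfIntegers K)))
  refine exists_cubic_of_three_dvd_card b φ ?_ hΔ hn hb0 ?_ h3
  · rw [hb1, hφτ]; simp only [T, map_div₀, map_add, hconj]; simp [Complex.conj_ofNat]; ring
  · rw [hb1]
    apply hφinj
    simp only [map_mul, map_sub, map_intCast, hφτ, hTT]

/-- A negative fundamental discriminant with class number divisible by three is the reduced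
discriminant of a reduced binary cubic form. -/
theorem exists_reduced_cubic_of_three_dvd_classNum {Δ : ℤ} (hf : IsFundamentalDiscriminant Δ)
    (hΔ : Δ < 0) (h3 : 3 ∣ classNum Δ) :
    ∃ a b c d : ℤ, cubicDisc a b c d = Δ ∧ 0 < a ∧ 0 ≤ a * d - b * c ∧
      a * d - b * c ≤ b ^ 2 - a * c ∧ b ^ 2 - a * c ≤ c ^ 2 - b * d := by
  obtain ⟨a, b, c, d, h, hD⟩ := exists_cubic_of_three_dvd_classNum hf hΔ h3
  obtain ⟨a', b', c', d', hD', h'⟩ := exists_reduced_cubic h (hD ▸ hΔ)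
  exact ⟨a', b', c', d', hD'.trans hD, h'⟩

section LocalCount

variable {R : Type*} [CommRing R]

theorem isUnit_add_of_nonunit_mul_eq_zero
    (hR : ∀ x y : R, ¬ IsUnit x → ¬ IsUnit y → x * y = 0) {u x : R} (hu : IsUnit u)
    (hx : ¬ IsUnit x) : IsUnit (u + x) := by
  by_contra h
  have h1 := hR _ _ hx h
  have h2 := hR _ _ hx hx
  have h3 : x * u = 0 := by linear_combination h1 - h2
  have h4 : x = 0 := by simpa using (hu.mul_left_eq_zero).1 h3
  exact h (by simpa [h4] using hu)

theorem cubic_eq_of_unit_leading {a b c d c' d' : R} (ha : IsUnit a)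
    (hA : b ^ 2 - a * c = b ^ 2 - a * c')
    (hQ : a ^ 2 * d - 3 * a * b * c + 2 * b ^ 3 = a ^ 2 * d' - 3 * a * b * c' + 2 * b ^ 3) :
    c = c' ∧ d = d' := by
  have hc : c = c' := ha.mul_left_cancel (by linear_combination -hA)
  subst hc
  exact ⟨rfl, (ha.pow 2).mul_left_cancel (by linear_combination hQ)⟩

variable [Fintype R]

open Classical in
theorem card_cubicDisc_unit_leading_le (h2 : IsUnit (2 : R))
    (hR : ∀ x y : R, ¬ IsUnit x → ¬ IsUnit y → x * y = 0) {D : R} (hD : D ≠ 0) (T : Finset R)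
    (hT : ∀ q, q ∈ T ∨ (¬ IsUnit D ∧ ¬ IsUnit q)) :
    (Finset.univ.filter fun f : Fin 4 → R =>
      cubicDisc (f 0) (f 1) (f 2) (f 3) = D ∧ IsUnit (f 0)).card ≤
    (Finset.univ.filter fun x : R => IsUnit x).card * (Fintype.card R * T.card) := by
  have h4 : IsUnit (4 : R) := by
    have : (4 : R) = 2 * 2 := by norm_num
    rw [this]; exact h2.mul h2
  let A : (Fin 4 → R) → R := fun f => f 1 ^ 2 - f 0 * f 2
  let Q : (Fin 4 → R) → R := fun f => f 0 ^ 2 * f 3 - 3 * f 0 * f 1 * f 2 + 2 * f 1 ^ 3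
  have key : ∀ f : Fin 4 → R, cubicDisc (f 0) (f 1) (f 2) (f 3) = D →
      f 0 ^ 2 * D = Q f ^ 2 - 4 * A f ^ 3 := fun f hf => by
    rw [← hf]; exact cubic_syzygy _ _ _ _
  have hcube : ∀ f, ¬ IsUnit (A f) → A f ^ 3 = 0 := fun f h => by
    rw [pow_succ, pow_two, hR _ _ h h, zero_mul]
  have hnD : ∀ f : Fin 4 → R, cubicDisc (f 0) (f 1) (f 2) (f 3) = D → IsUnit (f 0) →
      ¬ IsUnit (A f) → IsUnit D ∧ IsUnit (Q f) := by
    intro f hf ha hA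
    have h1 := key f hf
    rw [hcube f hA, mul_zero, sub_zero] at h1
    have hQ : IsUnit (Q f) := by
      by_contra hQ
      rw [pow_two (Q f), hR _ _ hQ hQ] at h1
      exact hD ((ha.pow 2).mul_right_eq_zero.1 h1)
    refine ⟨?_, hQ⟩
    exact isUnit_of_mul_isUnit_right (h1 ▸ hQ.pow 2)
  let F : (Fin 4 → R) → R × R × R := fun f =>
    if IsUnit (A f) then (f 0 * Ring.inverse (A f), f 1, Q f * Ring.inverse (A f))
    else (f 0, f 1, Q f + f 0 * A f)
  have hFu : ∀ f, cubicDisc (f 0) (f 1) (f 2) (f 3) = D → IsUnit (f 0) → IsUnit (A f) →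
      f 0 = (F f).1 * A f ∧ Q f = (F f).2.2 * A f ∧ (F f).2.2 ^ 2 - (F f).1 ^ 2 * D = 4 * A f := by
    intro f hf ha hA
    have hinv : Ring.inverse (A f) * A f = 1 := Ring.inverse_mul_cancel _ hA
    have e1 : f 0 = (F f).1 * A f := by simp [F, hA]; rw [mul_assoc, hinv, mul_one]
    have e2 : Q f = (F f).2.2 * A f := by simp [F, hA]; rw [mul_assoc, hinv, mul_one]
    refine ⟨e1, e2, ?_⟩
    have h1 := key f hf
    rw [e1, e2] at h1
    refine (hA.pow 2).mul_left_cancel ?_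
    linear_combination -h1
  have hFn : ∀ f, cubicDisc (f 0) (f 1) (f 2) (f 3) = D → IsUnit (f 0) → ¬ IsUnit (A f) →
      (F f).1 = f 0 ∧ (F f).2.2 = Q f + f 0 * A f ∧
        (F f).2.2 ^ 2 - (F f).1 ^ 2 * D = A f * (2 * Q f * f 0) := by
    intro f hf ha hA
    have e1 : (F f).1 = f 0 := by simp [F, hA]
    have e2 : (F f).2.2 = Q f + f 0 * A f := by simp [F, hA]
    refine ⟨e1, e2, ?_⟩
    rw [e1, e2]
    linear_combination - key f hf + f 0 ^ 2 * hR _ _ hA hA + 4 * hcube f hA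
  have hF1 : ∀ f, (F f).2.1 = f 1 := fun f => by simp only [F]; split_ifs <;> rfl
  have := Finset.card_le_card_of_injOn (s := Finset.univ.filter fun f : Fin 4 → R =>
      cubicDisc (f 0) (f 1) (f 2) (f 3) = D ∧ IsUnit (f 0))
    (t := (Finset.univ.filter fun x : R => IsUnit x) ×ˢ (Finset.univ : Finset R) ×ˢ T) F ?_ ?_
  · simpa [Finset.card_product] using this
  · intro f hf
    simp only [Finset.mem_coe, Finset.mem_filter, Finset.mem_univ, true_and] at hf
    obtain ⟨hf, ha⟩ := hf
    simp only [Finset.mem_coe, Finset.mem_product, Finset.mem_filter, Finset.mem_univ, true_and]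
    by_cases hA : IsUnit (A f)
    · obtain ⟨e1, -, e3⟩ := hFu f hf ha hA
      refine ⟨isUnit_of_mul_isUnit_left (e1 ▸ ha), ?_⟩
      refine (hT _).resolve_right fun ⟨hDn, hq⟩ => ?_
      have : (F f).2.2 ^ 2 = 0 := by rw [pow_two]; exact hR _ _ hq hq
      rw [this] at e3
      have h5 : IsUnit ((F f).1 ^ 2 * D) := by
        have : (F f).1 ^ 2 * D = -(4 * A f) := by linear_combination -e3
        rw [this]; exact (h4.mul hA).neg
      exact hDn (isUnit_of_mul_isUnit_right h5)
    · obtain ⟨e1, -, -⟩ := hFn f hf ha hA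
      refine ⟨e1 ▸ ha, ?_⟩
      exact (hT _).resolve_right fun h => h.1 (hnD f hf ha hA).1
  · intro f hf g hg hfg
    simp only [Finset.mem_coe, Finset.mem_filter, Finset.mem_univ, true_and] at hf hg
    obtain ⟨hf, ha⟩ := hf
    obtain ⟨hg, ha'⟩ := hg
    have fin : f 0 = g 0 → A f = A g → Q f = Q g → f = g := by
      intro h0 hA hQ
      have h1 : f 1 = g 1 := by rw [← hF1 f, ← hF1 g, hfg]
      simp only [A, Q, ← h0, ← h1] at hA hQ
      obtain ⟨h2, h3⟩ := cubic_eq_of_unit_leading ha hA hQ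
      ext i; fin_cases i <;> assumption
    by_cases hA : IsUnit (A f) <;> by_cases hA' : IsUnit (A g)
    · obtain ⟨e1, e2, e3⟩ := hFu f hf ha hA
      obtain ⟨e1', e2', e3'⟩ := hFu g hg ha' hA'
      rw [hfg] at e1 e2 e3
      have : A f = A g := h4.mul_left_cancel (by rw [← e3, ← e3'])
      exact fin (by rw [e1, e1', this]) this (by rw [e2, e2', this])
    · obtain ⟨-, -, e3⟩ := hFu f hf ha hA
      obtain ⟨-, -, e3'⟩ := hFn g hg ha' hA'
      rw [hfg, e3'] at e3
      exact absurd (isUnit_of_mul_isUnit_left (e3 ▸ h4.mul hA)) hA'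
    · obtain ⟨-, -, e3⟩ := hFn f hf ha hA
      obtain ⟨-, -, e3'⟩ := hFu g hg ha' hA'
      rw [hfg, e3'] at e3
      exact absurd (isUnit_of_mul_isUnit_left (e3 ▸ h4.mul hA')) hA
    · obtain ⟨e1, e2, -⟩ := hFn f hf ha hA
      obtain ⟨e1', e2', -⟩ := hFn g hg ha' hA'
      rw [hfg] at e1 e2
      have h0 : f 0 = g 0 := e1.symm.trans e1'
      obtain ⟨-, hQu⟩ := hnD f hf ha hA
      have hk := key f hf
      have hk' := key g hg
      rw [hcube f hA] at hk
      rw [hcube g hA', ← h0] at hk'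
      have hsum : IsUnit (Q f + Q g) := by
        have h5 : Q f + Q g = (2 * Q f + f 0 * A f) + -(f 0 * A g) := by
          rw [← h0] at e2'
          linear_combination e2 - e2'
        rw [h5]
        refine isUnit_add_of_nonunit_mul_eq_zero hR
          (isUnit_add_of_nonunit_mul_eq_zero hR (h2.mul hQu) ?_) ?_
        · exact fun h => hA (isUnit_of_mul_isUnit_right h)
        · exact fun h => hA' (isUnit_of_mul_isUnit_right (IsUnit.neg_iff _ |>.1 h))
      have hQ : Q f = Q g := by
        have : (Q f + Q g) * (Q f - Q g) = 0 := by linear_combination hk' - hk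
        exact sub_eq_zero.1 (hsum.mul_right_eq_zero.1 this)
      refine fin h0 (ha.mul_left_cancel ?_) hQ
      rw [← h0] at e2'
      linear_combination e2' - e2 - hQ

open Classical in
theorem card_cubicDisc_unit_second_le (h2 : IsUnit (2 : R))
    (hR : ∀ x y : R, ¬ IsUnit x → ¬ IsUnit y → x * y = 0) (D : R) :
    (Finset.univ.filter fun f : Fin 4 → R =>
      cubicDisc (f 0) (f 1) (f 2) (f 3) = D ∧ ¬ IsUnit (f 0) ∧ IsUnit (f 1)).card ≤
    (Finset.univ.filter fun x : R => ¬ IsUnit x).card *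
      ((Finset.univ.filter fun x : R => IsUnit x).card * Fintype.card R) := by
  have h4 : IsUnit (4 : R) := by
    have : (4 : R) = 2 * 2 := by norm_num
    rw [this]; exact h2.mul h2
  have := Finset.card_le_card_of_injOn (s := Finset.univ.filter fun f : Fin 4 → R =>
      cubicDisc (f 0) (f 1) (f 2) (f 3) = D ∧ ¬ IsUnit (f 0) ∧ IsUnit (f 1))
    (t := (Finset.univ.filter fun x : R => ¬ IsUnit x) ×ˢ
      (Finset.univ.filter fun x : R => IsUnit x) ×ˢ (Finset.univ : Finset R))
    (fun f => (f 0, f 1, f 2)) ?_ ?_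
  · simpa only [Finset.card_product, Finset.card_univ] using this
  · intro f hf
    simpa using (by simpa using hf : _ ∧ _).2
  · intro f hf g hg hfg
    simp only [Finset.mem_coe, Finset.mem_filter, Finset.mem_univ, true_and] at hf hg
    obtain ⟨hf, ha, hb⟩ := hf
    obtain ⟨hg, -, -⟩ := hg
    simp only [Prod.mk.injEq] at hfg
    obtain ⟨e0, e1, e2⟩ := hfg
    rw [← e0, ← e1, ← e2] at hg
    have hu : IsUnit (4 * f 1 ^ 3 + f 0 * (-6 * f 1 * f 2)) :=
      isUnit_add_of_nonunit_mul_eq_zero hR (h4.mul (hb.pow 3))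
        fun h => ha (isUnit_of_mul_isUnit_left h)
    have e3 : f 3 = g 3 := by
      refine hu.mul_left_cancel ?_
      have h0 := hR _ _ ha ha
      unfold cubicDisc at hf hg
      linear_combination hf - hg - (f 3 ^ 2 - g 3 ^ 2) * h0
    ext i; fin_cases i <;> assumption

open Classical in
theorem card_cubicDisc_nonunit_le (h2 : IsUnit (2 : R))
    (hR : ∀ x y : R, ¬ IsUnit x → ¬ IsUnit y → x * y = 0) {D : R} (hD : D ≠ 0) :
    (Finset.univ.filter fun f : Fin 4 → R =>
      cubicDisc (f 0) (f 1) (f 2) (f 3) = D ∧ ¬ IsUnit (f 0) ∧ ¬ IsUnit (f 1)).card ≤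
    if IsUnit D then 0 else (Finset.univ.filter fun x : R => ¬ IsUnit x).card *
      ((Finset.univ.filter fun x : R => IsUnit x).card * Fintype.card R) := by
  have h4 : IsUnit (4 : R) := by
    have : (4 : R) = 2 * 2 := by norm_num
    rw [this]; exact h2.mul h2
  have key : ∀ f : Fin 4 → R, cubicDisc (f 0) (f 1) (f 2) (f 3) = D → ¬ IsUnit (f 0) →
      ¬ IsUnit (f 1) → D = 4 * f 0 * f 2 ^ 3 := by
    intro f hf ha hb
    rw [← hf]
    unfold cubicDisc
    linear_combination f 3 ^ 2 * hR _ _ ha ha + (-3 * f 2 ^ 2 + 4 * f 1 * f 3) * hR _ _ hb hb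
      - 6 * f 2 * f 3 * hR _ _ ha hb
  split_ifs with hu
  · rw [Nat.le_zero, Finset.card_eq_zero, Finset.filter_eq_empty_iff]
    rintro f - ⟨hf, ha, hb⟩
    rw [key f hf ha hb] at hu
    exact ha (isUnit_of_mul_isUnit_right (isUnit_of_mul_isUnit_left hu))
  have := Finset.card_le_card_of_injOn (s := Finset.univ.filter fun f : Fin 4 → R =>
      cubicDisc (f 0) (f 1) (f 2) (f 3) = D ∧ ¬ IsUnit (f 0) ∧ ¬ IsUnit (f 1))
    (t := (Finset.univ.filter fun x : R => ¬ IsUnit x) ×ˢ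
      (Finset.univ.filter fun x : R => IsUnit x) ×ˢ (Finset.univ : Finset R))
    (fun f => (f 1, f 2, f 3)) ?_ ?_
  · simpa only [Finset.card_product, Finset.card_univ] using this
  · intro f hf
    simp only [Finset.mem_coe, Finset.mem_filter, Finset.mem_univ, true_and] at hf
    obtain ⟨hf, ha, hb⟩ := hf
    have hc : IsUnit (f 2) := by
      by_contra hc
      apply hD
      rw [key f hf ha hb]
      linear_combination 4 * f 2 ^ 2 * hR _ _ ha hc
    simpa using ⟨hb, hc⟩
  · intro f hf g hg hfg
    simp only [Finset.mem_coe, Finset.mem_filter, Finset.mem_univ, true_and] at hf hg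
    obtain ⟨hf, ha, hb⟩ := hf
    obtain ⟨hg, ha', hb'⟩ := hg
    simp only [Prod.mk.injEq] at hfg
    obtain ⟨e1, e2, e3⟩ := hfg
    have hc : IsUnit (f 2) := by
      by_contra hc
      apply hD
      rw [key f hf ha hb]
      linear_combination 4 * f 2 ^ 2 * hR _ _ ha hc
    have e0 : f 0 = g 0 := by
      refine (h4.mul (hc.pow 3)).mul_left_cancel ?_
      have k1 := key f hf ha hb
      have k2 := key g hg ha' hb'
      rw [← e2] at k2
      linear_combination k2 - k1
    ext i; fin_cases i <;> assumption

open Classical in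
theorem card_cubicDisc_le (h2 : IsUnit (2 : R))
    (hR : ∀ x y : R, ¬ IsUnit x → ¬ IsUnit y → x * y = 0) {D : R} (hD : D ≠ 0) {n u : ℕ}
    (hn : (Finset.univ.filter fun x : R => ¬ IsUnit x).card = n)
    (hu : (Finset.univ.filter fun x : R => IsUnit x).card = u) :
    (Finset.univ.filter fun f : Fin 4 → R => cubicDisc (f 0) (f 1) (f 2) (f 3) = D).card ≤
      if IsUnit D then u * ((n + u) * (n + u)) + n * (u * (n + u))
      else u * ((n + u) * u) + 2 * (n * (u * (n + u))) := by
  have hcard : Fintype.card R = n + u := by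
    rw [← hn, ← hu, add_comm, ← Finset.card_univ]
    exact (Finset.card_filter_add_card_filter_not _).symm
  have hsub : (Finset.univ.filter fun f : Fin 4 → R => cubicDisc (f 0) (f 1) (f 2) (f 3) = D) ⊆
      (Finset.univ.filter fun f : Fin 4 → R =>
        cubicDisc (f 0) (f 1) (f 2) (f 3) = D ∧ IsUnit (f 0)) ∪
      ((Finset.univ.filter fun f : Fin 4 → R =>
        cubicDisc (f 0) (f 1) (f 2) (f 3) = D ∧ ¬ IsUnit (f 0) ∧ IsUnit (f 1)) ∪
      (Finset.univ.filter fun f : Fin 4 → R =>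
        cubicDisc (f 0) (f 1) (f 2) (f 3) = D ∧ ¬ IsUnit (f 0) ∧ ¬ IsUnit (f 1))) := by
    intro f hf
    simp only [Finset.mem_union, Finset.mem_filter, Finset.mem_univ, true_and] at hf ⊢
    tauto
  have h0 := (Finset.card_le_card hsub).trans ((Finset.card_union_le _ _).trans
    (add_le_add le_rfl (Finset.card_union_le _ _)))
  have h5 := card_cubicDisc_unit_second_le h2 hR D
  have h6 := card_cubicDisc_nonunit_le h2 hR hD
  rw [hn, hu, hcard] at h5 h6
  by_cases hDu : IsUnit D
  · have h7 := card_cubicDisc_unit_leading_le h2 hR hD Finset.univ (fun q => by simp)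
    rw [hu, Finset.card_univ, hcard] at h7
    simp only [hDu, if_true] at h6 ⊢
    omega
  · have h7 := card_cubicDisc_unit_leading_le h2 hR hD (Finset.univ.filter fun x : R => IsUnit x)
      (fun q => by by_cases hq : IsUnit q <;> simp [hq, hDu])
    rw [hu, hcard] at h7
    simp only [hDu, if_false] at h6 ⊢
    omega

end LocalCount

theorem ZMod.isUnit_prime_sq_iff {p : ℕ} [hp : Fact p.Prime] (x : ZMod (p ^ 2)) :
    IsUnit x ↔ ¬ p ∣ x.val := by
  have : NeZero (p ^ 2) := ⟨pow_ne_zero _ hp.out.ne_zero⟩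
  conv_lhs => rw [← ZMod.natCast_zmod_val x]
  rw [ZMod.isUnit_iff_coprime, Nat.coprime_pow_right_iff two_pos, Nat.coprime_comm,
    hp.out.coprime_iff_not_dvd]

theorem ZMod.nonunit_mul_eq_zero {p : ℕ} [hp : Fact p.Prime] (x y : ZMod (p ^ 2))
    (hx : ¬ IsUnit x) (hy : ¬ IsUnit y) : x * y = 0 := by
  have : NeZero (p ^ 2) := ⟨pow_ne_zero _ hp.out.ne_zero⟩
  rw [ZMod.isUnit_prime_sq_iff, not_not] at hx hy
  have : p ^ 2 ∣ x.val * y.val := (pow_two p).dvd.trans (mul_dvd_mul hx hy)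
  rw [← ZMod.natCast_zmod_val x, ← ZMod.natCast_zmod_val y, ← Nat.cast_mul]
  exact (ZMod.natCast_eq_zero_iff _ _).2 this

open Classical in
theorem ZMod.card_units_prime_sq {p : ℕ} [hp : Fact p.Prime] [NeZero (p ^ 2)] :
    (Finset.univ.filter fun x : ZMod (p ^ 2) => IsUnit x).card = p * (p - 1) := by
  have h := ZMod.card_units_eq_totient (p ^ 2)
  rw [Nat.totient_prime_pow hp.out two_pos] at h
  rw [show 2 - 1 = 1 from rfl, pow_one] at h
  rw [← h, ← Finset.card_univ]
  symm
  refine Finset.card_bij (fun u _ => (u : ZMod (p ^ 2))) (by simp) (by simp [Units.ext_iff]) ?_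
  intro x hx
  obtain ⟨u, rfl⟩ : IsUnit x := by simpa using hx
  exact ⟨u, by simp⟩

open Classical in
theorem ZMod.card_nonunits_prime_sq {p : ℕ} [hp : Fact p.Prime] [NeZero (p ^ 2)] :
    (Finset.univ.filter fun x : ZMod (p ^ 2) => ¬ IsUnit x).card = p := by
  have h1 := Finset.card_filter_add_card_filter_not (s := (Finset.univ : Finset (ZMod (p ^ 2))))
    (fun x => IsUnit x)
  rw [ZMod.card_units_prime_sq, Finset.card_univ, ZMod.card] at h1
  have : p * (p - 1) + p = p ^ 2 := by
    obtain ⟨k, hk⟩ : ∃ k, p = k + 1 := ⟨p - 1, by have := hp.out.pos; omega⟩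
    rw [hk]; simp; ring
  omega

theorem local_count_identity {p : ℕ} (hp : 0 < p) :
    p * (p - 1) * ((p + p * (p - 1)) * (p + p * (p - 1))) +
      p * (p * (p - 1) * (p + p * (p - 1))) = p ^ 6 - p ^ 4 ∧
    p * (p - 1) * ((p + p * (p - 1)) * (p * (p - 1))) +
      2 * (p * (p * (p - 1) * (p + p * (p - 1)))) = p ^ 6 - p ^ 4 := by
  obtain ⟨k, rfl⟩ : ∃ k, p = k + 1 := ⟨p - 1, by omega⟩
  have hk : k + 1 - 1 = k := rfl
  rw [hk]
  constructor <;> apply Nat.eq_sub_of_add_eq <;> ring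

theorem card_cubicDisc_odd_prime_sq_le {p : ℕ} [hp : Fact p.Prime] (hp2 : p ≠ 2) {D : ZMod (p ^ 2)}
    (hD : D ≠ 0) :
    Nat.card {f : Fin 4 → ZMod (p ^ 2) // cubicDisc (f 0) (f 1) (f 2) (f 3) = D} ≤
      p ^ 6 - p ^ 4 := by
  classical
  have : NeZero (p ^ 2) := ⟨pow_ne_zero _ hp.out.ne_zero⟩
  have h2 : IsUnit (2 : ZMod (p ^ 2)) := by
    have : IsUnit ((2 : ℕ) : ZMod (p ^ 2)) := by
      rw [ZMod.isUnit_iff_coprime]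
      exact ((Nat.coprime_primes Nat.prime_two hp.out).2 hp2.symm).pow_right 2
    exact_mod_cast this
  have h := card_cubicDisc_le h2 ZMod.nonunit_mul_eq_zero hD (n := p) (u := p * (p - 1))
    (by convert ZMod.card_nonunits_prime_sq (p := p)) (by convert ZMod.card_units_prime_sq (p := p))
  refine (Nat.subtype_card _ fun f => ?_).le.trans (h.trans ?_)
  · simp only [Finset.mem_filter, Finset.mem_univ, true_and]
  split_ifs
  · exact (local_count_identity hp.out.pos).1.le
  · exact (local_count_identity hp.out.pos).2.le

/-- Sum of `f` over `0, …, n - 1`, in a form that evaluates by plain recursion. -/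
def sumBelow (f : ℕ → ℕ) : ℕ → ℕ := Nat.rec 0 (fun n r => f n + r)

theorem sumBelow_eq (f : ℕ → ℕ) (n : ℕ) : sumBelow f n = ∑ i ∈ Finset.range n, f i := by
  induction n with
  | zero => rfl
  | succ n ih => rw [Finset.sum_range_succ, ← ih, Nat.add_comm _ (f n)]; rfl

/-- The discriminant modulo `16`, computed with natural numbers. -/
def cubicDiscMod (a b c d : ℕ) : ℕ :=
  (a * a * (d * d) + 13 * (b * b * (c * c)) + 4 * (a * (c * c * c)) + 4 * (b * b * b * d) +
    10 * (a * b * (c * d))) % 16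

/-- Number of triples in a box on which `f` takes the value `D`. -/
def boxCount (D : ℕ) (f : ℕ → ℕ → ℕ → ℕ) (l m n : ℕ) : ℕ :=
  sumBelow (fun x => sumBelow (fun y => sumBelow
    (fun z => cond (Nat.beq (f x y z) D) 1 0) n) m) l

theorem boxCount_eq (D : ℕ) (f : ℕ → ℕ → ℕ → ℕ) (l m n : ℕ) :
    boxCount D f l m n = ((Finset.range l ×ˢ Finset.range m ×ˢ Finset.range n).filter
      fun t => f t.1 t.2.1 t.2.2 = D).card := by
  rw [Finset.card_filter, Finset.sum_product]
  simp only [Finset.sum_product, boxCount, sumBelow_eq]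
  refine Finset.sum_congr rfl fun x _ => Finset.sum_congr rfl fun y _ =>
    Finset.sum_congr rfl fun z _ => ?_
  by_cases h : f x y z = D
  · simp [h]
  · have : Nat.beq (f x y z) D = false := by
      rw [← Bool.not_eq_true, Nat.beq_eq]; exact h
    simp [h, this]

/-- Number of forms modulo `16` of discriminant `D` whose first odd coefficient is `1`. -/
def normalizedCount (D : ℕ) : ℕ :=
  boxCount D (fun x y z => cubicDiscMod 1 x y z) 16 16 16 +
  (boxCount D (fun x y z => cubicDiscMod (2 * x) 1 y z) 8 16 16 +
  (boxCount D (fun x y z => cubicDiscMod (2 * x) (2 * y) 1 z) 8 8 16 +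
  boxCount D (fun x y z => cubicDiscMod (2 * x) (2 * y) (2 * z) 1) 8 8 8))

set_option maxRecDepth 100000 in
theorem normalizedCount_eq : ∀ D ∈ [1, 5, 9, 13, 8, 12], normalizedCount D = 768 := by
  decide +kernel

theorem cubicDiscMod_eq (a b c d : ZMod 16) :
    cubicDiscMod a.val b.val c.val d.val = (cubicDisc a b c d).val := by
  have h : cubicDisc a b c d = ((cubicDiscMod a.val b.val c.val d.val : ℕ) : ZMod 16) := by
    have e13 : (13 : ZMod 16) = -3 := by decide
    have e10 : (10 : ZMod 16) = -6 := by decide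
    rw [cubicDiscMod, ZMod.natCast_mod]
    push_cast
    simp only [ZMod.natCast_val, ZMod.cast_id', id_eq, e13, e10]
    unfold cubicDisc; ring
  rw [h, ZMod.val_natCast]
  exact (Nat.mod_mod _ _).symm

theorem cubicDisc_smul {R : Type*} [CommRing R] (u a b c d : R) :
    cubicDisc (u * a) (u * b) (u * c) (u * d) = u ^ 4 * cubicDisc a b c d := by
  unfold cubicDisc; ring

theorem ZMod.val_sixteen_cases (x : ZMod 16) :
    (x.val % 2 = 1 ∧ x * (x ^ 3) = 1 ∧ x ^ 4 = 1) ∨ (∃ k < 8, x.val = 2 * k) := by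
  revert x; decide +kernel

open Classical in
theorem card_normalized_le {D : ℕ} (hD : D ∈ [1, 5, 9, 13, 8, 12]) :
    (Finset.univ.filter fun f : Fin 4 → ZMod 16 => cubicDisc (f 0) (f 1) (f 2) (f 3) = D ∧
      (f 0 = 1 ∨ ((f 0).val % 2 = 0 ∧ (f 1 = 1 ∨ ((f 1).val % 2 = 0 ∧ (f 2 = 1 ∨
        ((f 2).val % 2 = 0 ∧ f 3 = 1))))))).card ≤ 768 := by
  have hDlt : D < 16 := by revert hD; simp; omega
  have hv : ∀ f : Fin 4 → ZMod 16, cubicDisc (f 0) (f 1) (f 2) (f 3) = D →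
      cubicDiscMod (f 0).val (f 1).val (f 2).val (f 3).val = D := fun f hf => by
    rw [cubicDiscMod_eq, hf, ZMod.val_natCast, Nat.mod_eq_of_lt hDlt]
  have hlt : ∀ x : ZMod 16, x.val < 16 := fun x => ZMod.val_lt x
  have hhalf : ∀ x : ZMod 16, x.val % 2 = 0 → 2 * (x.val / 2) = x.val ∧ x.val / 2 < 8 :=
    fun x hx => by have := hlt x; omega
  have inj : ∀ x y : ZMod 16, x.val = y.val → x = y := fun x y h => ZMod.val_injective 16 h
  have inj2 : ∀ x y : ZMod 16, x.val % 2 = 0 → y.val % 2 = 0 → x.val / 2 = y.val / 2 → x = y :=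
    fun x y hx hy h => inj x y (by omega)
  have hval1 : (1 : ZMod 16).val = 1 := rfl
  rw [← normalizedCount_eq D hD, normalizedCount, boxCount_eq, boxCount_eq, boxCount_eq,
    boxCount_eq]
  have hsub : (Finset.univ.filter fun f : Fin 4 → ZMod 16 => cubicDisc (f 0) (f 1) (f 2) (f 3) = D ∧
      (f 0 = 1 ∨ ((f 0).val % 2 = 0 ∧ (f 1 = 1 ∨ ((f 1).val % 2 = 0 ∧ (f 2 = 1 ∨
        ((f 2).val % 2 = 0 ∧ f 3 = 1))))))) ⊆
      (Finset.univ.filter fun f => cubicDisc (f 0) (f 1) (f 2) (f 3) = D ∧ f 0 = 1) ∪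
      ((Finset.univ.filter fun f => cubicDisc (f 0) (f 1) (f 2) (f 3) = D ∧
        (f 0).val % 2 = 0 ∧ f 1 = 1) ∪
      ((Finset.univ.filter fun f => cubicDisc (f 0) (f 1) (f 2) (f 3) = D ∧
        (f 0).val % 2 = 0 ∧ (f 1).val % 2 = 0 ∧ f 2 = 1) ∪
      (Finset.univ.filter fun f => cubicDisc (f 0) (f 1) (f 2) (f 3) = D ∧
        (f 0).val % 2 = 0 ∧ (f 1).val % 2 = 0 ∧ (f 2).val % 2 = 0 ∧ f 3 = 1))) := by
    intro f hf
    simp only [Finset.mem_union, Finset.mem_filter, Finset.mem_univ, true_and] at hf ⊢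
    tauto
  refine (Finset.card_le_card hsub).trans ((Finset.card_union_le _ _).trans (add_le_add ?_
    ((Finset.card_union_le _ _).trans (add_le_add ?_ ((Finset.card_union_le _ _).trans
    (add_le_add ?_ ?_))))))
  · refine Finset.card_le_card_of_injOn (fun f => ((f 1).val, (f 2).val, (f 3).val)) ?_ ?_
    · intro f hf
      simp only [Finset.mem_coe, Finset.mem_filter, Finset.mem_univ, true_and] at hf
      have := hv f hf.1
      rw [hf.2, hval1] at this
      simp [hlt, this]
    · intro f hf g hg hfg
      simp only [Finset.mem_coe, Finset.mem_filter, Finset.mem_univ, true_and] at hf hg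
      simp only [Prod.mk.injEq] at hfg
      ext i; fin_cases i
      exacts [hf.2.trans hg.2.symm, inj _ _ hfg.1, inj _ _ hfg.2.1, inj _ _ hfg.2.2]
  · refine Finset.card_le_card_of_injOn (fun f => ((f 0).val / 2, (f 2).val, (f 3).val)) ?_ ?_
    · intro f hf
      simp only [Finset.mem_coe, Finset.mem_filter, Finset.mem_univ, true_and] at hf
      have := hv f hf.1
      rw [hf.2.2, hval1] at this
      simp [hlt, this, hhalf _ hf.2.1]
    · intro f hf g hg hfg
      simp only [Finset.mem_coe, Finset.mem_filter, Finset.mem_univ, true_and] at hf hg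
      simp only [Prod.mk.injEq] at hfg
      ext i; fin_cases i
      exacts [inj2 _ _ hf.2.1 hg.2.1 hfg.1, hf.2.2.trans hg.2.2.symm, inj _ _ hfg.2.1,
        inj _ _ hfg.2.2]
  · refine Finset.card_le_card_of_injOn (fun f => ((f 0).val / 2, (f 1).val / 2, (f 3).val)) ?_ ?_
    · intro f hf
      simp only [Finset.mem_coe, Finset.mem_filter, Finset.mem_univ, true_and] at hf
      have := hv f hf.1
      rw [hf.2.2.2, hval1] at this
      simp [hlt, this, hhalf _ hf.2.1, hhalf _ hf.2.2.1]
    · intro f hf g hg hfg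
      simp only [Finset.mem_coe, Finset.mem_filter, Finset.mem_univ, true_and] at hf hg
      simp only [Prod.mk.injEq] at hfg
      ext i; fin_cases i
      exacts [inj2 _ _ hf.2.1 hg.2.1 hfg.1, inj2 _ _ hf.2.2.1 hg.2.2.1 hfg.2.1,
        hf.2.2.2.trans hg.2.2.2.symm, inj _ _ hfg.2.2]
  · refine Finset.card_le_card_of_injOn
      (fun f => ((f 0).val / 2, (f 1).val / 2, (f 2).val / 2)) ?_ ?_
    · intro f hf
      simp only [Finset.mem_coe, Finset.mem_filter, Finset.mem_univ, true_and] at hf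
      have := hv f hf.1
      rw [hf.2.2.2.2, hval1] at this
      simp [this, hhalf _ hf.2.1, hhalf _ hf.2.2.1, hhalf _ hf.2.2.2.1]
    · intro f hf g hg hfg
      simp only [Finset.mem_coe, Finset.mem_filter, Finset.mem_univ, true_and] at hf hg
      simp only [Prod.mk.injEq] at hfg
      ext i; fin_cases i
      exacts [inj2 _ _ hf.2.1 hg.2.1 hfg.1, inj2 _ _ hf.2.2.1 hg.2.2.1 hfg.2.1,
        inj2 _ _ hf.2.2.2.1 hg.2.2.2.1 hfg.2.2, hf.2.2.2.2.trans hg.2.2.2.2.symm]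

theorem card_cubicDisc_sixteen_le {D : ZMod 16} (hD : D.val ∈ [1, 5, 9, 13, 8, 12]) :
    Nat.card {f : Fin 4 → ZMod 16 // cubicDisc (f 0) (f 1) (f 2) (f 3) = D} ≤ 6144 := by
  classical
  refine (Nat.subtype_card (Finset.univ.filter fun f : Fin 4 → ZMod 16 =>
    cubicDisc (f 0) (f 1) (f 2) (f 3) = D) fun f => ?_).le.trans ?_
  · simp only [Finset.mem_filter, Finset.mem_univ, true_and]
  have hn := card_normalized_le hD
  rw [ZMod.natCast_val, ZMod.cast_id', id_eq] at hn
  -- the first odd coefficient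
  have hlead : ∀ f : Fin 4 → ZMod 16, cubicDisc (f 0) (f 1) (f 2) (f 3) = D →
      ∃ u : ZMod 16, u.val % 2 = 1 ∧ u * u ^ 3 = 1 ∧
        (f 0 = u ∨ ((f 0).val % 2 = 0 ∧ (f 1 = u ∨ ((f 1).val % 2 = 0 ∧ (f 2 = u ∨
        ((f 2).val % 2 = 0 ∧ f 3 = u)))))) := by
    intro f hf
    rcases ZMod.val_sixteen_cases (f 0) with h0 | ⟨k0, -, h0⟩
    · exact ⟨f 0, h0.1, h0.2.1, Or.inl rfl⟩
    rcases ZMod.val_sixteen_cases (f 1) with h1 | ⟨k1, -, h1⟩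
    · exact ⟨f 1, h1.1, h1.2.1, Or.inr ⟨by omega, Or.inl rfl⟩⟩
    rcases ZMod.val_sixteen_cases (f 2) with h2 | ⟨k2, -, h2⟩
    · exact ⟨f 2, h2.1, h2.2.1, Or.inr ⟨by omega, Or.inr ⟨by omega, Or.inl rfl⟩⟩⟩
    rcases ZMod.val_sixteen_cases (f 3) with h3 | ⟨k3, -, h3⟩
    · exact ⟨f 3, h3.1, h3.2.1, Or.inr ⟨by omega, Or.inr ⟨by omega, Or.inr ⟨by omega, rfl⟩⟩⟩⟩
    exfalso
    have e : ∀ (x : ZMod 16) (k : ℕ), x.val = 2 * k → x = 2 * k := fun x k h => by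
      rw [← ZMod.natCast_zmod_val x, h]; push_cast; rfl
    have h16 : (16 : ZMod 16) = 0 := by decide
    have : D = 0 := by
      have h2' : (2 : ZMod 16) ^ 4 = 0 := by decide
      rw [← hf, e _ _ h0, e _ _ h1, e _ _ h2, e _ _ h3, cubicDisc_smul, h2', zero_mul]
    simp [this] at hD
  choose! u hu1 hu2 hu3 using hlead
  have hmul2 : ∀ x y : ZMod 16, x.val % 2 = 0 → (y * x).val % 2 = 0 := by decide +kernel
  have hc := Finset.card_le_card_of_injOn (s := Finset.univ.filter fun f : Fin 4 → ZMod 16 =>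
      cubicDisc (f 0) (f 1) (f 2) (f 3) = D)
    (t := (Finset.univ.filter fun x : ZMod 16 => x.val % 2 = 1) ×ˢ
      Finset.univ.filter fun f : Fin 4 → ZMod 16 => cubicDisc (f 0) (f 1) (f 2) (f 3) = D ∧
      (f 0 = 1 ∨ ((f 0).val % 2 = 0 ∧ (f 1 = 1 ∨ ((f 1).val % 2 = 0 ∧ (f 2 = 1 ∨
        ((f 2).val % 2 = 0 ∧ f 3 = 1)))))))
    (fun f => (u f, fun i => u f ^ 3 * f i)) ?_ ?_
  · refine hc.trans ?_
    rw [Finset.card_product]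
    have : (Finset.univ.filter fun x : ZMod 16 => x.val % 2 = 1).card = 8 := by decide
    rw [this]
    omega
  · intro f hf
    simp only [Finset.mem_coe, Finset.mem_filter, Finset.mem_univ, true_and,
      Finset.mem_product] at hf ⊢
    refine ⟨hu1 f hf, ?_, ?_⟩
    · have : (u f ^ 3) ^ 4 = 1 := by
        have := hu2 f hf
        calc (u f ^ 3) ^ 4 = (u f * u f ^ 3) ^ 3 := by ring
          _ = 1 := by rw [this, one_pow]
      rw [cubicDisc_smul, this, one_mul, hf]
    · have h1 : ∀ x : ZMod 16, x = u f → u f ^ 3 * x = 1 := fun x hx => by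
        rw [hx, mul_comm]; exact hu2 f hf
      rcases hu3 f hf with h | ⟨h0, h | ⟨h1', h | ⟨h2', h⟩⟩⟩
      · exact Or.inl (h1 _ h)
      · exact Or.inr ⟨hmul2 _ _ h0, Or.inl (h1 _ h)⟩
      · exact Or.inr ⟨hmul2 _ _ h0, Or.inr ⟨hmul2 _ _ h1', Or.inl (h1 _ h)⟩⟩
      · exact Or.inr ⟨hmul2 _ _ h0, Or.inr ⟨hmul2 _ _ h1', Or.inr ⟨hmul2 _ _ h2', h1 _ h⟩⟩⟩
  · intro f hf g hg hfg
    simp only [Finset.mem_coe, Finset.mem_filter, Finset.mem_univ, true_and] at hf hg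
    simp only [Prod.mk.injEq] at hfg
    obtain ⟨h1, h2⟩ := hfg
    ext i
    have h3 := congrFun h2 i
    have h4 := hu2 f hf
    rw [← h1] at h3
    calc f i = (u f * u f ^ 3) * f i := by rw [h4, one_mul]
      _ = u f * (u f ^ 3 * f i) := by ring
      _ = (u f * u f ^ 3) * g i := by rw [h3]; ring
      _ = g i := by rw [h4, one_mul]

theorem map_cubicDisc {R S : Type*} [CommRing R] [CommRing S] (φ : R →+* S) (a b c d : R) :
    φ (cubicDisc a b c d) = cubicDisc (φ a) (φ b) (φ c) (φ d) := by
  have h3 : φ 3 = 3 := map_ofNat φ 3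
  have h4 : φ 4 = 4 := map_ofNat φ 4
  have h6 : φ 6 = 6 := map_ofNat φ 6
  simp [cubicDisc, h3, h4, h6]

/-- Forms over `R` whose discriminant lies in `L`. -/
def discForms {R : Type*} [CommRing R] (L : Set R) : Set (Fin 4 → R) :=
  {f | cubicDisc (f 0) (f 1) (f 2) (f 3) ∈ L}

theorem card_discForms_le {R : Type*} [CommRing R] [Finite R] {L : Set R} {k : ℕ}
    (h : ∀ D ∈ L, Nat.card {f : Fin 4 → R // cubicDisc (f 0) (f 1) (f 2) (f 3) = D} ≤ k) :
    Nat.card (discForms L) ≤ k * Nat.card L := by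
  classical
  have := Fintype.ofFinite R
  have e : discForms L ≃ Σ D : L, {f : Fin 4 → R // cubicDisc (f 0) (f 1) (f 2) (f 3) = D} :=
    { toFun := fun f => ⟨⟨_, f.2⟩, ⟨f.1, rfl⟩⟩
      invFun := fun x => ⟨x.2.val, by
        change cubicDisc _ _ _ _ ∈ L
        rw [x.2.property]
        exact x.1.property⟩
      left_inv := fun f => rfl
      right_inv := fun ⟨⟨D, hD⟩, ⟨f, hf⟩⟩ => by
        have hf' : cubicDisc (f 0) (f 1) (f 2) (f 3) = D := hf
        subst hf'; rfl }
  rw [Nat.card_congr e, Nat.card_sigma]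
  refine (Finset.sum_le_card_nsmul _ _ k fun (D : L) _ => h D.val D.property).trans ?_
  rw [Finset.card_univ, Nat.card_eq_fintype_card, smul_eq_mul, mul_comm]

section CRT

variable {ι : Type*} {R : Type*} [CommRing R] {S : ι → Type*} [∀ i, CommRing (S i)]

/-- Elements of a product ring with all components in prescribed sets. -/
def crtSet (e : R ≃+* ∀ i, S i) (L : ∀ i, Set (S i)) : Set R :=
  {D | ∀ i, e D i ∈ L i}

theorem intCast_mem_crtSet (e : R ≃+* ∀ i, S i) (L : ∀ i, Set (S i)) (n : ℤ) :
    (n : R) ∈ crtSet e L ↔ ∀ i, (n : S i) ∈ L i := by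
  simp [crtSet]

variable [Fintype ι]

theorem card_crtSet (e : R ≃+* ∀ i, S i) (L : ∀ i, Set (S i)) :
    Nat.card (crtSet e L) = ∏ i, Nat.card (L i) := by
  rw [← Nat.card_pi]
  refine Nat.card_congr ?_
  exact
    { toFun := fun D i => ⟨e D i, D.2 i⟩
      invFun := fun x => ⟨e.symm fun i => x i, fun i => by simp⟩
      left_inv := fun D => by simp
      right_inv := fun x => by simp }

theorem card_discForms_crtSet (e : R ≃+* ∀ i, S i) (L : ∀ i, Set (S i)) :
    Nat.card (discForms (crtSet e L)) = ∏ i, Nat.card (discForms (L i)) := by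
  rw [← Nat.card_pi]
  have key : ∀ (f : Fin 4 → R) (i : ι), e (cubicDisc (f 0) (f 1) (f 2) (f 3)) i =
      cubicDisc (e (f 0) i) (e (f 1) i) (e (f 2) i) (e (f 3) i) := fun f i =>
    map_cubicDisc ((Pi.evalRingHom _ i).comp e.toRingHom) _ _ _ _
  refine Nat.card_congr ?_
  exact
    { toFun := fun f i => ⟨fun j => e (f.1 j) i, by
        have := f.2 i
        rw [key] at this
        exact this⟩
      invFun := fun x => ⟨fun j => e.symm fun i => (x i).1 j, fun i => by
        have : cubicDisc ((x i).1 0) ((x i).1 1) ((x i).1 2) ((x i).1 3) ∈ L i := (x i).2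
        change e (cubicDisc _ _ _ _) i ∈ L i
        rw [key (fun j => e.symm fun i => (x i).1 j) i]
        simpa only [RingEquiv.apply_symm_apply] using this⟩
      left_inv := fun f => by ext j; simp
      right_inv := fun x => by ext i j; simp }

theorem card_discForms_crtSet_le [∀ i, Finite (S i)] (e : R ≃+* ∀ i, S i) (L : ∀ i, Set (S i))
    {k : ι → ℕ} (h : ∀ i, ∀ D ∈ L i,
      Nat.card {f : Fin 4 → S i // cubicDisc (f 0) (f 1) (f 2) (f 3) = D} ≤ k i) :
    Nat.card (discForms (crtSet e L)) ≤ (∏ i, k i) * Nat.card (crtSet e L) := by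
  rw [card_discForms_crtSet, card_crtSet, ← Finset.prod_mul_distrib]
  exact Finset.prod_le_prod' fun i _ => card_discForms_le (h i)

end CRT

section VolumeCalculus

open MeasureTheory ENNReal

theorem lintegral_comp_affine {a : ℝ} (ha : a ≠ 0) (k : ℝ) {H : ℝ → ℝ≥0∞} (hH : Measurable H) :
    ∫⁻ x, H (a * x + k) = ENNReal.ofReal |a⁻¹| * ∫⁻ x, H x := by
  have h1 : Measurable fun x => H (x + k) := hH.comp (by fun_prop)
  rw [← lintegral_add_right_eq_self H k, ← lintegral_map (f := fun x => H (x + k)) (g := fun x => a * x) h1 (by fun_prop),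
    Real.map_volume_mul_left ha, lintegral_smul_measure, smul_eq_mul]

theorem lintegral_Icc_of_hasDerivAt {a b : ℝ} (hab : a ≤ b) {F f : ℝ → ℝ}
    (hF : ∀ x ∈ Set.Icc a b, HasDerivAt F (f x) x) (hf : ContinuousOn f (Set.Icc a b))
    (h0 : ∀ x ∈ Set.Icc a b, 0 ≤ f x) :
    ∫⁻ x in Set.Icc a b, ENNReal.ofReal (f x) = ENNReal.ofReal (F b - F a) := by
  have hi : IntegrableOn f (Set.Icc a b) := hf.integrableOn_Icc
  rw [← ofReal_integral_eq_lintegral_ofReal hi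
    ((ae_restrict_iff' measurableSet_Icc).2 (Eventually.of_forall h0)),
    integral_Icc_eq_integral_Ioc, ← intervalIntegral.integral_of_le hab,
    intervalIntegral.integral_eq_sub_of_hasDerivAt]
  · rwa [Set.uIcc_of_le hab]
  · rw [intervalIntegrable_iff_integrableOn_Icc_of_le hab]
    exact hi

theorem lintegral_inv_quadratic {A B C : ℝ} (hA : 0 < A) (hD : 0 < 4 * A * C - B ^ 2) :
    ∫⁻ s : ℝ, ENNReal.ofReal (1 / (2 * (C + (s * B + s ^ 2 * A)))) =
      ENNReal.ofReal (Real.pi / √(4 * A * C - B ^ 2)) := by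
  set r := √(4 * A * C - B ^ 2) with hr
  have hr0 : 0 < r := Real.sqrt_pos.2 hD
  have hr2 : r ^ 2 = 4 * A * C - B ^ 2 := Real.sq_sqrt hD.le
  have key : ∀ s : ℝ, ENNReal.ofReal (1 / (2 * (C + (s * B + s ^ 2 * A)))) =
      ENNReal.ofReal (2 * A / r ^ 2) *
        ENNReal.ofReal (1 + ((2 * A / r) * s + B / r) ^ 2)⁻¹ := by
    intro s
    rw [← ENNReal.ofReal_mul (by positivity)]
    congr 1
    have e : 2 * (C + (s * B + s ^ 2 * A)) = r ^ 2 * (1 + ((2 * A / r) * s + B / r) ^ 2) / (2 * A) := by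
      field_simp
      rw [hr2]; ring
    rw [e]
    have : 0 < 1 + ((2 * A / r) * s + B / r) ^ 2 := by positivity
    field_simp
  simp_rw [key]
  rw [lintegral_const_mul _ (by fun_prop),
    lintegral_comp_affine (H := fun u => ENNReal.ofReal (1 + u ^ 2)⁻¹) (by positivity) _
      (by fun_prop), ← ofReal_integral_eq_lintegral_ofReal integrable_inv_one_add_sq
      (Eventually.of_forall fun x => by positivity), integral_univ_inv_one_add_sq,
    ← ENNReal.ofReal_mul (by positivity), ← ENNReal.ofReal_mul (by positivity),
    abs_of_pos (by positivity)]
  congr 1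
  field_simp

theorem lintegral_rsqrt_disc_le {A B : ℝ} (hA : 0 < A) (hB : 0 ≤ B) (hBA : B ≤ A) :
    ∫⁻ C in {C | A ≤ C ∧ 4 * A * C - B ^ 2 ≤ 1},
        ENNReal.ofReal (Real.pi / √(4 * A * C - B ^ 2)) ≤
      ENNReal.ofReal (Real.pi / (2 * A) * (1 - √(4 * A ^ 2 - B ^ 2))) := by
  have hset : {C | A ≤ C ∧ 4 * A * C - B ^ 2 ≤ 1} = Set.Icc A ((1 + B ^ 2) / (4 * A)) := by
    ext C
    simp only [Set.mem_ofPred_eq, Set.mem_Icc]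
    rw [le_div_iff₀ (by positivity)]
    constructor <;> rintro ⟨h1, h2⟩ <;> exact ⟨h1, by linarith⟩
  rw [hset]
  rcases le_total A ((1 + B ^ 2) / (4 * A)) with h | h
  · have hpos : ∀ x ∈ Set.Icc A ((1 + B ^ 2) / (4 * A)), 0 < 4 * A * x - B ^ 2 := by
      intro x hx
      nlinarith [hx.1]
    rw [lintegral_Icc_of_hasDerivAt h (F := fun C => Real.pi / (2 * A) * √(4 * A * C - B ^ 2))]
    · refine (congrArg ENNReal.ofReal ?_).le
      have : 4 * A * ((1 + B ^ 2) / (4 * A)) - B ^ 2 = 1 := by field_simp; ring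
      simp only [this, Real.sqrt_one]
      rw [show 4 * A * A = 4 * A ^ 2 by ring]; ring
    · intro x hx
      have hp := hpos x hx
      have h1 : HasDerivAt (fun C => 4 * A * C - B ^ 2) (4 * A) x := by
        simpa using ((hasDerivAt_id x).const_mul (4 * A)).sub_const (B ^ 2)
      have := (h1.sqrt hp.ne').const_mul (Real.pi / (2 * A))
      refine HasDerivAt.congr_deriv this ?_
      have := Real.sqrt_pos.2 hp
      field_simp
      ring
    · refine continuousOn_const.div (by fun_prop) fun x hx => ?_
      exact (Real.sqrt_pos.2 (hpos x hx)).ne'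
    · intro x hx
      have := Real.pi_pos
      positivity
  · rcases h.eq_or_lt with h | h
    · rw [h]; simp
    · rw [Set.Icc_eq_empty (not_le.2 h)]; simp

theorem lintegral_one_sub_mul {w : ℝ} (hw : 0 < w) :
    ∫⁻ A in Set.Ioi (0 : ℝ), ENNReal.ofReal (Real.pi / 2 * (1 - A * w)) ≤
      ENNReal.ofReal (Real.pi / (4 * w)) := by
  have hsub : ∫⁻ A in Set.Ioi (0 : ℝ), ENNReal.ofReal (Real.pi / 2 * (1 - A * w)) ≤
      ∫⁻ A in Set.Icc (0 : ℝ) (1 / w), ENNReal.ofReal (Real.pi / 2 * (1 - A * w)) := by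
    rw [← lintegral_indicator measurableSet_Ioi, ← lintegral_indicator measurableSet_Icc]
    refine lintegral_mono fun A => ?_
    by_cases h : A ∈ Set.Icc (0 : ℝ) (1 / w)
    · rw [Set.indicator_of_mem h]
      exact Set.indicator_le_self _ _ _
    · rw [Set.indicator_of_notMem h]
      by_cases h' : A ∈ Set.Ioi (0 : ℝ)
      · rw [Set.indicator_of_mem h', ENNReal.ofReal_of_nonpos]
        have h2 : 1 / w < A := by
          by_contra hc
          exact h ⟨le_of_lt h', not_lt.1 hc⟩
        rw [div_lt_iff₀ hw] at h2
        nlinarith [Real.pi_pos]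
      · rw [Set.indicator_of_notMem h']
  refine hsub.trans (le_of_eq ?_)
  rw [lintegral_Icc_of_hasDerivAt (by positivity)
    (F := fun A => Real.pi / 2 * (A - A ^ 2 * w / 2))]
  · congr 1; field_simp; ring
  · intro x _
    have := (((hasDerivAt_id x).sub (((hasDerivAt_pow 2 x).mul_const w).div_const 2))).const_mul
      (Real.pi / 2)
    refine HasDerivAt.congr_deriv this ?_
    simp; ring
  · fun_prop
  · intro x hx
    have : x * w ≤ 1 := (le_div_iff₀ hw).1 hx.2
    have := Real.pi_pos
    have : 0 ≤ 1 - x * w := by linarith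
    positivity

theorem lintegral_rsqrt_four_sub_sq :
    ∫⁻ σ in Set.Icc (0 : ℝ) 1, ENNReal.ofReal (Real.pi / (4 * √(4 - σ ^ 2))) =
      ENNReal.ofReal (Real.pi ^ 2 / 24) := by
  have hpos : ∀ x ∈ Set.Icc (0 : ℝ) 1, 0 < 4 - x ^ 2 := fun x hx => by nlinarith [hx.1, hx.2]
  rw [lintegral_Icc_of_hasDerivAt zero_le_one (F := fun σ => Real.pi / 4 * Real.arcsin (σ / 2))]
  · have : Real.arcsin (1 / 2) = Real.pi / 6 := by
      rw [← Real.sin_pi_div_six, Real.arcsin_sin] <;> linarith [Real.pi_pos]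
    congr 1
    simp only [zero_div, Real.arcsin_zero, mul_zero, sub_zero]
    rw [this]; ring
  · intro x hx
    have hp := hpos x hx
    have h1 := (Real.hasDerivAt_arcsin (x := x / 2) (by linarith [hx.1]) (by linarith [hx.2])).comp x
      ((hasDerivAt_id x).div_const 2)
    have := h1.const_mul (Real.pi / 4)
    refine HasDerivAt.congr_deriv this ?_
    have e : √(1 - (x / 2) ^ 2) = √(4 - x ^ 2) / 2 := by
      rw [show 1 - (x / 2) ^ 2 = (4 - x ^ 2) / 2 ^ 2 by ring, Real.sqrt_div hp.le,
        Real.sqrt_sq (by norm_num)]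
    rw [e]
    have := Real.sqrt_pos.2 hp
    field_simp
    try ring
  · refine continuousOn_const.div (by fun_prop) fun x hx => ?_
    have := Real.sqrt_pos.2 (hpos x hx)
    positivity
  · intro x hx
    have := Real.pi_pos
    positivity

theorem lintegral_inv_mul_comp_div_sq {A : ℝ} (hA : 0 < A) (g : ℝ → ℝ≥0∞) :
    ∫⁻ a in Set.Ioi (0 : ℝ), ENNReal.ofReal a⁻¹ * g (A ^ 2 / a ^ 2) =
      ∫⁻ t in Set.Ioi (0 : ℝ), ENNReal.ofReal (1 / (2 * t)) * g t := by
  have himg : (fun t : ℝ => A / √t) '' Set.Ioi 0 = Set.Ioi 0 := by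
    ext a
    constructor
    · rintro ⟨t, ht, rfl⟩
      have := Real.sqrt_pos.2 ht
      exact div_pos hA this
    · intro ha
      have ha' : 0 < a := ha
      refine ⟨(A / a) ^ 2, pow_pos (div_pos hA ha') 2, ?_⟩
      simp only
      rw [Real.sqrt_sq (by positivity)]
      field_simp
  have hinj : Set.InjOn (fun t : ℝ => A / √t) (Set.Ioi 0) := by
    intro s hs t ht h
    have h1 := Real.sqrt_pos.2 hs
    have h2 := Real.sqrt_pos.2 ht
    simp only at h
    rw [div_eq_div_iff h1.ne' h2.ne'] at h
    have : √s = √t := by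
      have := mul_left_cancel₀ hA.ne' h
      exact this.symm
    rw [← Real.sq_sqrt (le_of_lt hs), ← Real.sq_sqrt (le_of_lt ht), this]
  conv_lhs => rw [← himg]
  rw [lintegral_image_eq_lintegral_abs_deriv_mul measurableSet_Ioi
    (f' := fun t => -(A / (2 * t * √t))) _ hinj]
  · refine setLIntegral_congr_fun measurableSet_Ioi fun t ht => ?_
    have ht' : 0 < t := ht
    have hs := Real.sqrt_pos.2 ht'
    have hss := Real.sq_sqrt ht'.le
    have e : A ^ 2 / (A / √t) ^ 2 = t := by
      rw [div_pow, hss]; field_simp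
    simp only [e]
    rw [← mul_assoc, ← ENNReal.ofReal_mul (abs_nonneg _), abs_neg, abs_of_pos (by positivity)]
    congr 2
    field_simp
  · intro t ht
    have ht' : 0 < t := ht
    have hs := Real.sqrt_pos.2 ht'
    have hss := Real.sq_sqrt ht'.le
    have := (((hasDerivAt_id t).sqrt ht'.ne').inv hs.ne').const_mul A
    refine HasDerivAt.hasDerivWithinAt ?_
    refine HasDerivAt.congr_deriv this ?_
    simp only [id]
    rw [hss]
    field_simp

end VolumeCalculus

section ReducedVolume

open MeasureTheory ENNReal

theorem lintegral_fin_cons {n : ℕ} {g : (Fin (n + 1) → ℝ) → ℝ≥0∞} (hg : Measurable g) :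
    ∫⁻ f, g f = ∫⁻ x, ∫⁻ y : Fin n → ℝ, g (Fin.cons x y) := by
  have hp := volume_preserving_piFinSuccAbove (fun _ : Fin (n + 1) => ℝ) 0
  have h := (hp.symm _).lintegral_comp hg
  rw [← h]
  have hm : Measurable fun z : ℝ × (Fin n → ℝ) => g ((MeasurableEquiv.piFinSuccAbove (fun _ : Fin (n + 1) => ℝ) 0).symm z) :=
    hg.comp (MeasurableEquiv.measurable _)
  refine (lintegral_prod _ hm.aemeasurable).trans ?_
  refine lintegral_congr fun x => lintegral_congr fun y => ?_
  simp [MeasurableEquiv.piFinSuccAbove, Fin.insertNthEquiv]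

theorem lintegral_fin_four {g : (Fin 4 → ℝ) → ℝ≥0∞} (hg : Measurable g) :
    ∫⁻ f, g f = ∫⁻ a, ∫⁻ b, ∫⁻ c, ∫⁻ d, g ![a, b, c, d] := by
  have hcons : ∀ {n : ℕ} {h : (Fin (n + 1) → ℝ) → ℝ≥0∞} (x : ℝ), Measurable h →
      Measurable fun y : Fin n → ℝ => h (Fin.cons x y) := by
    intro n h x hh
    refine hh.comp (measurable_pi_iff.2 fun i => ?_)
    refine Fin.cases ?_ (fun j => ?_) i
    · simp only [Fin.cons_zero]; fun_prop
    · simp only [Fin.cons_succ]; fun_prop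
  rw [lintegral_fin_cons hg]
  refine lintegral_congr fun a => ?_
  rw [lintegral_fin_cons (hcons a hg)]
  refine lintegral_congr fun b => ?_
  rw [lintegral_fin_cons (hcons b (hcons a hg))]
  refine lintegral_congr fun c => ?_
  rw [lintegral_fin_cons (hcons c (hcons b (hcons a hg)))]
  refine lintegral_congr fun d => ?_
  rw [Measure.volume_pi_eq_dirac, lintegral_dirac]
  refine congrArg g ?_
  ext i
  fin_cases i <;> rfl

theorem lintegral_four_swap {μ : Measure ℝ} [SFinite μ] {F : ℝ → ℝ → ℝ → ℝ → ℝ≥0∞}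
    (hF : Measurable fun p : (ℝ × ℝ) × ℝ × ℝ => F p.1.1 p.1.2 p.2.1 p.2.2) :
    ∫⁻ a, (∫⁻ s, ∫⁻ A, ∫⁻ B, F a s A B) ∂μ = ∫⁻ A, ∫⁻ B, ∫⁻ s, ∫⁻ a, F a s A B ∂μ := by
  have h1 : ∀ a s, ∫⁻ A, ∫⁻ B, F a s A B = ∫⁻ q : ℝ × ℝ, F a s q.1 q.2 := fun a s =>
    (lintegral_prod (fun q : ℝ × ℝ => F a s q.1 q.2)
      (hF.comp (measurable_const.prodMk measurable_id :
        Measurable fun q : ℝ × ℝ => (((a, s), q) : (ℝ × ℝ) × ℝ × ℝ))).aemeasurable).symm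
  have h2 : ∀ A B, ∫⁻ s, ∫⁻ a, F a s A B ∂μ =
      ∫⁻ p : ℝ × ℝ, F p.1 p.2 A B ∂(μ.prod volume) := fun A B =>
    (lintegral_prod_symm (fun p : ℝ × ℝ => F p.1 p.2 A B)
      (hF.comp (measurable_id.prodMk measurable_const :
        Measurable fun p : ℝ × ℝ => ((p, (A, B)) : (ℝ × ℝ) × ℝ × ℝ))).aemeasurable).symm
  simp_rw [h1, h2]
  have m1 : Measurable fun p : ℝ × ℝ => ∫⁻ q : ℝ × ℝ, F p.1 p.2 q.1 q.2 :=
    Measurable.lintegral_prod_right' hF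
  have m2 : Measurable fun q : ℝ × ℝ => ∫⁻ p : ℝ × ℝ, F p.1 p.2 q.1 q.2 ∂(μ.prod volume) :=
    Measurable.lintegral_prod_left' hF
  rw [← lintegral_prod _ m1.aemeasurable, lintegral_lintegral_swap hF.aemeasurable,
    Measure.volume_eq_prod, lintegral_prod _ m2.aemeasurable]

/-- Triples `(A, B, C)` of coefficients of reduced positive definite binary quadratic forms of
discriminant at least `-1`. -/
def reducedHessians : Set (ℝ × ℝ × ℝ) :=
  {p | 0 < p.1 ∧ 0 ≤ p.2.1 ∧ p.2.1 ≤ p.1 ∧ p.1 ≤ p.2.2 ∧ 4 * p.1 * p.2.2 - p.2.1 ^ 2 ≤ 1}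

theorem measurableSet_reducedHessians : MeasurableSet reducedHessians := by
  change MeasurableSet ({p : ℝ × ℝ × ℝ | 0 < p.1} ∩ ({p | 0 ≤ p.2.1} ∩ ({p | p.2.1 ≤ p.1} ∩
    ({p | p.1 ≤ p.2.2} ∩ {p | 4 * p.1 * p.2.2 - p.2.1 ^ 2 ≤ 1}))))
  refine (measurableSet_lt ?_ ?_).inter ((measurableSet_le ?_ ?_).inter ((measurableSet_le ?_ ?_).inter
    ((measurableSet_le ?_ ?_).inter (measurableSet_le ?_ ?_)))) <;> fun_prop

/-- Binary cubic forms with positive leading coefficient and reduced Hessian. -/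
def reducedForms : Set (Fin 4 → ℝ) :=
  {f | 0 < f 0 ∧
    (f 1 ^ 2 - f 0 * f 2, f 0 * f 3 - f 1 * f 2, f 2 ^ 2 - f 1 * f 3) ∈ reducedHessians}

theorem measurableSet_reducedForms : MeasurableSet reducedForms := by
  have h1 : MeasurableSet {f : Fin 4 → ℝ | 0 < f 0} := measurableSet_lt (by fun_prop) (by fun_prop)
  exact h1.inter (measurableSet_reducedHessians.preimage (f := fun f : Fin 4 → ℝ =>
    (f 1 ^ 2 - f 0 * f 2, f 0 * f 3 - f 1 * f 2, f 2 ^ 2 - f 1 * f 3)) (by fun_prop))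

/-- Indicator function of `reducedHessians`. -/
noncomputable def hessInd (p : ℝ × ℝ × ℝ) : ℝ≥0∞ := reducedHessians.indicator 1 p

@[fun_prop]
theorem measurable_hessInd : Measurable hessInd :=
  measurable_one.indicator measurableSet_reducedHessians

theorem lintegral_form_eq {a : ℝ} (ha : 0 < a) :
    ∫⁻ b, ∫⁻ c, ∫⁻ d, hessInd (b ^ 2 - a * c, a * d - b * c, c ^ 2 - b * d) =
      ENNReal.ofReal a⁻¹ * ∫⁻ s, ∫⁻ A, ∫⁻ B, hessInd (A, B, A ^ 2 / a ^ 2 - (s * B + s ^ 2 * A)) := by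
  have h1 : ∀ b c : ℝ, ∫⁻ d, hessInd (b ^ 2 - a * c, a * d - b * c, c ^ 2 - b * d) =
      ENNReal.ofReal a⁻¹ * ∫⁻ B, hessInd (-a * c + b ^ 2, B,
        (-a * c + b ^ 2) ^ 2 / a ^ 2 - ((b / a) * B + (b / a) ^ 2 * (-a * c + b ^ 2))) := by
    intro b c
    have := lintegral_comp_affine ha.ne' (-(b * c)) (H := fun B => hessInd (-a * c + b ^ 2, B,
        (-a * c + b ^ 2) ^ 2 / a ^ 2 - ((b / a) * B + (b / a) ^ 2 * (-a * c + b ^ 2)))) (by fun_prop)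
    rw [abs_of_pos (by positivity)] at this
    rw [← this]
    refine lintegral_congr fun d => congrArg hessInd ?_
    refine Prod.ext (by simp only; ring) (Prod.ext (by simp only; ring) ?_)
    simp only
    field_simp
    ring
  have h2 : ∀ b : ℝ, ∫⁻ c, ∫⁻ d, hessInd (b ^ 2 - a * c, a * d - b * c, c ^ 2 - b * d) =
      ENNReal.ofReal a⁻¹ * (ENNReal.ofReal a⁻¹ * ∫⁻ A, ∫⁻ B, hessInd (A, B,
        A ^ 2 / a ^ 2 - ((b / a) * B + (b / a) ^ 2 * A))) := by
    intro b
    simp_rw [h1]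
    have hm : Measurable fun A => ∫⁻ B, hessInd (A, B,
        A ^ 2 / a ^ 2 - ((b / a) * B + (b / a) ^ 2 * A)) :=
      Measurable.lintegral_prod_right' (f := fun p : ℝ × ℝ => hessInd (p.1, p.2,
        p.1 ^ 2 / a ^ 2 - ((b / a) * p.2 + (b / a) ^ 2 * p.1))) (by fun_prop)
    have hm2 := hm.comp (by fun_prop : Measurable fun c => -a * c + b ^ 2)
    refine (lintegral_const_mul _ hm2).trans ?_
    have := lintegral_comp_affine (neg_ne_zero.2 ha.ne') (b ^ 2) hm
    rw [abs_inv, abs_neg, abs_of_pos ha] at this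
    exact congrArg _ this
  simp_rw [h2]
  have hm : Measurable fun s => ∫⁻ A, ∫⁻ B, hessInd (A, B, A ^ 2 / a ^ 2 - (s * B + s ^ 2 * A)) := by
    refine Measurable.lintegral_prod_right' (f := fun p : ℝ × ℝ => ∫⁻ B, hessInd (p.2, B,
      p.2 ^ 2 / a ^ 2 - (p.1 * B + p.1 ^ 2 * p.2))) ?_
    exact Measurable.lintegral_prod_right' (f := fun p : (ℝ × ℝ) × ℝ => hessInd (p.1.2, p.2,
      p.1.2 ^ 2 / a ^ 2 - (p.1.1 * p.2 + p.1.1 ^ 2 * p.1.2))) (by fun_prop)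
  have h3 : ∫⁻ b, ∫⁻ A, ∫⁻ B, hessInd (A, B, A ^ 2 / a ^ 2 - ((b / a) * B + (b / a) ^ 2 * A)) =
      ENNReal.ofReal a * ∫⁻ s, ∫⁻ A, ∫⁻ B, hessInd (A, B, A ^ 2 / a ^ 2 - (s * B + s ^ 2 * A)) := by
    have := lintegral_comp_affine (inv_ne_zero ha.ne') 0 hm
    rw [inv_inv, abs_of_pos ha] at this
    rw [← this]
    refine lintegral_congr fun b => ?_
    rw [show b / a = a⁻¹ * b + 0 by ring]
  have hm' : Measurable fun b => ∫⁻ A, ∫⁻ B, hessInd (A, B,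
      A ^ 2 / a ^ 2 - ((b / a) * B + (b / a) ^ 2 * A)) :=
    hm.comp (by fun_prop : Measurable fun b : ℝ => b / a)
  rw [lintegral_const_mul _ (hm'.const_mul _), lintegral_const_mul _ hm', h3,
    ← mul_assoc (ENNReal.ofReal a⁻¹) (ENNReal.ofReal a), ← ENNReal.ofReal_mul (by positivity),
    inv_mul_cancel₀ ha.ne', ENNReal.ofReal_one, one_mul]

theorem lintegral_leading_coeff_le {A : ℝ} (hA : 0 < A) (B s : ℝ) :
    ∫⁻ a in Set.Ioi (0 : ℝ), ENNReal.ofReal a⁻¹ *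
        hessInd (A, B, A ^ 2 / a ^ 2 - (s * B + s ^ 2 * A)) ≤
      ∫⁻ C, hessInd (A, B, C) * ENNReal.ofReal (1 / (2 * (C + (s * B + s ^ 2 * A)))) := by
  rw [lintegral_inv_mul_comp_div_sq hA (fun t => hessInd (A, B, t - (s * B + s ^ 2 * A)))]
  refine (setLIntegral_le_lintegral _ _).trans (le_of_eq ?_)
  rw [← lintegral_add_right_eq_self _ (s * B + s ^ 2 * A)]
  refine lintegral_congr fun C => ?_
  rw [mul_comm, add_sub_cancel_right]

theorem hessInd_eq_zero {p : ℝ × ℝ × ℝ} (h : p ∉ reducedHessians) : hessInd p = 0 :=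
  Set.indicator_of_notMem h _

theorem hessInd_eq_one {p : ℝ × ℝ × ℝ} (h : p ∈ reducedHessians) : hessInd p = 1 :=
  Set.indicator_of_mem h _

theorem lintegral_first_le (A B : ℝ) :
    ∫⁻ s, ∫⁻ a in Set.Ioi (0 : ℝ), ENNReal.ofReal a⁻¹ *
        hessInd (A, B, A ^ 2 / a ^ 2 - (s * B + s ^ 2 * A)) ≤
      (Set.Ioi (0 : ℝ)).indicator (fun A => (Set.Icc 0 A).indicator (fun B =>
        ENNReal.ofReal (Real.pi / (2 * A) * (1 - √(4 * A ^ 2 - B ^ 2)))) B) A := by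
  by_cases hAB : 0 < A ∧ 0 ≤ B ∧ B ≤ A
  · obtain ⟨hA, hB, hBA⟩ := hAB
    rw [Set.indicator_of_mem (Set.mem_Ioi.2 hA), Set.indicator_of_mem (Set.mem_Icc.2 ⟨hB, hBA⟩)]
    refine (lintegral_mono fun s => lintegral_leading_coeff_le hA B s).trans ?_
    rw [lintegral_lintegral_swap (by fun_prop)]
    refine le_trans ?_ (lintegral_rsqrt_disc_le hA hB hBA)
    rw [← lintegral_indicator]
    · refine lintegral_mono fun C => ?_
      by_cases hC : (A, B, C) ∈ reducedHessians
      · have hC' := hC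
        obtain ⟨-, -, -, h1, h2⟩ := hC'
        simp only at h1 h2
        rw [Set.indicator_of_mem (show C ∈ {C | A ≤ C ∧ 4 * A * C - B ^ 2 ≤ 1} from ⟨h1, h2⟩)]
        simp only [hessInd_eq_one hC, one_mul]
        exact (lintegral_inv_quadratic hA (by nlinarith)).le
      · simp [hessInd_eq_zero hC]
    · have m1 : MeasurableSet {C : ℝ | A ≤ C} := measurableSet_le (by fun_prop) (by fun_prop)
      have m2 : MeasurableSet {C : ℝ | 4 * A * C - B ^ 2 ≤ 1} :=
        measurableSet_le (by fun_prop) (by fun_prop)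
      exact m1.inter m2
  · have : ∀ C, hessInd (A, B, C) = 0 := fun C =>
      hessInd_eq_zero fun h => hAB ⟨h.1, h.2.1, h.2.2.1⟩
    simp [this]

theorem volume_reducedForms_le : volume reducedForms ≤ ENNReal.ofReal (Real.pi ^ 2 / 24) := by
  rw [← lintegral_indicator_one measurableSet_reducedForms,
    lintegral_fin_four (measurable_one.indicator measurableSet_reducedForms)]
  have h0 : ∀ a : ℝ, ∫⁻ b, ∫⁻ c, ∫⁻ d, reducedForms.indicator (1 : (Fin 4 → ℝ) → ℝ≥0∞) ![a, b, c, d] =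
      (Set.Ioi (0 : ℝ)).indicator (fun a => ENNReal.ofReal a⁻¹ *
        ∫⁻ s, ∫⁻ A, ∫⁻ B, hessInd (A, B, A ^ 2 / a ^ 2 - (s * B + s ^ 2 * A))) a := by
    intro a
    by_cases ha : 0 < a
    · rw [Set.indicator_of_mem (Set.mem_Ioi.2 ha), ← lintegral_form_eq ha]
      refine lintegral_congr fun b => lintegral_congr fun c => lintegral_congr fun d => ?_
      have : ![a, b, c, d] ∈ reducedForms ↔
          (b ^ 2 - a * c, a * d - b * c, c ^ 2 - b * d) ∈ reducedHessians := by
        simp [reducedForms, ha]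
      by_cases hm : ![a, b, c, d] ∈ reducedForms
      · rw [Set.indicator_of_mem hm, hessInd, Set.indicator_of_mem (this.1 hm)]; rfl
      · rw [Set.indicator_of_notMem hm, hessInd, Set.indicator_of_notMem (this.not.1 hm)]
    · rw [Set.indicator_of_notMem (by simpa using ha)]
      simp [Set.indicator, reducedForms, ha]
  simp_rw [h0]
  rw [lintegral_indicator measurableSet_Ioi]
  have hswap : ∫⁻ a in Set.Ioi (0 : ℝ), ENNReal.ofReal a⁻¹ *
        ∫⁻ s, ∫⁻ A, ∫⁻ B, hessInd (A, B, A ^ 2 / a ^ 2 - (s * B + s ^ 2 * A)) =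
      ∫⁻ A, ∫⁻ B, ∫⁻ s, ∫⁻ a in Set.Ioi (0 : ℝ), ENNReal.ofReal a⁻¹ *
        hessInd (A, B, A ^ 2 / a ^ 2 - (s * B + s ^ 2 * A)) := by
    have hm : Measurable fun p : (ℝ × ℝ) × ℝ × ℝ => ENNReal.ofReal p.1.1⁻¹ *
        hessInd (p.2.1, p.2.2, p.2.1 ^ 2 / p.1.1 ^ 2 - (p.1.2 * p.2.2 + p.1.2 ^ 2 * p.2.1)) := by
      fun_prop
    rw [← lintegral_four_swap hm]
    refine lintegral_congr fun a => ?_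
    simp_rw [lintegral_const_mul' _ _ (ENNReal.ofReal_ne_top)]
  rw [hswap]
  refine (lintegral_mono fun A => lintegral_mono fun B => lintegral_first_le A B).trans ?_
  have h1 : ∀ A : ℝ, ∫⁻ B, (Set.Ioi (0 : ℝ)).indicator (fun A => (Set.Icc 0 A).indicator (fun B =>
        ENNReal.ofReal (Real.pi / (2 * A) * (1 - √(4 * A ^ 2 - B ^ 2)))) B) A =
      (Set.Ioi (0 : ℝ)).indicator (fun A => ∫⁻ σ in Set.Icc (0 : ℝ) 1,
        ENNReal.ofReal (Real.pi / 2 * (1 - A * √(4 - σ ^ 2)))) A := by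
    intro A
    by_cases hA : 0 < A
    · simp only [Set.indicator_of_mem (Set.mem_Ioi.2 hA)]
      have := lintegral_comp_affine hA.ne' 0 (H := (Set.Icc 0 A).indicator (fun B =>
        ENNReal.ofReal (Real.pi / (2 * A) * (1 - √(4 * A ^ 2 - B ^ 2)))))
        (Measurable.indicator (by fun_prop) measurableSet_Icc)
      rw [abs_of_pos (by positivity)] at this
      have e : ∀ X : ℝ≥0∞, X = ENNReal.ofReal A * (ENNReal.ofReal A⁻¹ * X) := by
        intro X
        rw [← mul_assoc, ← ENNReal.ofReal_mul hA.le, mul_inv_cancel₀ hA.ne', ENNReal.ofReal_one,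
          one_mul]
      rw [e (∫⁻ B, _), ← this, ← lintegral_const_mul, ← lintegral_indicator measurableSet_Icc]
      · refine lintegral_congr fun σ => ?_
        have hmem : A * σ + 0 ∈ Set.Icc 0 A ↔ σ ∈ Set.Icc (0 : ℝ) 1 := by
          simp only [Set.mem_Icc, add_zero]
          refine and_congr (mul_nonneg_iff_of_pos_left hA) ?_
          exact mul_le_iff_le_one_right hA
        by_cases hσ : σ ∈ Set.Icc (0 : ℝ) 1
        · rw [Set.indicator_of_mem (hmem.2 hσ), Set.indicator_of_mem hσ,
            ← ENNReal.ofReal_mul hA.le]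
          congr 1
          rw [show 4 * A ^ 2 - (A * σ + 0) ^ 2 = A ^ 2 * (4 - σ ^ 2) by ring,
            Real.sqrt_mul (by positivity), Real.sqrt_sq hA.le]
          field_simp
        · rw [Set.indicator_of_notMem (hmem.not.2 hσ), Set.indicator_of_notMem hσ, mul_zero]
      · exact (Measurable.indicator (by fun_prop) measurableSet_Icc).comp (by fun_prop)
    · simp [Set.indicator, hA]
  simp_rw [h1]
  rw [lintegral_indicator measurableSet_Ioi, lintegral_lintegral_swap (by fun_prop),
    ← lintegral_rsqrt_four_sub_sq]
  refine setLIntegral_mono' measurableSet_Icc fun σ hσ => ?_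
  exact lintegral_one_sub_mul (Real.sqrt_pos.2 (by nlinarith [hσ.1, hσ.2]))

end ReducedVolume

section LatticePoints

open MeasureTheory

/-- Binary cubic forms of negative discriminant, positive leading coefficient and reduced Hessian. -/
def IsReducedCubic (f : Fin 4 → ℤ) : Prop :=
  0 < f 0 ∧ 0 ≤ f 0 * f 3 - f 1 * f 2 ∧ f 0 * f 3 - f 1 * f 2 ≤ f 1 ^ 2 - f 0 * f 2 ∧
    f 1 ^ 2 - f 0 * f 2 ≤ f 2 ^ 2 - f 1 * f 3 ∧ cubicDisc (f 0) (f 1) (f 2) (f 3) < 0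

theorem three_mul_sq_le_four_mul_hessian {a b c d : ℝ} (hB : 0 ≤ a * d - b * c)
    (hBA : a * d - b * c ≤ b ^ 2 - a * c) (hAC : b ^ 2 - a * c ≤ c ^ 2 - b * d)
    (hA : 0 < b ^ 2 - a * c) : 3 * a ^ 2 ≤ 4 * (b ^ 2 - a * c) := by
  have h1 := cubic_syzygy a b c d
  rw [← hessian_disc] at h1
  set A := b ^ 2 - a * c
  set B := a * d - b * c
  set C := c ^ 2 - b * d
  have h2 : 3 * A ^ 2 ≤ 4 * A * C - B ^ 2 := by nlinarith
  have h3 : a ^ 2 * (3 * A ^ 2) ≤ a ^ 2 * (4 * A * C - B ^ 2) :=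
    mul_le_mul_of_nonneg_left h2 (sq_nonneg a)
  have h4 : a ^ 2 * (3 * A ^ 2) ≤ 4 * A ^ 3 := by
    nlinarith [sq_nonneg (a ^ 2 * d - 3 * a * b * c + 2 * b ^ 3)]
  have h5 : A ^ 2 * (3 * a ^ 2) ≤ A ^ 2 * (4 * A) := by nlinarith
  exact le_of_mul_le_mul_left h5 (by positivity)

/-- The part of the normalised reduction domain where the leading coefficient is at least `δ`. -/
def truncatedForms (δ : ℝ) : Set (Fin 4 → ℝ) :=
  {f | δ ≤ f 0 ∧ 3 * f 0 ^ 2 ≤ 4 * (f 1 ^ 2 - f 0 * f 2) ∧ 0 ≤ f 0 * f 3 - f 1 * f 2 ∧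
    f 0 * f 3 - f 1 * f 2 ≤ f 1 ^ 2 - f 0 * f 2 ∧ f 1 ^ 2 - f 0 * f 2 ≤ f 2 ^ 2 - f 1 * f 3 ∧
    4 * (f 1 ^ 2 - f 0 * f 2) * (f 2 ^ 2 - f 1 * f 3) - (f 0 * f 3 - f 1 * f 2) ^ 2 ≤ 1}

theorem isClosed_truncatedForms (δ : ℝ) : IsClosed (truncatedForms δ) := by
  change IsClosed ({f : Fin 4 → ℝ | δ ≤ f 0} ∩ ({f | 3 * f 0 ^ 2 ≤ 4 * (f 1 ^ 2 - f 0 * f 2)} ∩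
    ({f | 0 ≤ f 0 * f 3 - f 1 * f 2} ∩ ({f | f 0 * f 3 - f 1 * f 2 ≤ f 1 ^ 2 - f 0 * f 2} ∩
    ({f | f 1 ^ 2 - f 0 * f 2 ≤ f 2 ^ 2 - f 1 * f 3} ∩ {f | 4 * (f 1 ^ 2 - f 0 * f 2) *
      (f 2 ^ 2 - f 1 * f 3) - (f 0 * f 3 - f 1 * f 2) ^ 2 ≤ 1})))))
  refine (isClosed_le ?_ ?_).inter ((isClosed_le ?_ ?_).inter ((isClosed_le ?_ ?_).inter
    ((isClosed_le ?_ ?_).inter ((isClosed_le ?_ ?_).inter (isClosed_le ?_ ?_))))) <;> fun_prop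

theorem truncatedForms_subset {δ : ℝ} (hδ : 0 < δ) : truncatedForms δ ⊆ reducedForms := by
  rintro f ⟨h0, h1, h2, h3, h4, h5⟩
  have : 0 < f 0 := hδ.trans_le h0
  exact ⟨this, by simp only; nlinarith [sq_nonneg (f 0)], h2, h3, h4, h5⟩

theorem isCompact_truncatedForms {δ : ℝ} (hδ : 0 < δ) : IsCompact (truncatedForms δ) := by
  set m := 3 * δ ^ 2 / 4 with hm
  have hm0 : 0 < m := by positivity
  set R1 := (2 * (1 / (3 * m)) + 2) / m with hR1
  set R2 := (2 * (1 / (3 * m)) + R1) / m with hR2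
  have hR10 : 0 < R1 := by positivity
  have hR20 : 0 < R2 := by positivity
  set R := 2 + R1 + R2
  refine IsCompact.of_isClosed_subset (isCompact_Icc (a := fun _ : Fin 4 => -R) (b := fun _ => R))
    (isClosed_truncatedForms δ) ?_
  rintro f ⟨h0, h1, h2, h3, h4, h5⟩
  have e1 : f 0 * (f 2 ^ 2 - f 1 * f 3) + f 1 * (f 0 * f 3 - f 1 * f 2) +
    f 2 * (f 1 ^ 2 - f 0 * f 2) = 0 := by ring
  have e2 : f 1 * (f 2 ^ 2 - f 1 * f 3) + f 2 * (f 0 * f 3 - f 1 * f 2) +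
    f 3 * (f 1 ^ 2 - f 0 * f 2) = 0 := by ring
  have e3 : (f 1 ^ 2 - f 0 * f 2) * f 1 ^ 2 + (f 0 * f 3 - f 1 * f 2) * f 0 * f 1 +
    (f 2 ^ 2 - f 1 * f 3) * f 0 ^ 2 = (f 1 ^ 2 - f 0 * f 2) ^ 2 := by ring
  generalize f 1 ^ 2 - f 0 * f 2 = A at *
  generalize f 0 * f 3 - f 1 * f 2 = B at *
  generalize f 2 ^ 2 - f 1 * f 3 = C at *
  have hA : m ≤ A := by nlinarith
  have hA0 : 0 < A := hm0.trans_le hA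
  have hC0 : 0 < C := hA0.trans_le h4
  have hD : 3 * (A * C) ≤ 4 * A * C - B ^ 2 := by nlinarith
  have hA1 : A ≤ 1 := by nlinarith
  have hC : C ≤ 1 / (3 * m) := by
    rw [le_div_iff₀ (by positivity)]
    nlinarith
  have ha : |f 0| ≤ 2 := abs_le_of_sq_le_sq (by nlinarith) (by norm_num)
  have hb2 : (A * C) * (3 * f 1 ^ 2) ≤ (A * C) * (4 * A) := by
    nlinarith [sq_nonneg (B * f 1 + 2 * C * f 0), sq_nonneg (f 1)]
  have hb : |f 1| ≤ 2 := by
    have := le_of_mul_le_mul_left hb2 (by positivity)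
    exact abs_le_of_sq_le_sq (by nlinarith) (by norm_num)
  have hB1 : |B| ≤ 1 := abs_le.2 ⟨by linarith, by linarith⟩
  have hC1 : |C| ≤ 1 / (3 * m) := by rwa [abs_of_pos hC0]
  have step : ∀ {x y z u : ℝ}, |x| ≤ 2 → |y| ≤ u → x * C + y * B + z * A = 0 →
      |z| ≤ (2 * (1 / (3 * m)) + u) / m := by
    intro x y z u hx hy e
    rw [le_div_iff₀ hm0]
    have : z * A = -(x * C + y * B) := by linarith
    calc |z| * m ≤ |z| * A := mul_le_mul_of_nonneg_left hA (abs_nonneg _)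
      _ = |x * C + y * B| := by rw [← abs_neg (x * C + y * B), ← this, abs_mul, abs_of_pos hA0]
      _ ≤ |x * C| + |y * B| := abs_add_le _ _
      _ ≤ 2 * (1 / (3 * m)) + u * 1 := by
        rw [abs_mul, abs_mul]
        have : 0 ≤ u := (abs_nonneg _).trans hy
        gcongr
      _ = _ := by ring
  have hc : |f 2| ≤ R1 := step ha hb e1
  have hd : |f 3| ≤ R2 := step hb hc e2
  have key : ∀ i, |f i| ≤ R := by
    intro i
    fin_cases i <;> simp [R] <;> linarith
  exact ⟨fun i => (abs_le.1 (key i)).1, fun i => (abs_le.1 (key i)).2⟩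

theorem card_mul_le_volume_cthickening {M : ℕ} (hM : 0 < M) {lam : ℝ} (hl : 0 < lam)
    (K : Set (Fin 4 → ℝ)) (F : Finset (Fin 4 → ℤ))
    (hmod : ∀ f ∈ F, ∀ g ∈ F, ∀ i, (M : ℤ) ∣ f i - g i)
    (hF : ∀ f ∈ F, (fun i => (f i : ℝ) / lam) ∈ K) :
    (F.card : ENNReal) * ENNReal.ofReal ((M / lam) ^ 4) ≤
      volume (Metric.cthickening (M / lam) K) := by
  have hr : 0 < M / lam := by positivity
  let Q : (Fin 4 → ℤ) → Set (Fin 4 → ℝ) := fun f =>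
    Set.pi Set.univ fun i => Set.Ico ((f i : ℝ) / lam) ((f i : ℝ) / lam + M / lam)
  have hvol : ∀ f, volume (Q f) = ENNReal.ofReal ((M / lam) ^ 4) := by
    intro f
    rw [volume_pi_pi]
    simp [Real.volume_Ico, ENNReal.ofReal_pow hr.le]
  have hdis : Set.PairwiseDisjoint (F : Set (Fin 4 → ℤ)) Q := by
    intro f hf g hg hne
    rw [Function.onFun, Set.disjoint_left]
    intro y hy hy'
    refine hne (funext fun i => ?_)
    have h1 := hy i (Set.mem_univ i)
    have h2 := hy' i (Set.mem_univ i)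
    simp only [← add_div] at h1 h2
    obtain ⟨h11, h12⟩ := h1
    obtain ⟨h21, h22⟩ := h2
    rw [div_le_iff₀ hl] at h11 h21
    rw [lt_div_iff₀ hl] at h12 h22
    have k1 : (f i : ℝ) < g i + M := by linarith
    have k2 : (g i : ℝ) < f i + M := by linarith
    have k1' : f i < g i + M := by exact_mod_cast k1
    have k2' : g i < f i + M := by exact_mod_cast k2
    have := Int.eq_zero_of_abs_lt_dvd (hmod f hf g hg i) (by rw [abs_lt]; constructor <;> linarith)
    linarith
  have hsub : (⋃ f ∈ F, Q f) ⊆ Metric.cthickening (M / lam) K := by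
    intro y hy
    simp only [Set.mem_iUnion] at hy
    obtain ⟨f, hf, hy⟩ := hy
    refine Metric.mem_cthickening_of_dist_le y _ _ K (hF f hf) ?_
    rw [dist_pi_le_iff hr.le]
    intro i
    have h1 := hy i (Set.mem_univ i)
    rw [Real.dist_eq, abs_le]
    constructor <;> linarith [h1.1, h1.2]
  calc (F.card : ENNReal) * ENNReal.ofReal ((M / lam) ^ 4) = ∑ f ∈ F, volume (Q f) := by
        simp [hvol]
    _ = volume (⋃ f ∈ F, Q f) := (measure_biUnion_finset hdis fun f _ =>
        MeasurableSet.univ_pi fun i => measurableSet_Ico).symm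
    _ ≤ _ := measure_mono hsub

theorem card_truncated_le {δ : ℝ} (hδ : 0 < δ) {M : ℕ} [NeZero M] (W : Set (Fin 4 → ZMod M))
    {ε : ℝ} (hε : 0 < ε) : ∀ᶠ X : ℝ in atTop, ∀ F : Finset (Fin 4 → ℤ),
      (∀ f ∈ F, (fun i => (f i : ZMod M)) ∈ W ∧ IsReducedCubic f ∧
        -((cubicDisc (f 0) (f 1) (f 2) (f 3) : ℤ) : ℝ) < X ∧ δ * X ^ (1 / 4 : ℝ) ≤ f 0) →
      (F.card : ℝ) ≤ ((Nat.card W : ℝ) / M ^ 4 * (Real.pi ^ 2 / 24) + ε) * X := by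
  classical
  have hM : 0 < M := Nat.pos_of_ne_zero (NeZero.ne M)
  set V : ℝ := Real.pi ^ 2 / 24 + ε with hV
  have hV0 : 0 < V := by positivity
  have hlim : Tendsto (fun X : ℝ => (M : ℝ) / X ^ (1 / 4 : ℝ)) atTop (nhds 0) :=
    Tendsto.const_div_atTop (tendsto_rpow_atTop (by norm_num)) _
  have hcth := (tendsto_measure_cthickening_of_isCompact (μ := volume)
    (isCompact_truncatedForms hδ)).comp hlim
  have hKV : volume (truncatedForms δ) < ENNReal.ofReal V := by
    refine lt_of_le_of_lt ((measure_mono (truncatedForms_subset hδ)).trans volume_reducedForms_le) ?_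
    exact (ENNReal.ofReal_lt_ofReal_iff hV0).2 (by linarith)
  filter_upwards [hcth.eventually_lt_const hKV, eventually_gt_atTop 0] with X hX hX0 F hF
  set lam := X ^ (1 / 4 : ℝ) with hlam
  have hl : 0 < lam := Real.rpow_pos_of_pos hX0 _
  have hl4 : lam ^ 4 = X := by
    rw [hlam, ← Real.rpow_natCast, ← Real.rpow_mul hX0.le]; norm_num
  have hK : ∀ f ∈ F, (fun i => (f i : ℝ) / lam) ∈ truncatedForms δ := by
    intro f hf
    obtain ⟨-, ⟨h0, h1, h2, h3, h4⟩, h5, h6⟩ := hF f hf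
    have hd := hessian_disc (f 0 : ℝ) (f 1) (f 2) (f 3)
    have h1' : (0 : ℝ) ≤ f 0 * f 3 - f 1 * f 2 := by exact_mod_cast h1
    have h2' : (f 0 * f 3 - f 1 * f 2 : ℝ) ≤ f 1 ^ 2 - f 0 * f 2 := by exact_mod_cast h2
    have h3' : (f 1 ^ 2 - f 0 * f 2 : ℝ) ≤ f 2 ^ 2 - f 1 * f 3 := by exact_mod_cast h3
    have hcast : ((cubicDisc (f 0) (f 1) (f 2) (f 3) : ℤ) : ℝ) =
      cubicDisc (f 0 : ℝ) (f 1) (f 2) (f 3) := map_cubicDisc (Int.castRingHom ℝ) _ _ _ _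
    have h4' : cubicDisc (f 0 : ℝ) (f 1) (f 2) (f 3) < 0 := by
      rw [← hcast]; exact_mod_cast h4
    have hA : (0 : ℝ) < f 1 ^ 2 - f 0 * f 2 := by
      by_contra hc
      have hA0 : (f 1 ^ 2 - f 0 * f 2 : ℝ) = 0 := by linarith
      have hB0 : (f 0 * f 3 - f 1 * f 2 : ℝ) = 0 := by linarith
      rw [hA0, hB0] at hd
      linarith
    have h7 := three_mul_sq_le_four_mul_hessian h1' h2' h3' hA
    rw [hcast, ← hl4] at h5
    rw [← hd] at h5
    have hq : ∀ x y z w : ℝ, x / lam * (y / lam) - z / lam * (w / lam) =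
      (x * y - z * w) / lam ^ 2 := fun x y z w => by field_simp
    have hl2 : 0 < lam ^ 2 := by positivity
    refine ⟨?_, ?_, ?_, ?_, ?_, ?_⟩
    · rwa [le_div_iff₀ hl]
    · have e : 3 * (f 0 / lam : ℝ) ^ 2 = 3 * (f 0 : ℝ) ^ 2 / lam ^ 2 := by rw [div_pow]; ring
      have e' : 4 * ((f 1 / lam : ℝ) ^ 2 - f 0 / lam * (f 2 / lam)) =
        4 * ((f 1 : ℝ) ^ 2 - f 0 * f 2) / lam ^ 2 := by field_simp
      rw [e, e']
      gcongr
    · simp only [hq]; positivity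
    · simp only [pow_two (_ / lam), hq]
      rw [← pow_two (f 1 : ℝ)]
      gcongr
    · simp only [pow_two (_ / lam), hq]
      rw [← pow_two (f 1 : ℝ), ← pow_two (f 2 : ℝ)]
      gcongr
    · simp only [pow_two (_ / lam), hq]
      rw [← pow_two (f 1 : ℝ), ← pow_two (f 2 : ℝ)]
      have e : ∀ A B C : ℝ, 4 * (A / lam ^ 2) * (C / lam ^ 2) - (B / lam ^ 2) ^ 2 =
        (4 * A * C - B ^ 2) / lam ^ 4 := fun A B C => by field_simp
      rw [e, div_le_one (by positivity)]
      linarith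
  have hfib : ∀ w : Fin 4 → ZMod M, (((F.filter fun f => (fun i => (f i : ZMod M)) = w).card : ℕ) : ℝ) ≤
      V * X / M ^ 4 := by
    intro w
    have h1 := card_mul_le_volume_cthickening hM hl (truncatedForms δ)
      (F.filter fun f => (fun i => (f i : ZMod M)) = w) ?_ ?_
    · have h2 := h1.trans hX.le
      rw [← ENNReal.ofReal_natCast, ← ENNReal.ofReal_mul (by positivity),
        ENNReal.ofReal_le_ofReal_iff hV0.le, div_pow, hl4] at h2
      rw [le_div_iff₀ (by positivity)]
      rw [← mul_div_assoc, div_le_iff₀ hX0] at h2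
      exact h2
    · intro f hf g hg i
      have hf' := (Finset.mem_filter.1 hf).2
      have hg' := (Finset.mem_filter.1 hg).2
      have := congrFun (hf'.trans hg'.symm) i
      rw [← ZMod.intCast_zmod_eq_zero_iff_dvd]
      simp [this]
    · intro f hf
      exact hK f (Finset.mem_filter.1 hf).1
  have hWfin : W.Finite := Set.toFinite W
  have hcard : F.card = ∑ w ∈ hWfin.toFinset, (F.filter fun f => (fun i => (f i : ZMod M)) = w).card :=
    Finset.card_eq_sum_card_fiberwise fun f hf => by
      simpa using (hF f hf).1
  have hWc : (hWfin.toFinset.card : ℝ) = Nat.card W := by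
    rw [← Set.ncard_eq_toFinset_card W hWfin, Nat.card_coe_set_eq]
  have hWle : (Nat.card W : ℝ) / M ^ 4 ≤ 1 := by
    rw [div_le_one (by positivity)]
    have : Nat.card W ≤ Nat.card (Fin 4 → ZMod M) := Nat.card_le_card_of_injective _ Subtype.val_injective
    have h2 : Nat.card (Fin 4 → ZMod M) = M ^ 4 := by simp
    rw [h2] at this
    exact_mod_cast this
  calc (F.card : ℝ) = ∑ w ∈ hWfin.toFinset, (((F.filter fun f => (fun i => (f i : ZMod M)) = w).card : ℕ) : ℝ) := by
        rw [hcard]; push_cast; rfl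
    _ ≤ ∑ w ∈ hWfin.toFinset, V * X / M ^ 4 := Finset.sum_le_sum fun w _ => hfib w
    _ = (Nat.card W : ℝ) / M ^ 4 * V * X := by
        rw [Finset.sum_const, nsmul_eq_mul, hWc]; ring
    _ ≤ _ := by
        refine mul_le_mul_of_nonneg_right ?_ hX0.le
        rw [hV]
        nlinarith

end LatticePoints

section Cusp

/-- The leading coefficient of the Hessian of a binary cubic form. -/
def hessA (f : Fin 4 → ℤ) : ℤ := f 1 ^ 2 - f 0 * f 2

/-- The leading coefficient of the cubic covariant of a binary cubic form. -/
def covQ (f : Fin 4 → ℤ) : ℤ := f 0 ^ 2 * f 3 - 3 * f 0 * f 1 * f 2 + 2 * f 1 ^ 3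

theorem covQ_sq (f : Fin 4 → ℤ) :
    covQ f ^ 2 = 4 * hessA f ^ 3 + f 0 ^ 2 * cubicDisc (f 0) (f 1) (f 2) (f 3) := by
  rw [cubic_syzygy]; simp only [covQ, hessA]; ring

theorem IsReducedCubic.hessA_pos {f : Fin 4 → ℤ} (hf : IsReducedCubic f) : 0 < hessA f := by
  obtain ⟨h0, h1, h2, h3, h4⟩ := hf
  rw [← hessian_disc] at h4
  rw [hessA]
  by_contra hc
  have hA : f 1 ^ 2 - f 0 * f 2 = 0 := by linarith
  have hB : f 0 * f 3 - f 1 * f 2 = 0 := by linarith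
  simp [hA, hB] at h4

theorem IsReducedCubic.three_mul_hessA_sq_le {f : Fin 4 → ℤ} (hf : IsReducedCubic f) :
    3 * hessA f ^ 2 ≤ -cubicDisc (f 0) (f 1) (f 2) (f 3) := by
  have hA := hf.hessA_pos
  obtain ⟨h0, h1, h2, h3, h4⟩ := hf
  rw [← hessian_disc]
  rw [hessA] at *
  nlinarith

theorem IsReducedCubic.coeff_le_hessA {f : Fin 4 → ℤ} (hf : IsReducedCubic f) :
    f 0 ≤ hessA f := by
  have hA := hf.hessA_pos
  have h1 := hf.three_mul_hessA_sq_le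
  have h2 := covQ_sq f
  have h0 : 0 < f 0 := hf.1
  have h3 : f 0 ^ 2 * (3 * hessA f ^ 2) ≤ 4 * hessA f ^ 3 := by
    nlinarith [sq_nonneg (covQ f), mul_le_mul_of_nonneg_left h1 (sq_nonneg (f 0))]
  have h5 : hessA f ^ 2 * (3 * f 0 ^ 2) ≤ hessA f ^ 2 * (4 * hessA f) := by nlinarith
  have h6 : 3 * f 0 ^ 2 ≤ 4 * hessA f := le_of_mul_le_mul_left h5 (by positivity)
  rcases lt_or_ge (f 0) 2 with h | h
  · linarith
  · nlinarith

theorem IsReducedCubic.eq_of_invariants {f g : Fin 4 → ℤ} (hf : IsReducedCubic f)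
    (hg : IsReducedCubic g) (h0 : f 0 = g 0) (hb : f 0 ∣ f 1 - g 1) (hA : hessA f = hessA g)
    (hQ : covQ f = covQ g) : f = g := by
  have hpos := hf.hessA_pos
  obtain ⟨f0, f1, f2, -, -⟩ := hf
  obtain ⟨g0, g1, g2, -, -⟩ := hg
  obtain ⟨t, ht⟩ := hb
  have eB : ∀ f : Fin 4 → ℤ, f 0 * (f 0 * f 3 - f 1 * f 2) = covQ f - 2 * f 1 * hessA f := by
    intro f; simp only [covQ, hessA]; ring
  have e1 : f 0 * ((f 0 * f 3 - f 1 * f 2) - (g 0 * g 3 - g 1 * g 2)) =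
      f 0 * (-2 * t * hessA f) := by
    rw [mul_sub, eB f]
    conv_lhs => rw [h0, eB g, ← hA, ← hQ]
    linear_combination -2 * hessA f * ht
  have e2 := mul_left_cancel₀ f0.ne' e1
  change f 0 * f 3 - f 1 * f 2 ≤ hessA f at f2
  change g 0 * g 3 - g 1 * g 2 ≤ hessA g at g2
  rw [← hA] at g2
  have ht0 : t = 0 := by
    by_contra hne
    rcases lt_or_gt_of_ne hne with h | h
    · nlinarith
    · nlinarith
  have hb : f 1 = g 1 := by rw [ht0] at ht; linarith
  have hc : f 2 = g 2 := by
    have h1 : f 0 * f 2 = f 0 * g 2 := by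
      have : f 1 ^ 2 - f 0 * f 2 = g 1 ^ 2 - g 0 * g 2 := hA
      rw [← hb, ← h0] at this
      linarith
    exact mul_left_cancel₀ f0.ne' h1
  have hd : f 3 = g 3 := by
    have h1 : f 0 * f 3 = f 0 * g 3 := by
      rw [ht0, hb, hc, ← h0] at e2
      linarith
    exact mul_left_cancel₀ f0.ne' h1
  ext i
  fin_cases i
  exacts [h0, hb, hc, hd]

theorem sq_dvd_covQ_sub {f g : Fin 4 → ℤ} (h0 : f 0 = g 0) (hb : f 0 ∣ f 1 - g 1)
    (hA : hessA f = hessA g) : f 0 ^ 2 ∣ covQ f - covQ g := by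
  obtain ⟨t, ht⟩ := hb
  have hb : f 1 = g 1 + f 0 * t := by linarith
  refine ⟨f 3 - g 3 - 3 * g 1 * t ^ 2 - f 0 * t ^ 3 - 3 * t * g 2, ?_⟩
  have e1 : covQ f = f 0 ^ 2 * f 3 + 3 * f 1 * hessA f - f 1 ^ 3 := by
    simp only [covQ, hessA]; ring
  have e2 : covQ g = f 0 ^ 2 * g 3 + 3 * g 1 * hessA f - g 1 ^ 3 := by
    rw [hA, h0]; simp only [covQ, hessA]; ring
  have e3 : hessA f = g 1 ^ 2 - f 0 * g 2 := by rw [hA, h0]; rfl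
  rw [e1, e2, e3, hb]
  ring

theorem IsReducedCubic.gap_bounds {f : Fin 4 → ℤ} (hf : IsReducedCubic f) {X : ℝ} {n : ℤ}
    (hn : 0 < n) (hnA : n * f 0 ≤ hessA f)
    (hX : -((cubicDisc (f 0) (f 1) (f 2) (f 3) : ℤ) : ℝ) < X) :
    0 ≤ √(4 * hessA f ^ 3) - |(covQ f : ℝ)| ∧
      √(4 * hessA f ^ 3) - |(covQ f : ℝ)| ≤ (f 0 * X / n) ^ (3 / 4 : ℝ) := by
  have hA : (0 : ℝ) < hessA f := by exact_mod_cast hf.hessA_pos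
  have ha : (0 : ℝ) < f 0 := by exact_mod_cast hf.1
  have hn' : (0 : ℝ) < n := by exact_mod_cast hn
  have hnA' : (n : ℝ) * f 0 ≤ hessA f := by exact_mod_cast hnA
  have hD : ((cubicDisc (f 0) (f 1) (f 2) (f 3) : ℤ) : ℝ) < 0 := by exact_mod_cast hf.2.2.2.2
  set D : ℝ := ((cubicDisc (f 0) (f 1) (f 2) (f 3) : ℤ) : ℝ) with hDdef
  have hsq : |(covQ f : ℝ)| ^ 2 = 4 * (hessA f : ℝ) ^ 3 + (f 0 : ℝ) ^ 2 * D := by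
    rw [sq_abs, hDdef]
    exact_mod_cast covQ_sq f
  set R := √(4 * hessA f ^ 3) with hR
  have hR2 : R ^ 2 = 4 * (hessA f : ℝ) ^ 3 := Real.sq_sqrt (by positivity)
  have hR0 : 0 < R := Real.sqrt_pos.2 (by positivity)
  set q := |(covQ f : ℝ)|
  have hq0 : 0 ≤ q := abs_nonneg _
  have hX0 : 0 < X := by linarith
  have hqR : q ≤ R := by
    refine abs_le_of_sq_le_sq' ?_ hR0.le |>.2
    rw [hsq, hR2]
    nlinarith [mul_nonneg (sq_nonneg (f 0 : ℝ)) (neg_nonneg.2 hD.le)]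
  refine ⟨by linarith, ?_⟩
  set r := R - q with hr
  have hr0 : 0 ≤ r := by linarith
  have hrR : r * R ≤ (f 0 : ℝ) ^ 2 * X := by
    have h1 : r * R ≤ R ^ 2 - q ^ 2 := by rw [hr]; nlinarith
    have h2 : (f 0 : ℝ) ^ 2 * (-D) ≤ (f 0 : ℝ) ^ 2 * X := by gcongr
    linarith
  have h4 : r ^ 4 * R ^ 2 ≤ ((f 0 : ℝ) ^ 2 * X) ^ 3 := by
    calc r ^ 4 * R ^ 2 = r ^ 3 * R ^ 2 * r := by ring
      _ ≤ r ^ 3 * R ^ 2 * R := by gcongr; linarith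
      _ = (r * R) ^ 3 := by ring
      _ ≤ _ := by gcongr
  have h5 : ((n : ℝ) * f 0) ^ 3 ≤ R ^ 2 := by
    rw [hR2]
    have : ((n : ℝ) * f 0) ^ 3 ≤ (hessA f : ℝ) ^ 3 := by gcongr
    linarith [pow_pos hA 3]
  have h6 : r ^ 4 ≤ ((f 0 : ℝ) * X / n) ^ 3 := by
    have h7 : r ^ 4 * ((n : ℝ) * f 0) ^ 3 ≤ ((f 0 : ℝ) ^ 2 * X) ^ 3 :=
      (mul_le_mul_of_nonneg_left h5 (by positivity)).trans h4
    rw [div_pow, le_div_iff₀ (by positivity)]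
    refine le_of_mul_le_mul_right ?_ (pow_pos ha 3)
    calc r ^ 4 * (n : ℝ) ^ 3 * (f 0 : ℝ) ^ 3 = r ^ 4 * ((n : ℝ) * f 0) ^ 3 := by ring
      _ ≤ _ := h7
      _ = _ := by ring
  calc r = (r ^ 4) ^ (1 / 4 : ℝ) := by
        rw [← Real.rpow_natCast, ← Real.rpow_mul hr0]; norm_num
    _ ≤ (((f 0 : ℝ) * X / n) ^ 3) ^ (1 / 4 : ℝ) := by gcongr
    _ = _ := by
        rw [← Real.rpow_natCast, ← Real.rpow_mul (by positivity)]; norm_num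

/-- The number of reduced forms with prescribed `a`, `b mod a`, `⌊A / a⌋` and sign of `Q`. -/
theorem card_fiber_le {X : ℝ} (hX : 0 ≤ X) {a b n : ℤ} (ha : 0 < a) (hn : 0 < n) (s : Prop)
    (G : Finset (Fin 4 → ℤ)) (hG : ∀ f ∈ G, IsReducedCubic f ∧
      -((cubicDisc (f 0) (f 1) (f 2) (f 3) : ℤ) : ℝ) < X ∧ f 0 = a ∧ f 1 % a = b ∧
      hessA f / a = n ∧ (0 ≤ covQ f ↔ s)) :
    (G.card : ℝ) ≤ (a * X / n) ^ (3 / 4 : ℝ) / a ^ 2 + 1 := by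
  set L : ℝ := (a * X / n) ^ (3 / 4 : ℝ) / a ^ 2 with hL
  have ha' : (0 : ℝ) < a := by exact_mod_cast ha
  have hbound : ∀ f ∈ G, 0 ≤ √(4 * hessA f ^ 3) - |(covQ f : ℝ)| ∧
      √(4 * hessA f ^ 3) - |(covQ f : ℝ)| ≤ (a * X / n) ^ (3 / 4 : ℝ) := by
    intro f hf
    obtain ⟨h1, h2, rfl, h4, h5, h6⟩ := hG f hf
    exact h1.gap_bounds hn (h5 ▸ Int.ediv_mul_le _ h1.1.ne') h2
  have hn' : (0 : ℝ) < n := by exact_mod_cast hn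
  have hL0 : 0 ≤ L := by positivity
  have hcard : G.card ≤ (Finset.range (⌊L⌋₊ + 1)).card := by
    refine Finset.card_le_card_of_injOn
      (fun f => ⌊(√(4 * hessA f ^ 3) - |(covQ f : ℝ)|) / a ^ 2⌋₊) ?_ ?_
    · intro f hf
      simp only [Finset.coe_range, Set.mem_Iio]
      exact Nat.lt_succ_of_le (Nat.floor_le_floor (div_le_div_of_nonneg_right (hbound f hf).2
        (by positivity)))
    · intro f hf g hg hfg
      obtain ⟨f1, f2, f3, f4, f5, f6⟩ := hG f hf
      obtain ⟨g1, g2, g3, g4, g5, g6⟩ := hG g hg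
      have h0 : f 0 = g 0 := by rw [f3, g3]
      have hb : f 0 ∣ f 1 - g 1 := by
        rw [f3]
        exact Int.ModEq.dvd (show g 1 % a = f 1 % a by rw [f4, g4])
      have hA : hessA f = hessA g := by
        have hmod : hessA f % a = hessA g % a := by
          refine Int.ModEq.symm (Int.modEq_of_dvd ?_)
          obtain ⟨t, ht⟩ := hb
          refine ⟨t * (f 1 + g 1) - f 2 + g 2, ?_⟩
          simp only [hessA, ← h0]
          rw [f3] at *
          linear_combination (f 1 + g 1) * ht
        rw [← Int.mul_ediv_add_emod (hessA f) a, ← Int.mul_ediv_add_emod (hessA g) a, f5, g5, hmod]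
      refine f1.eq_of_invariants g1 h0 hb hA ?_
      have hdvd := sq_dvd_covQ_sub h0 hb hA
      simp only [hA] at hfg
      have h1 := (hbound f hf).1
      rw [hA] at h1
      have hfg' := congrArg (Nat.cast (R := ℤ)) hfg
      rw [Int.natCast_floor_eq_floor (div_nonneg h1 (by positivity)),
        Int.natCast_floor_eq_floor (div_nonneg (hbound g hg).1 (by positivity))] at hfg'
      have hlt := Int.abs_sub_lt_one_of_floor_eq_floor hfg'
      rw [← sub_div, abs_div, abs_of_pos (by positivity : (0:ℝ) < a ^ 2),
        div_lt_one (by positivity)] at hlt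
      have hlt2 : |(|covQ g| - |covQ f| : ℤ)| < a ^ 2 := by
        have : |(|(covQ g : ℝ)| - |(covQ f : ℝ)|)| < (a : ℝ) ^ 2 := by
          rwa [sub_sub_sub_cancel_left] at hlt
        exact_mod_cast this
      rw [f3] at hdvd
      by_cases hs : s
      · have q1 := f6.2 hs
        have q2 := g6.2 hs
        rw [abs_of_nonneg q1, abs_of_nonneg q2, abs_sub_comm] at hlt2
        have := Int.eq_zero_of_abs_lt_dvd hdvd hlt2
        linarith
      · have q1 : covQ f < 0 := not_le.1 fun h => hs (f6.1 h)
        have q2 : covQ g < 0 := not_le.1 fun h => hs (g6.1 h)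
        rw [abs_of_neg q1, abs_of_neg q2] at hlt2
        have := Int.eq_zero_of_abs_lt_dvd hdvd (by rwa [neg_sub_neg] at hlt2)
        linarith
  rw [Finset.card_range] at hcard
  calc (G.card : ℝ) ≤ ((⌊L⌋₊ + 1 : ℕ) : ℝ) := by exact_mod_cast hcard
    _ ≤ L + 1 := by push_cast; linarith [Nat.floor_le hL0]

theorem sum_rpow_le {θ : ℝ} (h0 : 0 < θ) (h1 : θ ≤ 1) (m : ℕ) :
    ∑ n ∈ Finset.Icc 1 m, (n : ℝ) ^ (θ - 1) ≤ (m : ℝ) ^ θ / θ := by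
  induction m with
  | zero => simp [Real.zero_rpow h0.ne']
  | succ m ih =>
    rw [Finset.sum_Icc_succ_top (by omega)]
    have hm : (0 : ℝ) < (m + 1 : ℕ) := by positivity
    have hb := rpow_one_add_le_one_add_mul_self (s := -(1 / ((m + 1 : ℕ) : ℝ))) (p := θ) (by
      rw [neg_le_neg_iff, div_le_one hm]; push_cast; linarith [Nat.cast_nonneg (α := ℝ) m]) h0.le h1
    have e : 1 + -(1 / ((m + 1 : ℕ) : ℝ)) = m / ((m + 1 : ℕ) : ℝ) := by
      push_cast; field_simp; ring
    rw [e, Real.div_rpow (by positivity) hm.le, div_le_iff₀ (by positivity)] at hb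
    have e2 : ((m + 1 : ℕ) : ℝ) ^ (θ - 1) = ((m + 1 : ℕ) : ℝ) ^ θ / ((m + 1 : ℕ) : ℝ) :=
      Real.rpow_sub_one hm.ne' θ
    have h3 : (m : ℝ) ^ θ / θ + ((m + 1 : ℕ) : ℝ) ^ (θ - 1) ≤ ((m + 1 : ℕ) : ℝ) ^ θ / θ := by
      rw [e2, div_add' _ _ _ h0.ne']
      refine div_le_div_of_nonneg_right ?_ h0.le
      calc _ ≤ (1 + θ * -(1 / ((m + 1 : ℕ) : ℝ))) * ((m + 1 : ℕ) : ℝ) ^ θ +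
            ((m + 1 : ℕ) : ℝ) ^ θ / ((m + 1 : ℕ) : ℝ) * θ := by gcongr
        _ = _ := by ring
    linarith

end Cusp

section Cusp

theorem sum_gap_le {X : ℝ} (hX : 0 < X) {a : ℕ} (ha : 0 < a) :
    a * ∑ n ∈ Finset.Icc 1 ⌊X ^ (1 / 2 : ℝ) / a⌋₊,
        (2 * ((a * X / n) ^ (3 / 4 : ℝ) / (a : ℝ) ^ 2 + 1)) ≤
      8 * X ^ (7 / 8 : ℝ) * (a : ℝ) ^ ((1 / 2 : ℝ) - 1) + 2 * X ^ (1 / 2 : ℝ) := by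
  have ha' : (0 : ℝ) < a := by exact_mod_cast ha
  set m := ⌊X ^ (1 / 2 : ℝ) / a⌋₊ with hm
  have hm1 : (m : ℝ) ≤ X ^ (1 / 2 : ℝ) / a := Nat.floor_le (by positivity)
  have e1 : ∀ n ∈ Finset.Icc 1 m, 2 * ((a * X / n) ^ (3 / 4 : ℝ) / (a : ℝ) ^ 2 + 1) =
      2 * ((a : ℝ) ^ (3 / 4 : ℝ) * X ^ (3 / 4 : ℝ) / (a : ℝ) ^ 2) * (n : ℝ) ^ ((1 / 4 : ℝ) - 1) + 2 := by
    intro n hn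
    have hn0 : (0 : ℝ) < n := by exact_mod_cast (Finset.mem_Icc.1 hn).1
    rw [Real.div_rpow (by positivity) hn0.le, Real.mul_rpow ha'.le hX.le,
      show (1 / 4 : ℝ) - 1 = -(3 / 4) by norm_num, Real.rpow_neg hn0.le]
    field_simp
  rw [Finset.sum_congr rfl e1, Finset.sum_add_distrib, ← Finset.mul_sum, Finset.sum_const,
    Nat.card_Icc, Nat.add_sub_cancel, nsmul_eq_mul]
  have h1 := sum_rpow_le (θ := 1 / 4) (by norm_num) (by norm_num) m
  have h2 : (m : ℝ) ^ (1 / 4 : ℝ) ≤ X ^ (1 / 8 : ℝ) / (a : ℝ) ^ (1 / 4 : ℝ) := by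
    calc (m : ℝ) ^ (1 / 4 : ℝ) ≤ (X ^ (1 / 2 : ℝ) / a) ^ (1 / 4 : ℝ) := by gcongr
      _ = _ := by
        rw [Real.div_rpow (by positivity) ha'.le, ← Real.rpow_mul hX.le]; norm_num
  have e2 : (a : ℝ) * ((a : ℝ) ^ (3 / 4 : ℝ) / (a : ℝ) ^ 2 / (a : ℝ) ^ (1 / 4 : ℝ)) =
      (a : ℝ) ^ ((1 / 2 : ℝ) - 1) := by
    rw [← Real.rpow_natCast (a : ℝ) 2, ← Real.rpow_sub ha', ← Real.rpow_sub ha']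
    nth_rewrite 1 [← Real.rpow_one (a : ℝ)]
    rw [← Real.rpow_add ha']
    norm_num
  have e3 : X ^ (3 / 4 : ℝ) * X ^ (1 / 8 : ℝ) = X ^ (7 / 8 : ℝ) := by
    rw [← Real.rpow_add hX]; norm_num
  calc _ ≤ a * (2 * ((a : ℝ) ^ (3 / 4 : ℝ) * X ^ (3 / 4 : ℝ) / (a : ℝ) ^ 2) *
        ((X ^ (1 / 8 : ℝ) / (a : ℝ) ^ (1 / 4 : ℝ)) / (1 / 4)) + X ^ (1 / 2 : ℝ) / a * 2) := by
        gcongr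
        exact h1.trans (by gcongr)
    _ = 8 * (X ^ (3 / 4 : ℝ) * X ^ (1 / 8 : ℝ)) * ((a : ℝ) * ((a : ℝ) ^ (3 / 4 : ℝ) / (a : ℝ) ^ 2 / (a : ℝ) ^ (1 / 4 : ℝ))) +
        2 * X ^ (1 / 2 : ℝ) := by field_simp; ring
    _ = _ := by rw [e2, e3]

theorem card_cusp_le {δ : ℝ} (hδ : 0 < δ) {X : ℝ} (hX : 1 ≤ X) (F : Finset (Fin 4 → ℤ))
    (hF : ∀ f ∈ F, IsReducedCubic f ∧
      -((cubicDisc (f 0) (f 1) (f 2) (f 3) : ℤ) : ℝ) < X ∧ (f 0 : ℝ) < δ * X ^ (1 / 4 : ℝ)) :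
    (F.card : ℝ) ≤ (16 * √δ + 2 * δ) * X := by
  classical
  have hX0 : 0 < X := by linarith
  set N := ⌊δ * X ^ (1 / 4 : ℝ)⌋₊ with hN
  have hN1 : (N : ℝ) ≤ δ * X ^ (1 / 4 : ℝ) := Nat.floor_le (by positivity)
  let t : Finset (Σ _ : ℕ, ℕ × ℕ × Bool) := (Finset.Icc 1 N).sigma fun a =>
    Finset.range a ×ˢ Finset.Icc 1 ⌊X ^ (1 / 2 : ℝ) / a⌋₊ ×ˢ Finset.univ
  let φ : (Fin 4 → ℤ) → Σ _ : ℕ, ℕ × ℕ × Bool := fun f =>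
    ⟨(f 0).toNat, (f 1 % f 0).toNat, (hessA f / f 0).toNat, decide (0 ≤ covQ f)⟩
  have hmaps : ∀ f ∈ F, φ f ∈ t := by
    intro f hf
    obtain ⟨h1, h2, h3⟩ := hF f hf
    have h0 : 0 < f 0 := h1.1
    have hc : ((f 0).toNat : ℤ) = f 0 := Int.toNat_of_nonneg h0.le
    have hcR : ((f 0).toNat : ℝ) = f 0 := by exact_mod_cast congrArg (Int.cast (R := ℝ)) hc
    have hn : 0 < hessA f / f 0 := Int.lt_of_lt_of_le zero_lt_one ((Int.le_ediv_iff_mul_le h0).2 (by rw [one_mul]; exact h1.coeff_le_hessA))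
    simp only [φ, t, Finset.mem_sigma, Finset.mem_product, Finset.mem_Icc, Finset.mem_range,
      Finset.mem_univ, and_true]
    refine ⟨⟨by omega, ?_⟩, ?_, by omega, ?_⟩
    · rw [hN]
      refine Nat.le_floor ?_
      rw [hcR]; exact h3.le
    · have := Int.emod_nonneg (f 1) h0.ne'
      have := Int.emod_lt_of_pos (f 1) h0
      omega
    · refine Nat.le_floor ?_
      have hcn : ((hessA f / f 0).toNat : ℝ) = ((hessA f / f 0 : ℤ) : ℝ) := by
        exact_mod_cast congrArg (Int.cast (R := ℝ)) (Int.toNat_of_nonneg hn.le)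
      rw [hcn, hcR, le_div_iff₀ (by exact_mod_cast h0)]
      have h4 : (((hessA f / f 0 * f 0 : ℤ)) : ℝ) ≤ hessA f := by
        exact_mod_cast Int.ediv_mul_le _ h0.ne'
      push_cast at h4
      refine h4.trans ?_
      rw [← Real.sqrt_eq_rpow]
      refine Real.le_sqrt_of_sq_le ?_
      have h5 : (3 * (hessA f : ℝ) ^ 2) ≤ -((cubicDisc (f 0) (f 1) (f 2) (f 3) : ℤ) : ℝ) := by
        exact_mod_cast h1.three_mul_hessA_sq_le
      nlinarith [sq_nonneg (hessA f : ℝ)]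
  have hfib : ∀ i ∈ t, (((F.filter fun f => φ f = i).card : ℕ) : ℝ) ≤
      (i.1 * X / i.2.2.1) ^ (3 / 4 : ℝ) / (i.1 : ℝ) ^ 2 + 1 := by
    rintro ⟨a, b, n, s⟩ hi
    simp only [t, Finset.mem_sigma, Finset.mem_product, Finset.mem_Icc, Finset.mem_range,
      Finset.mem_univ, and_true] at hi
    obtain ⟨⟨ha, -⟩, hb, hn, -⟩ := hi
    have := card_fiber_le hX0.le (a := (a : ℤ)) (b := (b : ℤ)) (n := (n : ℤ)) (by omega) (by omega) (s = true)
      (F.filter fun f => φ f = ⟨a, b, n, s⟩) ?_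
    · simpa using this
    · intro f hf
      obtain ⟨hfF, hφ⟩ := Finset.mem_filter.1 hf
      obtain ⟨h1, h2, h3⟩ := hF f hfF
      simp only [φ, Sigma.mk.injEq, heq_eq_eq, Prod.mk.injEq] at hφ
      obtain ⟨e1, e2, e3, e4⟩ := hφ
      have h0 : 0 < f 0 := h1.1
      have hfa : f 0 = a := by omega
      refine ⟨h1, h2, hfa, ?_, ?_, ?_⟩
      · have := Int.emod_nonneg (f 1) h0.ne'
        rw [← hfa]; omega
      · rw [← hfa]; omega
      · rw [← e4]; simp
  have hcard : F.card = ∑ i ∈ t, (F.filter fun f => φ f = i).card :=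
    Finset.card_eq_sum_card_fiberwise hmaps
  have hsum : (F.card : ℝ) ≤ ∑ i ∈ t, ((i.1 * X / i.2.2.1) ^ (3 / 4 : ℝ) / (i.1 : ℝ) ^ 2 + 1) := by
    rw [hcard]; push_cast
    exact Finset.sum_le_sum hfib
  refine hsum.trans ?_
  rw [Finset.sum_sigma]
  calc _ = ∑ a ∈ Finset.Icc 1 N, ((a : ℝ) * ∑ n ∈ Finset.Icc 1 ⌊X ^ (1 / 2 : ℝ) / (a : ℝ)⌋₊,
        (2 * (((a : ℝ) * X / (n : ℝ)) ^ (3 / 4 : ℝ) / (a : ℝ) ^ 2 + 1))) := by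
        refine Finset.sum_congr rfl fun a _ => ?_
        simp only [Finset.sum_product, Finset.sum_const, Finset.card_range, nsmul_eq_mul,
          Finset.card_univ, Fintype.card_bool]
        push_cast
        rfl
    _ ≤ ∑ a ∈ Finset.Icc 1 N, (8 * X ^ (7 / 8 : ℝ) * (a : ℝ) ^ ((1 / 2 : ℝ) - 1) +
        2 * X ^ (1 / 2 : ℝ)) := Finset.sum_le_sum fun a ha =>
        sum_gap_le hX0 (Finset.mem_Icc.1 ha).1
    _ = 8 * X ^ (7 / 8 : ℝ) * ∑ a ∈ Finset.Icc 1 N, (a : ℝ) ^ ((1 / 2 : ℝ) - 1) +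
        2 * X ^ (1 / 2 : ℝ) * N := by
        rw [Finset.sum_add_distrib, ← Finset.mul_sum, Finset.sum_const, Nat.card_Icc,
          Nat.add_sub_cancel, nsmul_eq_mul]
        ring
    _ ≤ 8 * X ^ (7 / 8 : ℝ) * ((√δ * X ^ (1 / 8 : ℝ)) / (1 / 2)) +
        2 * X ^ (1 / 2 : ℝ) * (δ * X ^ (1 / 4 : ℝ)) := by
        gcongr
        refine (sum_rpow_le (by norm_num) (by norm_num) N).trans ?_
        gcongr
        calc (N : ℝ) ^ (1 / 2 : ℝ) ≤ (δ * X ^ (1 / 4 : ℝ)) ^ (1 / 2 : ℝ) := by gcongr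
          _ = _ := by
            rw [Real.mul_rpow hδ.le (by positivity), ← Real.rpow_mul hX0.le, Real.sqrt_eq_rpow]
            norm_num
    _ = 16 * √δ * (X ^ (7 / 8 : ℝ) * X ^ (1 / 8 : ℝ)) +
        2 * δ * (X ^ (1 / 2 : ℝ) * X ^ (1 / 4 : ℝ)) := by ring
    _ = 16 * √δ * X + 2 * δ * X ^ (3 / 4 : ℝ) := by
        rw [← Real.rpow_add hX0, ← Real.rpow_add hX0]; norm_num
    _ ≤ 16 * √δ * X + 2 * δ * X := by
        gcongr
        exact Real.rpow_le_self_of_one_le hX (by norm_num)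
    _ = _ := by ring

/-- Upper bound for the number of reduced forms with coefficients in prescribed residue classes. -/
theorem card_reduced_le {M : ℕ} [NeZero M] (W : Set (Fin 4 → ZMod M)) {ε : ℝ} (hε : 0 < ε) :
    ∀ᶠ X : ℝ in atTop, ∀ F : Finset (Fin 4 → ℤ),
      (∀ f ∈ F, (fun i => (f i : ZMod M)) ∈ W ∧ IsReducedCubic f ∧
        -((cubicDisc (f 0) (f 1) (f 2) (f 3) : ℤ) : ℝ) < X) →
      (F.card : ℝ) ≤ ((Nat.card W : ℝ) / M ^ 4 * (Real.pi ^ 2 / 24) + ε) * X := by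
  classical
  obtain ⟨δ, hδ, hδε⟩ : ∃ δ : ℝ, 0 < δ ∧ 16 * √δ + 2 * δ ≤ ε / 2 := by
    have hc : ContinuousAt (fun δ : ℝ => 16 * √δ + 2 * δ) 0 := by fun_prop
    have h0 : (fun δ : ℝ => 16 * √δ + 2 * δ) 0 < ε / 2 := by simp; linarith
    have h1 := hc.eventually_lt continuousAt_const h0
    obtain ⟨r, hr, hball⟩ := Metric.eventually_nhds_iff.1 h1
    exact ⟨r / 2, by positivity, (hball (by simp [abs_of_pos hr]; linarith)).le⟩
  filter_upwards [card_truncated_le hδ W (half_pos hε), eventually_ge_atTop 1] with X hX hX1 F hF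
  have h1 := hX (F.filter fun f => δ * X ^ (1 / 4 : ℝ) ≤ f 0) fun f hf => by
    obtain ⟨h1, h2⟩ := Finset.mem_filter.1 hf
    exact ⟨(hF f h1).1, (hF f h1).2.1, (hF f h1).2.2, h2⟩
  have h2 := card_cusp_le hδ hX1 (F.filter fun f => ¬ δ * X ^ (1 / 4 : ℝ) ≤ f 0) fun f hf => by
    obtain ⟨h1, h2⟩ := Finset.mem_filter.1 hf
    exact ⟨(hF f h1).2.1, (hF f h1).2.2, not_le.1 h2⟩
  have h3 := Finset.card_filter_add_card_filter_not (s := F) (fun f => δ * X ^ (1 / 4 : ℝ) ≤ f 0)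
  have h4 : ((F.filter fun f => δ * X ^ (1 / 4 : ℝ) ≤ f 0).card : ℝ) +
      ((F.filter fun f => ¬ δ * X ^ (1 / 4 : ℝ) ≤ f 0).card : ℝ) = F.card := by
    exact_mod_cast h3
  have h5 : (16 * √δ + 2 * δ) * X ≤ ε / 2 * X := by gcongr
  rw [← h4]
  nlinarith

end Cusp

section Local

/-- The modulus modulo which being fundamental at `p` is decided. -/
def discModulus (p : ℕ) : ℕ := if p = 2 then 16 else p ^ 2

/-- The local condition at `p` satisfied by fundamental discriminants. -/
def IsFundamentalAt (p : ℕ) (Δ : ℤ) : Prop :=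
  if p = 2 then Δ % 16 = 1 ∨ Δ % 16 = 5 ∨ Δ % 16 = 9 ∨ Δ % 16 = 13 ∨ Δ % 16 = 8 ∨ Δ % 16 = 12
  else ¬ ((p : ℤ) ^ 2 ∣ Δ)

theorem IsFundamentalDiscriminant.isFundamentalAt {Δ : ℤ} (h : IsFundamentalDiscriminant Δ) {p : ℕ}
    (hp : p.Prime) : IsFundamentalAt p Δ := by
  unfold IsFundamentalAt
  obtain ⟨-, h⟩ := h
  split_ifs with hp2
  · omega
  · intro hd
    have hp' : Prime (p : ℤ) := Nat.prime_iff_prime_int.1 hp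
    rcases h with ⟨-, hs⟩ | ⟨h4, hs, -⟩
    · exact hp'.not_isUnit (hs p (by rwa [← sq]))
    · refine hp'.not_isUnit (hs p ?_)
      rw [← sq]
      have hc : IsCoprime ((p : ℤ) ^ 2) 4 := by
        have : Nat.Coprime (p ^ 2) (2 ^ 2) :=
          Nat.Coprime.pow 2 2 ((Nat.coprime_primes hp Nat.prime_two).2 hp2)
        exact_mod_cast Nat.isCoprime_iff_coprime.2 this
      refine hc.dvd_of_dvd_mul_left (?_ : _ ∣ 4 * (Δ / 4))
      rwa [Int.mul_ediv_cancel' (Int.dvd_of_emod_eq_zero h4)]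

theorem isFundamentalDiscriminant_of_isFundamentalAt {Δ : ℤ} (hΔ : Δ < 0)
    (h : ∀ p : ℕ, p.Prime → IsFundamentalAt p Δ) : IsFundamentalDiscriminant Δ := by
  have hodd : ∀ p : ℕ, p.Prime → p ≠ 2 → ¬ ((p : ℤ) ^ 2 ∣ Δ) := fun p hp h2 => by
    simpa [IsFundamentalAt, h2] using h p hp
  have h2 := h 2 Nat.prime_two
  simp only [IsFundamentalAt, if_true] at h2
  have key : ∀ n : ℤ, n ∣ Δ → ¬ (4 ∣ n) → Squarefree n := fun n hn h4 => by
    rw [← Int.squarefree_natAbs, Nat.squarefree_iff_prime_squarefree]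
    intro p hp hd
    have hd' : ((p * p : ℕ) : ℤ) ∣ n := Int.natCast_dvd.2 hd
    push_cast at hd'
    by_cases hp2 : p = 2
    · subst hp2; exact h4 (by simpa using hd')
    · exact hodd p hp hp2 (by rw [sq]; exact hd'.trans hn)
  refine ⟨by omega, ?_⟩
  by_cases h4 : Δ % 4 = 1
  · exact Or.inl ⟨h4, key Δ dvd_rfl (by omega)⟩
  · refine Or.inr ⟨by omega, key _ (Int.ediv_dvd_of_dvd (by omega)) (by omega), by omega⟩

/-- All the conditions at `p`. -/
def LocalCondition (S₁ S₂ : Finset ℕ) (p : ℕ) (Δ : ℤ) : Prop :=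
  IsFundamentalAt p Δ ∧ (p ∈ S₁ → ¬ SplitsIn p Δ) ∧ (p ∈ S₂ → SplitsIn p Δ ∨ RamifiesIn p Δ)

theorem isFundamentalAt_emod (p : ℕ) (n : ℤ) :
    IsFundamentalAt p (n % discModulus p) ↔ IsFundamentalAt p n := by
  unfold IsFundamentalAt discModulus
  split_ifs with h
  · push_cast; simp only [Int.emod_emod_of_dvd n (dvd_refl (16 : ℤ))]
  · push_cast
    rw [EuclideanDomain.dvd_mod_iff (dvd_refl ((p : ℤ) ^ 2))]

theorem dvd_sq_discModulus {p : ℕ} (h : p ≠ 2) : (p : ℤ) ∣ (discModulus p : ℤ) := by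
  rw [discModulus, if_neg h]; push_cast; exact dvd_pow_self _ two_ne_zero

theorem splitsIn_emod (p : ℕ) (n : ℤ) :
    SplitsIn p (n % discModulus p) ↔ SplitsIn p n := by
  unfold SplitsIn
  split_ifs with h hp
  · simp only [discModulus, if_pos h]; push_cast; omega
  · have := Fact.mk hp
    rw [legendreSym.mod p (n % _), Int.emod_emod_of_dvd n (dvd_sq_discModulus h), ← legendreSym.mod]
  · rfl

theorem ramifiesIn_emod (p : ℕ) (n : ℤ) :
    RamifiesIn p (n % discModulus p) ↔ RamifiesIn p n := by
  unfold RamifiesIn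
  split_ifs with h
  · simp only [discModulus, if_pos h]; push_cast; omega
  · exact EuclideanDomain.dvd_mod_iff (dvd_sq_discModulus h)

theorem localCondition_emod (S₁ S₂ : Finset ℕ) (p : ℕ) (n : ℤ) :
    LocalCondition S₁ S₂ p (n % discModulus p) ↔ LocalCondition S₁ S₂ p n := by
  unfold LocalCondition
  rw [isFundamentalAt_emod, splitsIn_emod, ramifiesIn_emod]

theorem discModulus_pos {p : ℕ} (hp : p.Prime) : 0 < discModulus p := by
  unfold discModulus
  split_ifs
  · norm_num
  · exact pow_pos hp.pos 2

/-- The residues modulo `discModulus p` satisfying the local condition at `p`. -/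
def localResidues (S₁ S₂ : Finset ℕ) (p : ℕ) : Set (ZMod (discModulus p)) :=
  {D | LocalCondition S₁ S₂ p D.val}

theorem intCast_mem_localResidues {S₁ S₂ : Finset ℕ} {p : ℕ} (hp : p.Prime) (n : ℤ) :
    (n : ZMod (discModulus p)) ∈ localResidues S₁ S₂ p ↔ LocalCondition S₁ S₂ p n := by
  have : NeZero (discModulus p) := ⟨(discModulus_pos hp).ne'⟩
  rw [← localCondition_emod, ← ZMod.val_intCast]
  rfl

theorem isFundamentalAt_val {p : ℕ} (hp : p.Prime) (hp2 : p ≠ 2) (D : ZMod (discModulus p)) :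
    IsFundamentalAt p D.val ↔ D ≠ 0 := by
  have : NeZero (discModulus p) := ⟨(discModulus_pos hp).ne'⟩
  rw [IsFundamentalAt, if_neg hp2, not_iff_not, ← ZMod.val_eq_zero]
  have h1 : (p : ℤ) ^ 2 = (discModulus p : ℕ) := by simp [discModulus, hp2]
  rw [h1, Int.natCast_dvd_natCast]
  exact ⟨fun h => Nat.eq_zero_of_dvd_of_lt h (ZMod.val_lt D), fun h => h ▸ dvd_zero _⟩

end Local

section LocalResidues

open Classical in
theorem two_mul_card_legendreSym_eq {p : ℕ} [hp : Fact p.Prime] (hp2 : p ≠ 2) [NeZero (p ^ 2)]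
    {s : ℤ} (hs : s = 1 ∨ s = -1) :
    2 * (Finset.univ.filter fun D : ZMod (p ^ 2) => legendreSym p D.val = s).card =
      p * (p - 1) := by
  have hmul : ∀ x y : ZMod (p ^ 2),
      legendreSym p (x * y).val = legendreSym p x.val * legendreSym p y.val := by
    intro x y
    rw [← legendreSym.mul, legendreSym.mod p (_ * _), legendreSym.mod p (ZMod.val (x * y)),
      ZMod.val_mul]
    push_cast
    rw [Int.emod_emod_of_dvd _ (dvd_pow_self (p : ℤ) two_ne_zero)]
  have hunit : ∀ x : ZMod (p ^ 2), IsUnit x ↔ legendreSym p x.val = 1 ∨ legendreSym p x.val = -1 := by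
    intro x
    rw [ZMod.isUnit_prime_sq_iff]
    have h0 := legendreSym.eq_zero_iff p (x.val : ℤ)
    rw [Int.cast_natCast, ZMod.natCast_eq_zero_iff] at h0
    constructor
    · intro h
      refine legendreSym.eq_one_or_neg_one p ?_
      rwa [Int.cast_natCast, Ne, ZMod.natCast_eq_zero_iff]
    · intro h h'
      have := h0.2 h'
      omega
  obtain ⟨g, hg⟩ : ∃ g : ZMod (p ^ 2), legendreSym p g.val = -1 := by
    obtain ⟨a, ha⟩ := quadraticChar_exists_neg_one (F := ZMod p)
      (by rwa [ZMod.ringChar_zmod_n])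
    refine ⟨(a.val : ZMod (p ^ 2)), ?_⟩
    rw [ZMod.val_natCast, legendreSym.mod, Int.natCast_mod, Nat.cast_pow,
      Int.emod_emod_of_dvd _ (dvd_pow_self (p : ℤ) two_ne_zero), ← legendreSym.mod, legendreSym]
    simpa using ha
  have hgu : IsUnit g := (hunit g).2 (Or.inr hg)
  have hcard : ∀ t : ℤ, (Finset.univ.filter fun D : ZMod (p ^ 2) => legendreSym p D.val = t).card ≤
      (Finset.univ.filter fun D : ZMod (p ^ 2) => legendreSym p D.val = -t).card := by
    intro t
    refine Finset.card_le_card_of_injOn (fun x => g * x) ?_ ?_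
    · intro x hx
      have hx' : legendreSym p x.val = t := by simpa using hx
      have h : legendreSym p (g * x).val = -t := by rw [hmul, hg, hx', neg_one_mul]
      exact Finset.mem_coe.2 (Finset.mem_filter.2 ⟨Finset.mem_univ _, h⟩)
    · intro x _ y _ h
      exact hgu.mul_left_cancel h
  have e : (Finset.univ.filter fun D : ZMod (p ^ 2) => legendreSym p D.val = 1).card =
      (Finset.univ.filter fun D : ZMod (p ^ 2) => legendreSym p D.val = -1).card :=
    le_antisymm (hcard 1) (by simpa using hcard (-1))
  have htot : (Finset.univ.filter fun D : ZMod (p ^ 2) => legendreSym p D.val = 1).card +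
      (Finset.univ.filter fun D : ZMod (p ^ 2) => legendreSym p D.val = -1).card = p * (p - 1) := by
    rw [← ZMod.card_units_prime_sq, ← Finset.card_union_of_disjoint]
    · congr 1
      ext x
      simp [hunit]
    · rw [Finset.disjoint_filter]
      intro x _ h1 h2
      omega
  rcases hs with rfl | rfl <;> omega

theorem le_two_mul_card_of_legendreSym {p : ℕ} [hp : Fact p.Prime] (hp2 : p ≠ 2) {m : ℕ}
    (hm : m = p ^ 2) {s : ℤ} (hs : s = 1 ∨ s = -1) {A : Set (ZMod m)}
    (hA : ∀ D : ZMod m, D ≠ 0 → legendreSym p D.val = s ∨ p ∣ D.val → D ∈ A) :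
    (p - 1) * (p + 2) ≤ 2 * Nat.card A := by
  classical
  subst hm
  have : NeZero (p ^ 2) := ⟨pow_ne_zero _ hp.out.ne_zero⟩
  have h1 := two_mul_card_legendreSym_eq hp2 hs
  have h2 := ZMod.card_nonunits_prime_sq (p := p)
  have h0 : (0 : ZMod (p ^ 2)) ∈ Finset.univ.filter fun x : ZMod (p ^ 2) => ¬ IsUnit x := by
    simp [ZMod.isUnit_prime_sq_iff]
  have h3 := Finset.card_erase_of_mem h0
  have hsub : (Finset.univ.filter fun D : ZMod (p ^ 2) => legendreSym p D.val = s) ∪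
      (Finset.univ.filter fun x : ZMod (p ^ 2) => ¬ IsUnit x).erase 0 ⊆
      Finset.univ.filter fun D => D ∈ A := by
    intro x hx
    simp only [Finset.mem_union, Finset.mem_filter, Finset.mem_univ, true_and, Finset.mem_erase,
      ZMod.isUnit_prime_sq_iff, not_not] at hx ⊢
    rcases hx with h | ⟨h, h'⟩
    · refine hA x ?_ (Or.inl h)
      rintro rfl
      have h4 : legendreSym p ((0 : ZMod (p ^ 2)).val : ℤ) = 0 :=
        (legendreSym.eq_zero_iff p _).2 (by simp)
      omega
    · exact hA x h (Or.inr h')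
  have hdis : Disjoint (Finset.univ.filter fun D : ZMod (p ^ 2) => legendreSym p D.val = s)
      ((Finset.univ.filter fun x : ZMod (p ^ 2) => ¬ IsUnit x).erase 0) := by
    rw [Finset.disjoint_left]
    intro x hx hx'
    simp only [Finset.mem_filter, Finset.mem_univ, true_and, Finset.mem_erase,
      ZMod.isUnit_prime_sq_iff, not_not] at hx hx'
    have h4 : legendreSym p (x.val : ℤ) = 0 :=
      (legendreSym.eq_zero_iff p _).2 (by
        rw [Int.cast_natCast, ZMod.natCast_eq_zero_iff]; exact hx'.2)
    omega
  have h5 := Finset.card_le_card hsub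
  rw [Finset.card_union_of_disjoint hdis, h3, h2] at h5
  have h6 : Nat.card A = (Finset.univ.filter fun D => D ∈ A).card := by
    rw [Nat.card_eq_fintype_card, Fintype.card_subtype]
  rw [h6]
  obtain ⟨k, hk⟩ : ∃ k, p = k + 1 := ⟨p - 1, by have := hp.out.pos; omega⟩
  subst hk
  simp only [Nat.add_sub_cancel] at *
  nlinarith

theorem card_localResidues_empty_two : Nat.card (localResidues ∅ ∅ 2) = 6 := by
  have e : ∀ D : ZMod 16, LocalCondition ∅ ∅ 2 (ZMod.val (n := 16) D) ↔
      D ∈ ({1, 5, 9, 13, 8, 12} : Finset (ZMod 16)) := by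
    simp only [LocalCondition, IsFundamentalAt, if_true, Finset.notMem_empty, false_imp_iff,
      and_true]
    decide
  calc Nat.card (localResidues ∅ ∅ 2) =
      Nat.card {D : ZMod 16 // D ∈ ({1, 5, 9, 13, 8, 12} : Finset (ZMod 16))} :=
        Nat.card_congr (Equiv.subtypeEquivRight e)
    _ = 6 := by rw [Nat.card_eq_fintype_card, Fintype.card_coe]; rfl

theorem card_localResidues_empty {p : ℕ} (hp : p.Prime) (hp2 : p ≠ 2) :
    Nat.card (localResidues ∅ ∅ p) = p ^ 2 - 1 := by
  have : NeZero (discModulus p) := ⟨(discModulus_pos hp).ne'⟩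
  have e : localResidues ∅ ∅ p = {0}ᶜ := by
    ext D
    change LocalCondition ∅ ∅ p D.val ↔ _
    simp only [LocalCondition, Finset.notMem_empty, false_imp_iff, and_true,
      isFundamentalAt_val hp hp2, Set.mem_compl_iff, Set.mem_singleton_iff]
  rw [e, Nat.card_coe_set_eq, Set.ncard_compl, Nat.card_zmod, Set.ncard_singleton, discModulus,
    if_neg hp2]

/-- The local factor at `p` in the density estimate. -/
noncomputable def densityFactor (p : ℕ) : ℝ :=
  if p = 2 then (1 / 24 : ℝ) else ((p : ℝ) + 2) / (2 * ((p : ℝ) + 1))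

theorem densityFactor_pos (p : ℕ) : 0 < densityFactor p := by
  unfold densityFactor
  split_ifs <;> positivity

theorem localResidues_eq_of_notMem {S₁ S₂ : Finset ℕ} {p : ℕ} (h1 : p ∉ S₁) (h2 : p ∉ S₂) :
    localResidues S₁ S₂ p = localResidues ∅ ∅ p := by
  ext D
  change LocalCondition _ _ _ _ ↔ LocalCondition _ _ _ _
  simp [LocalCondition, h1, h2]

theorem densityFactor_mul_card_le {S₁ S₂ : Finset ℕ} (hdisj : Disjoint S₁ S₂) {p : ℕ}
    (hp : p.Prime) (hpS : p ∈ S₁ ∪ S₂) :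
    densityFactor p * Nat.card (localResidues ∅ ∅ p) ≤ Nat.card (localResidues S₁ S₂ p) := by
  have : NeZero (discModulus p) := ⟨(discModulus_pos hp).ne'⟩
  by_cases hp2 : p = 2
  · subst hp2
    rw [card_localResidues_empty_two, densityFactor, if_pos rfl]
    have h8 : ((8 : ℤ) : ZMod (discModulus 2)) ∈ localResidues S₁ S₂ 2 := by
      rw [intCast_mem_localResidues hp]
      simp [LocalCondition, IsFundamentalAt, SplitsIn, RamifiesIn]
    have h1 : 0 < Nat.card (localResidues S₁ S₂ 2) :=
      Nat.card_pos_iff.2 ⟨⟨_, h8⟩, inferInstance⟩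
    have h2 : (1 : ℝ) ≤ Nat.card (localResidues S₁ S₂ 2) := by exact_mod_cast h1
    push_cast
    linarith
  · have := Fact.mk hp
    have hm : discModulus p = p ^ 2 := by simp [discModulus, hp2]
    have key : (p - 1) * (p + 2) ≤ 2 * Nat.card (localResidues S₁ S₂ p) := by
      have hsplit : ∀ D : ZMod (discModulus p), SplitsIn p D.val ↔ legendreSym p D.val = 1 := by
        intro D; simp [SplitsIn, hp2, hp]
      have hram : ∀ D : ZMod (discModulus p), RamifiesIn p D.val ↔ p ∣ D.val := by
        intro D; rw [RamifiesIn, if_neg hp2, Int.natCast_dvd_natCast]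
      have hz : ∀ D : ZMod (discModulus p), p ∣ D.val → legendreSym p D.val ≠ 1 := by
        intro D h h'
        have : legendreSym p (D.val : ℤ) = 0 :=
          (legendreSym.eq_zero_iff p _).2 (by
            rwa [Int.cast_natCast, ZMod.natCast_eq_zero_iff])
        omega
      rcases Finset.mem_union.1 hpS with h | h
      · have hn : p ∉ S₂ := Finset.disjoint_left.1 hdisj h
        refine le_two_mul_card_of_legendreSym hp2 hm (s := -1) (Or.inr rfl) fun D hD hD' => ?_
        refine ⟨(isFundamentalAt_val hp hp2 D).2 hD, fun _ => ?_, fun h' => absurd h' hn⟩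
        rw [hsplit]
        rcases hD' with h' | h'
        · omega
        · exact hz D h'
      · have hn : p ∉ S₁ := Finset.disjoint_right.1 hdisj h
        refine le_two_mul_card_of_legendreSym hp2 hm (s := 1) (Or.inl rfl) fun D hD hD' => ?_
        refine ⟨(isFundamentalAt_val hp hp2 D).2 hD, fun h' => absurd h' hn, fun _ => ?_⟩
        rw [hsplit, hram]
        exact hD'
    rw [card_localResidues_empty hp hp2, densityFactor, if_neg hp2]
    obtain ⟨k, hk⟩ : ∃ k, p = k + 1 := ⟨p - 1, by have := hp.pos; omega⟩
    have h1 : p ^ 2 - 1 = k * (k + 2) := by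
      rw [hk, show (k + 1) ^ 2 = k * (k + 2) + 1 by ring]; simp
    rw [h1]
    have hk' : (p : ℝ) = k + 1 := by rw [hk]; push_cast; ring
    have key' : (k : ℝ) * (k + 3) ≤ 2 * Nat.card (localResidues S₁ S₂ p) := by
      have : k * (k + 3) ≤ 2 * Nat.card (localResidues S₁ S₂ p) := by
        refine le_trans (le_of_eq ?_) key
        rw [hk]; simp
      exact_mod_cast this
    rw [hk']
    push_cast
    have : ((k : ℝ) + 1 + 2) / (2 * (k + 1 + 1)) * (k * (k + 2)) = k * (k + 3) / 2 := by
      field_simp; ring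
    rw [this]; linarith

theorem card_localResidues_le {S₁ S₂ : Finset ℕ} (hdisj : Disjoint S₁ S₂) {p : ℕ}
    (hp : p.Prime) :
    (if p ∈ S₁ ∪ S₂ then densityFactor p else 1) * Nat.card (localResidues ∅ ∅ p) ≤
      Nat.card (localResidues S₁ S₂ p) := by
  split_ifs with h
  · exact densityFactor_mul_card_le hdisj hp h
  · rw [Finset.mem_union, not_or] at h
    rw [localResidues_eq_of_notMem h.1 h.2, one_mul]

/-- Upper bound for the number of forms modulo `discModulus p` of given discriminant. -/
def formCount (p : ℕ) : ℕ := if p = 2 then 6144 else p ^ 6 - p ^ 4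

theorem card_cubicDisc_le_formCount {S₁ S₂ : Finset ℕ} {p : ℕ} (hp : p.Prime)
    {D : ZMod (discModulus p)} (hD : D ∈ localResidues S₁ S₂ p) :
    Nat.card {f : Fin 4 → ZMod (discModulus p) //
      cubicDisc (f 0) (f 1) (f 2) (f 3) = D} ≤ formCount p := by
  by_cases hp2 : p = 2
  · subst hp2
    have h1 : IsFundamentalAt 2 (ZMod.val (n := 16) D) := hD.1
    rw [formCount, if_pos rfl]
    refine card_cubicDisc_sixteen_le (D := D) ?_
    have h2 : ∀ D : ZMod 16, IsFundamentalAt 2 (ZMod.val (n := 16) D) →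
        ZMod.val (n := 16) D ∈ [1, 5, 9, 13, 8, 12] := by
      simp only [IsFundamentalAt, if_true]
      decide
    exact h2 D h1
  · have := Fact.mk hp
    have h1 := (isFundamentalAt_val hp hp2 D).1 hD.1
    have hm : discModulus p = p ^ 2 := by simp [discModulus, hp2]
    rw [formCount, if_neg hp2]
    clear hD
    revert D
    rw [hm]
    intro D hD
    exact card_cubicDisc_odd_prime_sq_le hp2 hD

end LocalResidues

section Residues

theorem discModulus_coprime {p q : ℕ} (hp : p.Prime) (hq : q.Prime) (h : p ≠ q) :
    Nat.Coprime (discModulus p) (discModulus q) := by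
  have key : ∀ r : ℕ, ∃ k, discModulus r = r ^ k := fun r => by
    unfold discModulus
    split_ifs with h
    · exact ⟨4, by rw [h]; norm_num⟩
    · exact ⟨2, rfl⟩
  obtain ⟨k, hk⟩ := key p
  obtain ⟨l, hl⟩ := key q
  rw [hk, hl]
  exact Nat.Coprime.pow k l ((Nat.coprime_primes hp hq).2 h)

/-- The product of the local moduli at the primes below `Y`. -/
def globalModulus (Y : ℕ) : ℕ := ∏ p : Y.primesBelow, discModulus p

theorem globalModulus_pos (Y : ℕ) : 0 < globalModulus Y :=
  Finset.prod_pos fun p _ => discModulus_pos (Nat.prime_of_mem_primesBelow p.2)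

instance (Y : ℕ) : NeZero (globalModulus Y) := ⟨(globalModulus_pos Y).ne'⟩

/-- The Chinese remainder isomorphism for `globalModulus Y`. -/
noncomputable def crtEquiv (Y : ℕ) :
    ZMod (globalModulus Y) ≃+* ∀ p : Y.primesBelow, ZMod (discModulus p) :=
  ZMod.prodEquivPi (fun p : Y.primesBelow => discModulus p) fun p q h =>
    discModulus_coprime (Nat.prime_of_mem_primesBelow p.2) (Nat.prime_of_mem_primesBelow q.2)
      fun h' => h (Subtype.ext h')

/-- The residues satisfying the local conditions at all primes below `Y`. -/
noncomputable def globalResidues (S₁ S₂ : Finset ℕ) (Y : ℕ) : Set (ZMod (globalModulus Y)) :=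
  crtSet (crtEquiv Y) fun p => localResidues S₁ S₂ p

theorem intCast_mem_globalResidues {S₁ S₂ : Finset ℕ} {Y : ℕ} (n : ℤ) :
    (n : ZMod (globalModulus Y)) ∈ globalResidues S₁ S₂ Y ↔
      ∀ p : ℕ, p.Prime → p < Y → LocalCondition S₁ S₂ p n := by
  rw [globalResidues, intCast_mem_crtSet]
  constructor
  · intro h p hp hY
    exact (intCast_mem_localResidues hp n).1 (h ⟨p, Nat.mem_primesBelow.2 ⟨hY, hp⟩⟩)
  · intro h p
    have hp := Nat.mem_primesBelow.1 p.2
    exact (intCast_mem_localResidues hp.2 n).2 (h p hp.2 hp.1)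

/-- The proportion of residues satisfying the local conditions at all primes below `Y`. -/
noncomputable def residueDensity (S₁ S₂ : Finset ℕ) (Y : ℕ) : ℝ :=
  (Nat.card (globalResidues S₁ S₂ Y) : ℝ) / globalModulus Y

theorem residueDensity_eq_prod (S₁ S₂ : Finset ℕ) (Y : ℕ) :
    residueDensity S₁ S₂ Y =
      ∏ p ∈ Y.primesBelow, ((Nat.card (localResidues S₁ S₂ p) : ℝ) / discModulus p) := by
  rw [residueDensity, globalResidues, card_crtSet, globalModulus, Nat.cast_prod, Nat.cast_prod,
    ← Finset.prod_div_distrib]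
  exact Finset.prod_coe_sort _ fun p : ℕ => (Nat.card (localResidues S₁ S₂ p) : ℝ) / discModulus p

/-- The partial product of the Euler product of `1 / ζ(2)`. -/
noncomputable def eulerPartial (Y : ℕ) : ℝ := ∏ p ∈ Y.primesBelow, (1 - ((p : ℝ) ^ 2)⁻¹)

theorem prod_primesBelow_ite {Y : ℕ} (hY : 3 ≤ Y) (c : ℝ) :
    ∏ p ∈ Y.primesBelow, (if p = 2 then c else 1) = c := by
  rw [Finset.prod_ite_eq' Y.primesBelow 2 fun _ => c,
    if_pos (Nat.mem_primesBelow.2 ⟨by omega, Nat.prime_two⟩)]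

theorem residueDensity_empty {Y : ℕ} (hY : 3 ≤ Y) :
    residueDensity ∅ ∅ Y = eulerPartial Y / 2 := by
  rw [residueDensity_eq_prod, eulerPartial, div_eq_mul_inv, ← prod_primesBelow_ite hY (2 : ℝ)⁻¹,
    ← Finset.prod_mul_distrib]
  refine Finset.prod_congr rfl fun p hp => ?_
  have hp' := Nat.prime_of_mem_primesBelow hp
  have hp0 : (p : ℝ) ≠ 0 := by exact_mod_cast hp'.ne_zero
  split_ifs with h
  · subst h
    rw [card_localResidues_empty_two, discModulus, if_pos rfl]
    norm_num
  · rw [card_localResidues_empty hp' h, discModulus, if_neg h,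
      Nat.cast_sub (Nat.one_le_pow _ _ hp'.pos)]
    push_cast
    field_simp

theorem prod_mul_residueDensity_le {S₁ S₂ : Finset ℕ} (hS₁ : ∀ p ∈ S₁, p.Prime)
    (hS₂ : ∀ p ∈ S₂, p.Prime) (hdisj : Disjoint S₁ S₂) {Y : ℕ} (hY : ∀ p ∈ S₁ ∪ S₂, p < Y) :
    (∏ p ∈ S₁ ∪ S₂, densityFactor p) * residueDensity ∅ ∅ Y ≤ residueDensity S₁ S₂ Y := by
  have hsub : S₁ ∪ S₂ ⊆ Y.primesBelow := fun p hp => Nat.mem_primesBelow.2 ⟨hY p hp, by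
    rcases Finset.mem_union.1 hp with h | h
    exacts [hS₁ p h, hS₂ p h]⟩
  have e : ∏ p ∈ S₁ ∪ S₂, densityFactor p =
      ∏ p ∈ Y.primesBelow, if p ∈ S₁ ∪ S₂ then densityFactor p else 1 := by
    rw [Finset.prod_ite_mem, Finset.inter_eq_right.2 hsub]
  rw [e, residueDensity_eq_prod, residueDensity_eq_prod, ← Finset.prod_mul_distrib]
  refine Finset.prod_le_prod (fun p _ => ?_) fun p hp => ?_
  · have := densityFactor_pos p
    split_ifs <;> positivity
  · have := card_localResidues_le hdisj (Nat.prime_of_mem_primesBelow hp)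
    rw [← mul_div_assoc]
    gcongr

theorem card_discForms_globalResidues_le {S₁ S₂ : Finset ℕ} {Y : ℕ} (hY : 3 ≤ Y) :
    (Nat.card (discForms (globalResidues S₁ S₂ Y)) : ℝ) / globalModulus Y ^ 4 ≤
      2 * eulerPartial Y * residueDensity S₁ S₂ Y := by
  have : ∀ p : Y.primesBelow, Finite (ZMod (discModulus p)) := fun p =>
    have : NeZero (discModulus p) :=
      ⟨(discModulus_pos (Nat.prime_of_mem_primesBelow p.2)).ne'⟩
    inferInstance
  have h1 := card_discForms_crtSet_le (crtEquiv Y)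
    (fun p : Y.primesBelow => localResidues S₁ S₂ p) (k := fun p => formCount p)
    fun p D hD => card_cubicDisc_le_formCount (Nat.prime_of_mem_primesBelow p.2) hD
  have h2 : (Nat.card (discForms (globalResidues S₁ S₂ Y)) : ℝ) ≤
      ((∏ p : Y.primesBelow, formCount p : ℕ) : ℝ) * Nat.card (globalResidues S₁ S₂ Y) := by
    exact_mod_cast h1
  have hM : (0 : ℝ) < globalModulus Y := by exact_mod_cast globalModulus_pos Y
  have h3 : ((∏ p : Y.primesBelow, formCount p : ℕ) : ℝ) / globalModulus Y ^ 3 =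
      2 * eulerPartial Y := by
    have e1 : ((∏ p : Y.primesBelow, formCount p : ℕ) : ℝ) =
        ∏ p ∈ Y.primesBelow, (formCount p : ℝ) := by
      rw [Nat.cast_prod]
      exact Finset.prod_coe_sort _ fun p : ℕ => (formCount p : ℝ)
    have e2 : (globalModulus Y : ℝ) = ∏ p ∈ Y.primesBelow, (discModulus p : ℝ) := by
      rw [globalModulus, Nat.cast_prod]
      exact Finset.prod_coe_sort _ fun p : ℕ => (discModulus p : ℝ)
    rw [e1, e2, ← Finset.prod_pow, ← Finset.prod_div_distrib, eulerPartial,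
      ← prod_primesBelow_ite hY (2 : ℝ), ← Finset.prod_mul_distrib]
    refine Finset.prod_congr rfl fun p hp => ?_
    have hp' := Nat.prime_of_mem_primesBelow hp
    have hp0 : (p : ℝ) ≠ 0 := by exact_mod_cast hp'.ne_zero
    unfold formCount discModulus
    split_ifs with h
    · subst h; norm_num
    · rw [Nat.cast_sub (Nat.pow_le_pow_right hp'.pos (by norm_num))]
      push_cast
      field_simp
  calc (Nat.card (discForms (globalResidues S₁ S₂ Y)) : ℝ) / globalModulus Y ^ 4
      ≤ ((∏ p : Y.primesBelow, formCount p : ℕ) : ℝ) * Nat.card (globalResidues S₁ S₂ Y) /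
        globalModulus Y ^ 4 := by gcongr
    _ = ((∏ p : Y.primesBelow, formCount p : ℕ) : ℝ) / globalModulus Y ^ 3 *
        residueDensity S₁ S₂ Y := by
        rw [residueDensity]; field_simp
    _ = _ := by rw [h3]

theorem tendsto_eulerPartial :
    Tendsto eulerPartial atTop (nhds (6 / Real.pi ^ 2)) := by
  have h1 := riemannZeta_eulerProduct (s := 2) (by norm_num)
  rw [riemannZeta_two] at h1
  have h2 : Tendsto (fun Y : ℕ => ((eulerPartial Y)⁻¹ : ℝ)) atTop (nhds (Real.pi ^ 2 / 6)) := by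
    have h3 := (Complex.continuous_re.tendsto _).comp h1
    have e : ((Real.pi : ℂ) ^ 2 / 6).re = Real.pi ^ 2 / 6 := by
      have : ((Real.pi : ℂ) ^ 2 / 6) = ((Real.pi ^ 2 / 6 : ℝ) : ℂ) := by push_cast; ring
      rw [this, Complex.ofReal_re]
    rw [e] at h3
    refine h3.congr fun Y => ?_
    have : ∏ p ∈ Y.primesBelow, (1 - (p : ℂ) ^ (-2 : ℂ))⁻¹ = (((eulerPartial Y)⁻¹ : ℝ) : ℂ) := by
      rw [eulerPartial, ← Finset.prod_inv_distrib]
      push_cast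
      refine Finset.prod_congr rfl fun p _ => ?_
      rw [Complex.cpow_neg]
      norm_cast
    simp only [Function.comp_apply]
    rw [this, Complex.ofReal_re]
  have h4 := h2.inv₀ (by positivity)
  simp only [inv_inv, inv_div] at h4
  exact h4

end Residues

section IntervalCount

theorem abs_card_Ico_modEq_sub_le {M : ℕ} [NeZero M] {a b : ℤ} (hab : a ≤ b) (v : ℤ) :
    |(((Finset.Ico a b).filter fun n => n ≡ v [ZMOD M]).card : ℝ) - (b - a) / M| ≤ 1 := by
  have hM : (0 : ℤ) < M := by exact_mod_cast Nat.pos_of_neZero M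
  have hMQ : (0 : ℚ) < M := by exact_mod_cast hM
  have h := Int.Ico_filter_modEq_card a b hM v
  have hle : ((a : ℚ) - v) / M ≤ (b - v) / M := by
    have : (a : ℚ) ≤ b := by exact_mod_cast hab
    gcongr
  rw [max_eq_left (sub_nonneg.2 (by push_cast; exact Int.ceil_mono hle))] at h
  have h1 := Int.le_ceil (((b : ℚ) - v) / M)
  have h2 := Int.ceil_lt_add_one (((b : ℚ) - v) / M)
  have h3 := Int.le_ceil (((a : ℚ) - v) / M)
  have h4 := Int.ceil_lt_add_one (((a : ℚ) - v) / M)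
  have hQ : |(((Finset.Ico a b).filter fun n => n ≡ v [ZMOD M]).card : ℚ) - (b - a) / M| ≤ 1 := by
    have h5 : (((Finset.Ico a b).filter fun n => n ≡ v [ZMOD M]).card : ℚ) =
        (⌈((b : ℚ) - v) / M⌉ : ℚ) - ⌈((a : ℚ) - v) / M⌉ := by exact_mod_cast h
    have h6 : ((b : ℚ) - a) / M = (b - v) / M - (a - v) / M := by ring
    rw [h5, h6, abs_le]
    constructor <;> linarith
  exact_mod_cast hQ

open Classical in
theorem abs_card_Ico_residues_sub_le {M : ℕ} [NeZero M] (A : Set (ZMod M)) {a b : ℤ}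
    (hab : a ≤ b) :
    |(((Finset.Ico a b).filter fun n : ℤ => (n : ZMod M) ∈ A).card : ℝ) -
      Nat.card A / M * (b - a)| ≤ Nat.card A := by
  have e : ((Finset.Ico a b).filter fun n : ℤ => (n : ZMod M) ∈ A).card =
      ∑ v ∈ Finset.univ.filter (fun v : ZMod M => v ∈ A),
        ((Finset.Ico a b).filter fun n : ℤ => n ≡ v.val [ZMOD M]).card := by
    rw [Finset.card_eq_sum_card_fiberwise (f := fun n : ℤ => (n : ZMod M))
      (t := Finset.univ.filter (fun v : ZMod M => v ∈ A))]
    · refine Finset.sum_congr rfl fun v hv => ?_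
      have hvA : v ∈ A := (Finset.mem_filter.1 hv).2
      congr 1
      ext n
      have h1 : n ≡ v.val [ZMOD M] ↔ (n : ZMod M) = v := by
        rw [← ZMod.intCast_eq_intCast_iff, Int.cast_natCast, ZMod.natCast_zmod_val]
      simp only [Finset.mem_filter, h1]
      constructor
      · rintro ⟨⟨h2, -⟩, h3⟩; exact ⟨h2, h3⟩
      · rintro ⟨h2, h3⟩; exact ⟨⟨h2, by rwa [h3]⟩, h3⟩
    · intro n hn
      simpa using (Finset.mem_filter.1 (Finset.mem_coe.1 hn)).2
  have hc : Nat.card A = (Finset.univ.filter fun v : ZMod M => v ∈ A).card := by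
    rw [Nat.card_eq_fintype_card, Fintype.card_subtype]
  have h2 : (Nat.card A : ℝ) / M * (b - a) =
      ∑ v ∈ Finset.univ.filter (fun v : ZMod M => v ∈ A), ((b : ℝ) - a) / M := by
    rw [Finset.sum_const, ← hc, nsmul_eq_mul]; ring
  rw [e, h2, Nat.cast_sum, ← Finset.sum_sub_distrib]
  refine (Finset.abs_sum_le_sum_abs _ _).trans ?_
  refine (Finset.sum_le_card_nsmul _ _ 1 fun v _ => abs_card_Ico_modEq_sub_le hab _).trans ?_
  rw [← hc]; simp

theorem card_filter_sq_dvd_le (N : ℕ) {k : ℕ} (hk : 0 < k) :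
    (((Finset.Ico (-(N : ℤ)) 0).filter fun n => (k : ℤ) ^ 2 ∣ n).card : ℝ) ≤
      N * ((k : ℝ) ^ 2)⁻¹ := by
  have hk2 : (0 : ℤ) < (k : ℤ) ^ 2 := by positivity
  have h := Int.Ico_filter_dvd_card (-(N : ℤ)) 0 hk2
  have hkQ : (0 : ℚ) < (k : ℚ) ^ 2 := by positivity
  have h1 : (((Finset.Ico (-(N : ℤ)) 0).filter fun n => (k : ℤ) ^ 2 ∣ n).card : ℚ) ≤
      N * ((k : ℚ) ^ 2)⁻¹ := by
    have h2 : (((Finset.Ico (-(N : ℤ)) 0).filter fun n => (k : ℤ) ^ 2 ∣ n).card : ℚ) =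
      ((max (⌈((0 : ℤ) : ℚ) / ((k : ℤ) ^ 2 : ℤ)⌉ - ⌈((-(N : ℤ) : ℤ) : ℚ) / ((k : ℤ) ^ 2 : ℤ)⌉) 0 : ℤ) : ℚ) := by
      exact_mod_cast h
    rw [h2]
    push_cast
    have h3 := Int.le_ceil (-(N : ℚ) / (k : ℚ) ^ 2)
    have h4 : -(N : ℚ) / (k : ℚ) ^ 2 = -(N * ((k : ℚ) ^ 2)⁻¹) := by ring
    rw [h4] at h3 ⊢
    refine max_le ?_ (by positivity)
    simp only [zero_div, Int.ceil_zero, Int.cast_zero]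
    linarith
  generalize ((Finset.Ico (-(N : ℤ)) 0).filter fun n => (k : ℤ) ^ 2 ∣ n).card = c at h1 ⊢
  have h5 := (Rat.cast_le (K := ℝ)).2 h1
  push_cast at h5
  exact h5

end IntervalCount

section Assembly

/-- The splitting conditions at the primes of `S₁` and `S₂`. -/
def SplittingConditions (S₁ S₂ : Finset ℕ) (Δ : ℤ) : Prop :=
  (∀ p ∈ S₁, ¬ SplitsIn p Δ) ∧ ∀ p ∈ S₂, SplitsIn p Δ ∨ RamifiesIn p Δ

open Classical in
/-- The fundamental discriminants in `[-N, 0)` satisfying the splitting conditions. -/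
noncomputable def condDiscs (S₁ S₂ : Finset ℕ) (N : ℕ) : Finset ℤ :=
  (Finset.Ico (-(N : ℤ)) 0).filter fun Δ =>
    IsFundamentalDiscriminant Δ ∧ SplittingConditions S₁ S₂ Δ

theorem mem_condDiscs {S₁ S₂ : Finset ℕ} {N : ℕ} {Δ : ℤ} :
    Δ ∈ condDiscs S₁ S₂ N ↔ (-(N : ℤ) ≤ Δ ∧ Δ < 0) ∧
      IsFundamentalDiscriminant Δ ∧ SplittingConditions S₁ S₂ Δ := by
  simp [condDiscs]

theorem intCast_mem_globalResidues_of_mem_condDiscs {S₁ S₂ : Finset ℕ} {N Y : ℕ} {Δ : ℤ}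
    (h : Δ ∈ condDiscs S₁ S₂ N) : (Δ : ZMod (globalModulus Y)) ∈ globalResidues S₁ S₂ Y := by
  obtain ⟨-, h1, h2, h3⟩ := mem_condDiscs.1 h
  exact (intCast_mem_globalResidues Δ).2 fun p hp _ => ⟨h1.isFundamentalAt hp, h2 p, h3 p⟩

theorem card_globalResidues_le (S₁ S₂ : Finset ℕ) (Y : ℕ) :
    (Nat.card (globalResidues S₁ S₂ Y) : ℝ) ≤ globalModulus Y := by
  have h := Finite.card_subtype_le (· ∈ globalResidues S₁ S₂ Y)
  rw [Nat.card_zmod] at h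
  exact_mod_cast h

theorem card_condDiscs_le (S₁ S₂ : Finset ℕ) (Y N : ℕ) :
    ((condDiscs S₁ S₂ N).card : ℝ) ≤ residueDensity S₁ S₂ Y * N + globalModulus Y := by
  classical
  have h1 := abs_card_Ico_residues_sub_le (globalResidues S₁ S₂ Y)
    (a := -(N : ℤ)) (b := 0) (by omega)
  have h2 : (condDiscs S₁ S₂ N).card ≤ ((Finset.Ico (-(N : ℤ)) 0).filter fun n : ℤ =>
      (n : ZMod (globalModulus Y)) ∈ globalResidues S₁ S₂ Y).card := by
    refine Finset.card_le_card fun Δ hΔ => Finset.mem_filter.2 ⟨?_, ?_⟩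
    · exact Finset.mem_Ico.2 (mem_condDiscs.1 hΔ).1
    · exact intCast_mem_globalResidues_of_mem_condDiscs hΔ
  have h3 : ((condDiscs S₁ S₂ N).card : ℝ) ≤ ((Finset.Ico (-(N : ℤ)) 0).filter fun n : ℤ =>
      (n : ZMod (globalModulus Y)) ∈ globalResidues S₁ S₂ Y).card := by exact_mod_cast h2
  have h4 := card_globalResidues_le S₁ S₂ Y
  have h5 := (abs_le.1 h1).2
  push_cast at h5
  rw [residueDensity]
  linarith

theorem le_card_condDiscs {S₁ S₂ : Finset ℕ} (hS₁ : ∀ p ∈ S₁, p.Prime) (hS₂ : ∀ p ∈ S₂, p.Prime)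
    {Y : ℕ} (hY : 3 ≤ Y) (hYS : ∀ p ∈ S₁ ∪ S₂, p < Y) (N : ℕ) :
    residueDensity S₁ S₂ Y * N - globalModulus Y - 2 / (Y : ℝ) * N ≤
      (condDiscs S₁ S₂ N).card := by
  classical
  have h1 := abs_card_Ico_residues_sub_le (globalResidues S₁ S₂ Y)
    (a := -(N : ℤ)) (b := 0) (by omega)
  set A := (Finset.Ico (-(N : ℤ)) 0).filter fun n : ℤ =>
      (n : ZMod (globalModulus Y)) ∈ globalResidues S₁ S₂ Y with hA
  set B : ℕ → Finset ℤ := fun k => (Finset.Ico (-(N : ℤ)) 0).filter fun n => (k : ℤ) ^ 2 ∣ n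
    with hB
  have hsub : A ⊆ condDiscs S₁ S₂ N ∪ (Finset.Ioc (Y - 1) (max (Y - 1) N)).biUnion B := by
    intro Δ hΔ
    obtain ⟨hΔ1, hΔ2⟩ := Finset.mem_filter.1 hΔ
    rw [intCast_mem_globalResidues] at hΔ2
    obtain ⟨h3, h4⟩ := Finset.mem_Ico.1 hΔ1
    rw [Finset.mem_union]
    by_cases hf : ∀ p : ℕ, p.Prime → IsFundamentalAt p Δ
    · refine Or.inl (mem_condDiscs.2 ⟨⟨h3, h4⟩,
        isFundamentalDiscriminant_of_isFundamentalAt h4 hf, fun p hp => ?_, fun p hp => ?_⟩)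
      · exact (hΔ2 p (hS₁ p hp) (hYS p (Finset.mem_union_left _ hp))).2.1 hp
      · exact (hΔ2 p (hS₂ p hp) (hYS p (Finset.mem_union_right _ hp))).2.2 hp
    · push Not at hf
      obtain ⟨p, hp, hpf⟩ := hf
      have hpY : Y ≤ p := by
        by_contra h
        exact hpf (hΔ2 p hp (not_le.1 h)).1
      rw [IsFundamentalAt, if_neg (by omega), not_not] at hpf
      refine Or.inr (Finset.mem_biUnion.2 ⟨p, Finset.mem_Ioc.2 ⟨by omega, ?_⟩,
        Finset.mem_filter.2 ⟨hΔ1, hpf⟩⟩)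
      have h5 : (p : ℤ) ^ 2 ≤ -Δ := Int.le_of_dvd (by omega) ((dvd_neg).2 hpf)
      have h6 : (p : ℤ) ≤ N := by nlinarith [hp.pos]
      exact le_max_of_le_right (by exact_mod_cast h6)
  have h2 := (Finset.card_le_card hsub).trans
    ((Finset.card_union_le _ _).trans (Nat.add_le_add_left Finset.card_biUnion_le _))
  have h3 : (A.card : ℝ) ≤ (condDiscs S₁ S₂ N).card +
      ∑ k ∈ Finset.Ioc (Y - 1) (max (Y - 1) N), ((B k).card : ℝ) := by exact_mod_cast h2
  have hY' : (3 : ℝ) ≤ Y := by exact_mod_cast hY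
  have h4 : ∑ k ∈ Finset.Ioc (Y - 1) (max (Y - 1) N), ((B k).card : ℝ) ≤ 2 / (Y : ℝ) * N := by
    calc _ ≤ ∑ k ∈ Finset.Ioc (Y - 1) (max (Y - 1) N), (N : ℝ) * ((k : ℝ) ^ 2)⁻¹ :=
          Finset.sum_le_sum fun k hk =>
            card_filter_sq_dvd_le N (by have := (Finset.mem_Ioc.1 hk).1; omega)
      _ = N * ∑ k ∈ Finset.Ioc (Y - 1) (max (Y - 1) N), ((k : ℝ) ^ 2)⁻¹ :=
          (Finset.mul_sum _ _ _).symm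
      _ ≤ N * (2 / (Y : ℝ)) := by
          gcongr
          refine (sum_Ioc_inv_sq_le_sub (by omega) (le_max_left _ _)).trans ?_
          have h5 : (0 : ℝ) ≤ ((max (Y - 1) N : ℕ) : ℝ)⁻¹ := by positivity
          have h6 : (((Y - 1 : ℕ) : ℝ))⁻¹ ≤ 2 / Y := by
            rw [Nat.cast_sub (by omega), Nat.cast_one, inv_eq_one_div,
              div_le_div_iff₀ (by linarith) (by linarith)]
            linarith
          linarith
      _ = _ := mul_comm _ _
  have h5 := (abs_le.1 h1).1
  have h6 := card_globalResidues_le S₁ S₂ Y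
  push_cast at h5
  rw [residueDensity]
  linarith

open Classical in
theorem eventually_card_divisible_le (S₁ S₂ : Finset ℕ) {Y : ℕ} (hY : 3 ≤ Y) {ε : ℝ}
    (hε : 0 < ε) :
    ∀ᶠ X : ℝ in atTop, ∀ N : ℕ, (N : ℝ) < X →
      (((condDiscs S₁ S₂ N).filter fun Δ => 3 ∣ classNum Δ).card : ℝ) ≤
        (2 * eulerPartial Y * residueDensity S₁ S₂ Y * (Real.pi ^ 2 / 24) + ε) * X := by
  filter_upwards [card_reduced_le (discForms (globalResidues S₁ S₂ Y)) hε, eventually_ge_atTop 0]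
    with X hX hX0 N hN
  have hex : ∀ Δ : ℤ, ∃ f : Fin 4 → ℤ,
      Δ ∈ (condDiscs S₁ S₂ N).filter (fun Δ => 3 ∣ classNum Δ) →
        cubicDisc (f 0) (f 1) (f 2) (f 3) = Δ ∧ IsReducedCubic f := by
    intro Δ
    by_cases h : Δ ∈ (condDiscs S₁ S₂ N).filter (fun Δ => 3 ∣ classNum Δ)
    · obtain ⟨h1, h2⟩ := Finset.mem_filter.1 h
      obtain ⟨⟨-, h3⟩, h4, -⟩ := mem_condDiscs.1 h1
      obtain ⟨a, b, c, d, e, r1, r2, r3, r4⟩ :=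
        exists_reduced_cubic_of_three_dvd_classNum h4 h3 h2
      exact ⟨![a, b, c, d], fun _ => ⟨e, r1, r2, r3, r4, lt_of_eq_of_lt e h3⟩⟩
    · exact ⟨0, fun h' => absurd h' h⟩
  choose φ hφ using hex
  have hinj : Set.InjOn φ ((condDiscs S₁ S₂ N).filter fun Δ => 3 ∣ classNum Δ : Finset ℤ) := by
    intro Δ hΔ Δ' hΔ' h
    rw [← (hφ Δ hΔ).1, ← (hφ Δ' hΔ').1, h]
  have h := hX (((condDiscs S₁ S₂ N).filter fun Δ => 3 ∣ classNum Δ).image φ) fun f hf => by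
    obtain ⟨Δ, hΔ, rfl⟩ := Finset.mem_image.1 hf
    obtain ⟨h1, h2⟩ := hφ Δ hΔ
    have h3 := (Finset.mem_filter.1 hΔ).1
    refine ⟨?_, h2, ?_⟩
    · change cubicDisc _ _ _ _ ∈ globalResidues S₁ S₂ Y
      have h4 := intCast_mem_globalResidues_of_mem_condDiscs (Y := Y) h3
      rw [← h1] at h4
      have h5 := map_cubicDisc (Int.castRingHom (ZMod (globalModulus Y)))
        (φ Δ 0) (φ Δ 1) (φ Δ 2) (φ Δ 3)
      simp only [eq_intCast] at h5
      rwa [h5] at h4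
    · rw [h1]
      have h4 : (-(N : ℤ) : ℝ) ≤ Δ := by exact_mod_cast (mem_condDiscs.1 h3).1.1
      push_cast at h4
      linarith
  rw [Finset.card_image_of_injOn hinj] at h
  refine h.trans ?_
  have := card_discForms_globalResidues_le (S₁ := S₁) (S₂ := S₂) hY
  gcongr

theorem natCard_condDiscs {x : ℝ} (hx : 0 < x) (S₁ S₂ : Finset ℕ) (Q : ℤ → Prop)
    [DecidablePred Q] :
    Nat.card {Δ : ℤ | IsFundamentalDiscriminant Δ ∧ Δ < 0 ∧ |(Δ : ℝ)| < x ∧ Q Δ ∧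
      (∀ p ∈ S₁, ¬ SplitsIn p Δ) ∧ (∀ p ∈ S₂, SplitsIn p Δ ∨ RamifiesIn p Δ)} =
    ((condDiscs S₁ S₂ (⌈x⌉₊ - 1)).filter Q).card := by
  have hc : 0 < ⌈x⌉₊ := Nat.ceil_pos.2 hx
  rw [← Nat.card_eq_finsetCard]
  refine Nat.card_congr (Equiv.subtypeEquivRight fun Δ => ?_)
  rw [Finset.mem_filter, mem_condDiscs]
  have key : Δ < 0 → (|(Δ : ℝ)| < x ↔ -((⌈x⌉₊ - 1 : ℕ) : ℤ) ≤ Δ) := by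
    intro h
    have h1 : |(Δ : ℝ)| = (Δ.natAbs : ℝ) := by rw [Nat.cast_natAbs, Int.cast_abs]
    rw [h1, ← Nat.lt_ceil]
    omega
  constructor
  · rintro ⟨h1, h2, h3, h4, h5, h6⟩
    exact ⟨⟨⟨(key h2).1 h3, h2⟩, h1, h5, h6⟩, h4⟩
  · rintro ⟨⟨⟨h3, h2⟩, h1, h5, h6⟩, h4⟩
    exact ⟨h1, h2, (key h2).2 h3, h4, h5, h6⟩

theorem natCard_fundamental {x : ℝ} (hx : 0 < x) :
    Nat.card {Δ : ℤ | IsFundamentalDiscriminant Δ ∧ Δ < 0 ∧ |(Δ : ℝ)| < x} =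
    (condDiscs ∅ ∅ (⌈x⌉₊ - 1)).card := by
  have h := natCard_condDiscs hx ∅ ∅ fun _ => True
  simpa using h

theorem isFundamentalDiscriminant_neg_three : IsFundamentalDiscriminant (-3) :=
  ⟨by norm_num, Or.inl ⟨by norm_num, (Int.prime_three.neg).squarefree⟩⟩

end Assembly

theorem exists_sieve_level {S₁ S₂ : Finset ℕ} (ρ : ℝ) {η : ℝ} (hη : 0 < η) :
    ∃ Y : ℕ, 3 ≤ Y ∧ (∀ p ∈ S₁ ∪ S₂, p < Y) ∧ 0 < eulerPartial Y ∧
      0 ≤ 1 - 2 * eulerPartial Y * (Real.pi ^ 2 / 24) ∧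
      (ρ / 2 - η) * (eulerPartial Y / 2) ≤
        ρ * (eulerPartial Y / 2) * (1 - 2 * eulerPartial Y * (Real.pi ^ 2 / 24)) - 2 / Y := by
  have hE := tendsto_eulerPartial
  have hpi : (0 : ℝ) < Real.pi ^ 2 := by positivity
  have h1 : Tendsto (fun Y : ℕ => 1 - 2 * eulerPartial Y * (Real.pi ^ 2 / 24)) atTop
      (nhds (1 / 2)) := by
    have := ((hE.const_mul 2).mul_const (Real.pi ^ 2 / 24)).const_sub 1
    rwa [show (1 : ℝ) - 2 * (6 / Real.pi ^ 2) * (Real.pi ^ 2 / 24) = 1 / 2 by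
      field_simp; norm_num] at this
  have h2 : Tendsto (fun Y : ℕ => (2 : ℝ) / Y) atTop (nhds 0) :=
    tendsto_const_div_atTop_nhds_zero_nat 2
  have h3 : Tendsto (fun Y : ℕ => ρ * (eulerPartial Y / 2) *
      (1 - 2 * eulerPartial Y * (Real.pi ^ 2 / 24)) - 2 / Y -
      (ρ / 2 - η) * (eulerPartial Y / 2)) atTop (nhds (η * (3 / Real.pi ^ 2))) := by
    have := ((((hE.div_const 2).const_mul ρ).mul h1).sub h2).sub
      ((hE.div_const 2).const_mul (ρ / 2 - η))
    rwa [show ρ * (6 / Real.pi ^ 2 / 2) * (1 / 2) - 0 - (ρ / 2 - η) * (6 / Real.pi ^ 2 / 2) =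
      η * (3 / Real.pi ^ 2) by field_simp; ring] at this
  have e1 := hE.eventually_const_lt (u := 0) (by positivity)
  have e2 := h1.eventually_const_lt (u := 0) (by norm_num)
  have e3 := h3.eventually_const_lt (u := 0) (by positivity)
  obtain ⟨Y, h⟩ := ((eventually_ge_atTop 3).and ((eventually_gt_atTop ((S₁ ∪ S₂).sup id)).and
    (e1.and (e2.and e3)))).exists
  obtain ⟨g1, g2, g3, g4, g5⟩ := h
  exact ⟨Y, g1, fun p hp => (Finset.le_sup (f := id) hp).trans_lt g2, g3, g4.le, by linarith⟩

theorem eventually_ratio_ge {S₁ S₂ : Finset ℕ} (hS₁ : ∀ p ∈ S₁, p.Prime)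
    (hS₂ : ∀ p ∈ S₂, p.Prime) (hdisj : Disjoint S₁ S₂) {η : ℝ} (hη : 0 < η) :
    ∀ᶠ x : ℝ in atTop, (1 / 2 : ℝ) * ∏ p ∈ S₁ ∪ S₂, densityFactor p - η ≤
        ((Nat.card {Δ : ℤ | IsFundamentalDiscriminant Δ ∧ Δ < 0 ∧ |(Δ : ℝ)| < x ∧
            ¬ (3 ∣ classNum Δ) ∧ (∀ p ∈ S₁, ¬ SplitsIn p Δ) ∧
            (∀ p ∈ S₂, SplitsIn p Δ ∨ RamifiesIn p Δ)} : ℕ) : ℝ) /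
        ((Nat.card {Δ : ℤ | IsFundamentalDiscriminant Δ ∧ Δ < 0 ∧ |(Δ : ℝ)| < x} : ℕ) : ℝ) := by
  classical
  set ρ := ∏ p ∈ S₁ ∪ S₂, densityFactor p
  set c := (1 / 2 : ℝ) * ρ - η with hc
  obtain ⟨Y, hY, hYS, hE, hκ, hlev⟩ := exists_sieve_level (S₁ := S₁) (S₂ := S₂) ρ (half_pos hη)
  set w := eulerPartial Y / 2 with hw
  set κ := 2 * eulerPartial Y * (Real.pi ^ 2 / 24) with hκ'
  set z := residueDensity S₁ S₂ Y with hz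
  have hw0 : 0 < w := by positivity
  have hzw : ρ * w ≤ z := by
    have := prod_mul_residueDensity_le hS₁ hS₂ hdisj hYS
    rwa [residueDensity_empty hY] at this
  set M : ℝ := (globalModulus Y : ℝ)
  have hε : 0 < w * η / 4 := by positivity
  filter_upwards [eventually_card_divisible_le S₁ S₂ hY hε, eventually_gt_atTop 4,
    eventually_ge_atTop ((M + z + |c| * M) / (w * η / 4))] with x hx hx4 hxC
  have hx0 : (0 : ℝ) < x := by linarith
  set N := ⌈x⌉₊ - 1 with hN
  have hN1 : 1 ≤ ⌈x⌉₊ := Nat.ceil_pos.2 hx0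
  have hNR : (N : ℝ) = (⌈x⌉₊ : ℝ) - 1 := by rw [hN, Nat.cast_sub hN1, Nat.cast_one]
  have hNx : (N : ℝ) < x := by
    have := Nat.ceil_lt_add_one hx0.le
    linarith
  have hxN : x - 1 ≤ N := by
    have := Nat.le_ceil x
    linarith
  rw [natCard_condDiscs hx0 S₁ S₂ fun Δ => ¬ 3 ∣ classNum Δ, natCard_fundamental hx0, ← hN]
  have hden : (0 : ℝ) < (condDiscs ∅ ∅ N).card := by
    have : (-3 : ℤ) ∈ condDiscs ∅ ∅ N := by
      refine mem_condDiscs.2 ⟨⟨?_, by norm_num⟩, isFundamentalDiscriminant_neg_three, ?_⟩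
      · have : (3 : ℝ) < N := by linarith
        have : 3 < N := by exact_mod_cast this
        omega
      · simp [SplittingConditions]
    exact_mod_cast Finset.card_pos.2 ⟨_, this⟩
  rw [le_div_iff₀ hden]
  have h1 := card_condDiscs_le ∅ ∅ Y N
  rw [residueDensity_empty hY, ← hw] at h1
  have h2 := le_card_condDiscs hS₁ hS₂ hY hYS N
  have h3 := hx N hNx
  have h4 : (((condDiscs S₁ S₂ N).filter fun Δ => 3 ∣ classNum Δ).card : ℝ) +
      ((condDiscs S₁ S₂ N).filter fun Δ => ¬ 3 ∣ classNum Δ).card = (condDiscs S₁ S₂ N).card := by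
    exact_mod_cast Finset.card_filter_add_card_filter_not _
  rw [← hz] at h2 h3
  rw [div_le_iff₀ hε] at hxC
  have hz0 : 0 ≤ z := by rw [hz, residueDensity]; positivity
  have hM0 : 0 ≤ M := Nat.cast_nonneg _
  rcases le_total c 0 with hc0 | hc0
  · exact (mul_nonpos_of_nonpos_of_nonneg hc0 hden.le).trans (Nat.cast_nonneg _)
  rw [abs_of_nonneg hc0] at hxC
  have h5 : c * (condDiscs ∅ ∅ N).card ≤ c * (w * x + M) := by
    refine mul_le_mul_of_nonneg_left (h1.trans ?_) hc0
    have := mul_le_mul_of_nonneg_left hNx.le hw0.le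
    linarith
  have h6 : z * (x - 1) ≤ z * N := mul_le_mul_of_nonneg_left hxN hz0
  have h7 : 2 / (Y : ℝ) * N ≤ 2 / (Y : ℝ) * x := mul_le_mul_of_nonneg_left hNx.le (by positivity)
  have h8 : ρ * w * (1 - κ) ≤ z * (1 - κ) := mul_le_mul_of_nonneg_right hzw hκ
  have h9 : ((ρ / 2 - η / 2) * w) * x ≤ (z * (1 - κ) - 2 / Y) * x :=
    mul_le_mul_of_nonneg_right (by linarith) hx0.le
  have h10 : 2 * eulerPartial Y * z * (Real.pi ^ 2 / 24) = κ * z := by rw [hκ']; ring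
  rw [h10] at h3
  have h11 : c * (w * x) = (ρ / 2 - η / 2) * w * x - w * η / 2 * x := by rw [hc]; ring
  linarith
/-- for disjoint finite sets of primes `S₁`, `S₂`, the lower density of negative
fundamental discriminants `Δ` with `3 ∤ h(Δ)`, no prime of `S₁` split in ℚ(√Δ), and every prime
of `S₂` split or ramified in ℚ(√Δ), is at least `(1/2) ∏_{p ∈ S₁ ∪ S₂} n_p`. -/
theorem lower_density_nondivisible_class_number
    (S₁ S₂ : Finset ℕ) (hS₁ : ∀ p ∈ S₁, p.Prime) (hS₂ : ∀ p ∈ S₂, p.Prime)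
    (hdisj : Disjoint S₁ S₂) :
    (1 / 2 : ℝ) * ∏ p ∈ S₁ ∪ S₂,
        (if p = 2 then (1 / 24 : ℝ) else ((p : ℝ) + 2) / (2 * ((p : ℝ) + 1))) ≤
      Filter.liminf (fun x : ℝ =>
        ((Nat.card {Δ : ℤ | IsFundamentalDiscriminant Δ ∧ Δ < 0 ∧ |(Δ : ℝ)| < x ∧
            ¬ (3 ∣ classNum Δ) ∧ (∀ p ∈ S₁, ¬ SplitsIn p Δ) ∧
            (∀ p ∈ S₂, SplitsIn p Δ ∨ RamifiesIn p Δ)} : ℕ) : ℝ) /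
        ((Nat.card {Δ : ℤ | IsFundamentalDiscriminant Δ ∧ Δ < 0 ∧ |(Δ : ℝ)| < x} : ℕ) : ℝ))
        Filter.atTop := by
  have hle : ∀ x : ℝ,
      ((Nat.card {Δ : ℤ | IsFundamentalDiscriminant Δ ∧ Δ < 0 ∧ |(Δ : ℝ)| < x ∧
            ¬ (3 ∣ classNum Δ) ∧ (∀ p ∈ S₁, ¬ SplitsIn p Δ) ∧
            (∀ p ∈ S₂, SplitsIn p Δ ∨ RamifiesIn p Δ)} : ℕ) : ℝ) /
        ((Nat.card {Δ : ℤ | IsFundamentalDiscriminant Δ ∧ Δ < 0 ∧ |(Δ : ℝ)| < x} : ℕ) : ℝ) ≤ 1 := by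
    intro x
    refine div_le_one_of_le₀ (Nat.cast_le.2 (Nat.card_mono ?_ ?_)) (Nat.cast_nonneg _)
    · refine (Set.finite_Icc (-⌈x⌉) ⌈x⌉).subset fun Δ hΔ => ?_
      have h1 : |(Δ : ℝ)| ≤ (⌈x⌉ : ℝ) := hΔ.2.2.le.trans (Int.le_ceil x)
      have h2 : |Δ| ≤ ⌈x⌉ := by exact_mod_cast h1
      exact abs_le.1 h2
    · exact fun Δ hΔ => ⟨hΔ.1, hΔ.2.1, hΔ.2.2.1⟩
  refine le_of_forall_sub_le fun η hη => ?_
  refine le_liminf_of_le ?_ (eventually_ratio_ge hS₁ hS₂ hdisj hη)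
  exact (isBoundedUnder_of ⟨1, hle⟩).isCoboundedUnder_ge
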